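/- Let f, g ∈ ℚ_p[x₁,…,x_n] be nonzero polynomials such that there is no constant c ∈ ℚ_p with f = c·g, let D = {x ∈ ℚ_p^n : f(x) = 0 or g(x) = 0}, let Φ : ℚ_p^n → ℂ be a test function, and let Ψ be a standard additive character of ℚ_p. Define E_Φ(z) = ∫_{ℚ_p^n ∖ D} Φ(x)·Ψ(z·f(x)/g(x)) dμ(x) for z ∈ ℚ_p. Then there exist a finite set Γ ⊂ {s ∈ ℂ : Re(s) > 0}, positive integers m_γ for γ ∈ Γ, locally constant functions e_{γ,m} : ℤ_p^× → ℂ for γ ∈ Γ and 1 ≤ m ≤ m_γ, and δ > 0, such that for every z ∈ ℚ_p ∖ {0} with |z|_p < δ: E_Φ(z) − ∫_{ℚ_p^n} Φ(x) dμ(x) = Σ_{γ∈Γ} Σ_{m=1}^{m_γ} e_{γ,m}(ac z) · |z|_p^γ · (ln|z|_p)^{m−1}. -/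

import Mathlib

namespace PadicOsc

set_option linter.unusedSectionVars false
open Filter Topology Set

section Germs
variable {𝕜 : Type*} [NontriviallyNormedField 𝕜]
variable {ι : Type*} [Fintype ι] [DecidableEq ι]

/-- The coordinate projection killing the `i`-th coordinate, as a continuous linear map. -/
noncomputable def killCoord (𝕜 : Type*) [NontriviallyNormedField 𝕜] {ι : Type*} [Fintype ι]
    [DecidableEq ι] (i : ι) : (ι → 𝕜) →L[𝕜] (ι → 𝕜) :=
  ContinuousLinearMap.pi fun j => if j = i then 0 else ContinuousLinearMap.proj j

lemma killCoord_apply (i : ι) (x : ι → 𝕜) : killCoord 𝕜 i x = Function.update x i 0 := by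
  ext j
  by_cases h : j = i
  · subst h; simp [killCoord]
  · simp [killCoord, h]

lemma norm_killCoord_le (i : ι) : ‖killCoord 𝕜 i‖ ≤ 1 := by
  refine ContinuousLinearMap.opNorm_le_bound _ zero_le_one fun x => ?_
  rw [killCoord_apply, one_mul]
  refine (pi_norm_le_iff_of_nonneg (norm_nonneg _)).2 fun j => ?_
  by_cases h : j = i
  · subst h; simp
  · simpa [h] using norm_le_pi_norm x j

lemma exists_division [CompleteSpace 𝕜] {f : (ι → 𝕜) → 𝕜} (hf : AnalyticAt 𝕜 f 0) (i : ι) :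
    ∃ g : (ι → 𝕜) → 𝕜, AnalyticAt 𝕜 g 0 ∧
      ∀ᶠ x in 𝓝 0, f x = f (Function.update x i 0) + x i * g x := by
  obtain ⟨P, r, hP⟩ := hf
  set e : ι → 𝕜 := Pi.single i 1 with he
  have hen : ‖e‖ = 1 := by rw [he, Pi.norm_single, norm_one]
  let c : ∀ (m : ℕ) (j : Fin (m + 1)) (l : Fin m), (ι → 𝕜) →L[𝕜] (ι → 𝕜) := fun m j l =>
    if l.castSucc < j then ContinuousLinearMap.id 𝕜 _ else killCoord 𝕜 i
  let q : FormalMultilinearSeries 𝕜 (ι → 𝕜) 𝕜 := fun m =>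
    ∑ j : Fin (m + 1), ((P (m + 1)).curryMid j e).compContinuousLinearMap (c m j)
  have hcn : ∀ m j l, ‖c m j l‖ ≤ 1 := by
    intro m j l
    simp only [c]
    split_ifs
    · exact ContinuousLinearMap.norm_id_le
    · exact norm_killCoord_le i
  have hqn : ∀ m, ‖q m‖ ≤ (m + 1) * ‖P (m + 1)‖ := by
    intro m
    refine (norm_sum_le _ _).trans ?_
    refine (Finset.sum_le_card_nsmul _ _ ‖P (m + 1)‖ fun j _ => ?_).trans (by simp)
    refine (ContinuousMultilinearMap.norm_compContinuousLinearMap_le _ _).trans ?_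
    have h1 : ‖(P (m + 1)).curryMid j e‖ ≤ ‖P (m + 1)‖ := by
      refine (ContinuousLinearMap.le_opNorm _ _).trans ?_
      rw [hen, mul_one, ContinuousMultilinearMap.norm_curryMid]
    have h2 : ∏ l, ‖c m j l‖ ≤ 1 := Finset.prod_le_one (fun _ _ => norm_nonneg _) fun l _ => hcn m j l
    calc _ ≤ ‖P (m + 1)‖ * 1 := by gcongr
      _ = _ := mul_one _
  have hqx : ∀ m x, x i * q m (fun _ => x) =
      P (m + 1) (fun _ => x) - P (m + 1) (fun _ => killCoord 𝕜 i x) := by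
    intro m x
    have h := (P (m + 1)).toMultilinearMap.map_piecewise_sub_map_piecewise
      (fun _ => x) (fun _ => killCoord 𝕜 i x) (fun _ => 0) Finset.univ
    simp only [Finset.piecewise_univ, Finset.mem_univ, if_true] at h
    rw [ContinuousMultilinearMap.coe_coe] at h
    rw [h]
    simp only [q, sum_apply, Finset.mul_sum]
    refine Finset.sum_congr rfl fun j _ => ?_
    rw [ContinuousMultilinearMap.compContinuousLinearMap_apply,
      ContinuousMultilinearMap.curryMid_apply]
    have h3 : x - killCoord 𝕜 i x = x i • e := by
      rw [killCoord_apply]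
      ext k
      by_cases hk : k = i
      · subst hk; simp [he]
      · simp [he, hk]
    have h4 : (fun l : Fin (m + 1) => if l < j then x else if l = j then x - killCoord 𝕜 i x
        else killCoord 𝕜 i x) = Function.update (j.insertNth e fun l => c m j l x) j (x i • e) := by
      ext1 l
      rcases Fin.eq_self_or_eq_succAbove j l with rfl | ⟨l, rfl⟩
      · simp [h3]
      · simp only [Fin.succAbove_ne, if_false, Function.update_of_ne (Fin.succAbove_ne j l),
          Fin.insertNth_apply_succAbove, c]
        by_cases hl : l.castSucc < j
        · simp [hl, Fin.succAbove_of_castSucc_lt _ _ hl]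
        · have : ¬ j.succAbove l < j := by
            rw [Fin.succAbove_of_le_castSucc _ _ (not_lt.1 hl)]
            exact not_lt.2 ((not_lt.1 hl).trans (Fin.castSucc_lt_succ).le)
          simp [hl, this]
    rw [h4]
    have h5 := (P (m + 1)).map_update_smul (j.insertNth e fun l => c m j l x) j (x i) e
    have h6 : Function.update (j.insertNth e fun l => c m j l x) j e
        = (j.insertNth e fun l => c m j l x : Fin (m + 1) → ι → 𝕜) := by
      ext1 l
      rcases Fin.eq_self_or_eq_succAbove j l with rfl | ⟨l, rfl⟩ <;> simp [Fin.succAbove_ne]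
    rw [h6, smul_eq_mul] at h5
    exact h5.symm
  have hrad : 0 < q.radius := by
    obtain ⟨ρ, hρ0, hρ⟩ := ENNReal.lt_iff_exists_nnreal_btwn.1 (hP.r_pos.trans_le hP.r_le)
    have hρ0 : 0 < ρ := by exact_mod_cast hρ0
    obtain ⟨a, ha, C, hC, hb⟩ := P.norm_mul_pow_le_mul_pow_of_lt_radius hρ
    have ht := (tendsto_self_mul_const_pow_of_lt_one ha.1.le ha.2)
    obtain ⟨B, hB⟩ := ht.bddAbove_range
    have : (ρ : ENNReal) ≤ q.radius := by
      refine q.le_radius_of_bound (C * B / ρ) fun m => ?_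
      rw [le_div_iff₀ (by exact_mod_cast hρ0)]
      have h6 : ((m + 1 : ℕ) : ℝ) * a ^ (m + 1) ≤ B := hB ⟨m + 1, rfl⟩
      calc ‖q m‖ * (ρ : ℝ) ^ m * ρ ≤ ((m + 1) * ‖P (m + 1)‖) * (ρ : ℝ) ^ m * ρ := by
            gcongr; exact hqn m
        _ = (m + 1) * (‖P (m + 1)‖ * (ρ : ℝ) ^ (m + 1)) := by ring
        _ ≤ (m + 1) * (C * a ^ (m + 1)) := mul_le_mul_of_nonneg_left (hb _) (by positivity)
        _ = C * (((m + 1 : ℕ) : ℝ) * a ^ (m + 1)) := by push_cast; ring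
        _ ≤ C * B := by gcongr
    exact lt_of_lt_of_le (by exact_mod_cast hρ0) this
  have hq := q.hasFPowerSeriesOnBall hrad
  refine ⟨q.sum, hq.analyticAt, ?_⟩
  have hb1 : Metric.eball (0 : ι → 𝕜) r ∈ 𝓝 0 := Metric.eball_mem_nhds _ hP.r_pos
  have hb2 : Metric.eball (0 : ι → 𝕜) q.radius ∈ 𝓝 0 := Metric.eball_mem_nhds _ hrad
  have hb3 : ∀ᶠ x in 𝓝 (0 : ι → 𝕜), killCoord 𝕜 i x ∈ Metric.eball (0 : ι → 𝕜) r :=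
    (killCoord 𝕜 i).continuous.continuousAt.eventually_mem (by simpa using hb1)
  filter_upwards [hb1, hb2, hb3] with x hx1 hx2 hx3
  have s1 := hP.hasSum hx1
  have s2 := hP.hasSum hx3
  have s3 := (hq.hasSum hx2).mul_left (x i)
  rw [zero_add] at s1 s2 s3
  have s4 := s1.sub s2
  have s5 := (hasSum_nat_add_iff' 1).2 s4
  simp only [Finset.range_one, Finset.sum_singleton] at s5
  have h0 : P 0 (fun _ => x) - P 0 (fun _ => killCoord 𝕜 i x) = 0 := by
    rw [sub_eq_zero]; congr 1; ext j; exact j.elim0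
  rw [h0, sub_zero] at s5
  simp_rw [hqx] at s3
  have := s3.unique s5
  rw [← killCoord_apply, this]; ring

end Germs

section Germs
variable {𝕜 : Type*} [NontriviallyNormedField 𝕜]
variable {ι : Type*} [Fintype ι] [DecidableEq ι]

lemma analyticAt_coord (i : ι) (a : ι → 𝕜) : AnalyticAt 𝕜 (fun x : ι → 𝕜 => x i) a :=
  (ContinuousLinearMap.proj (R := 𝕜) (φ := fun _ : ι => 𝕜) i).analyticAt a

lemma analyticAt_update {E : Type*} [NormedAddCommGroup E] [NormedSpace 𝕜 E]
    {s : E → ι → 𝕜} {ψ : E → 𝕜} {a : E} (hs : AnalyticAt 𝕜 s a)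
    (hψ : AnalyticAt 𝕜 ψ a) (i : ι) : AnalyticAt 𝕜 (fun x => Function.update (s x) i (ψ x)) a := by
  rw [analyticAt_pi_iff] at hs ⊢
  intro j
  by_cases h : j = i
  · subst h; simpa using hψ
  · simpa [h] using hs j

lemma eqOn_ball_zero_of_eventuallyEq {E : Type*} [NormedAddCommGroup E] [NormedSpace 𝕜 E]
    {g : E → 𝕜} {P : FormalMultilinearSeries 𝕜 E 𝕜} {a : E} {r : ENNReal}
    (hg : HasFPowerSeriesOnBall g P a r) (h : g =ᶠ[𝓝 a] 0) {x : E} (hx : x ∈ Metric.eball a r) :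
    g x = 0 := by
  have h0 : HasFPowerSeriesAt 0 P a := hg.hasFPowerSeriesAt.congr h
  have := hg.hasSum (y := x - a) (by simpa [edist_eq_enorm_sub] using hx)
  simp only [h0.apply_eq_zero, add_sub_cancel] at this
  exact this.unique hasSum_zero

lemma eventuallyEq_zero_or_of_mul [CompleteSpace 𝕜] {E : Type*} [NormedAddCommGroup E]
    [NormedSpace 𝕜 E]
    {f g : E → 𝕜} (hf : AnalyticAt 𝕜 f 0) (hg : AnalyticAt 𝕜 g 0)
    (h : (fun x => f x * g x) =ᶠ[𝓝 0] 0) : f =ᶠ[𝓝 0] 0 ∨ g =ᶠ[𝓝 0] 0 := by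
  by_contra! hcon
  obtain ⟨hf0, hg0⟩ := hcon
  obtain ⟨P, r, hP⟩ := hg
  obtain ⟨ρ, hρ0, hρ⟩ := ENNReal.lt_iff_exists_nnreal_btwn.1 hP.r_pos
  have hρ0 : 0 < ρ := by exact_mod_cast hρ0
  have hball : Metric.ball (0 : E) (ρ / 3) ∈ 𝓝 0 := Metric.ball_mem_nhds _ (by positivity)
  have hfr : ∃ᶠ x in 𝓝 (0 : E), f x ≠ 0 := by
    intro hc; apply hf0; filter_upwards [hc] with x hx; simpa using hx
  have hev := (eventually_eventually_nhds.2 h).and (hf.eventually_continuousAt.and hball)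
  obtain ⟨a, hfa, h1, h2, h3⟩ := (hfr.and_eventually hev).exists
  have hga : g =ᶠ[𝓝 a] 0 := by
    filter_upwards [h1, h2.eventually_ne hfa] with x hx hx'
    simpa [hx'] using hx
  have ha' : (‖a‖₊ : ENNReal) < r := by
    refine lt_of_lt_of_le ?_ hρ.le
    have h3' : ‖a‖₊ < ρ := by
      rw [← NNReal.coe_lt_coe]
      have h3' : ‖a‖ < ρ / 3 := by simpa using h3
      have : (0 : ℝ) < ρ := hρ0
      push_cast; linarith
    exact_mod_cast h3'
  have hch := hP.changeOrigin ha'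
  rw [zero_add] at hch
  apply hg0
  filter_upwards [hball] with x hx
  apply eqOn_ball_zero_of_eventuallyEq hch hga
  have h5 : ‖x‖ < ρ / 3 := by simpa using hx
  have h6 : ‖x - a‖₊ + ‖a‖₊ < ρ := by
    rw [← NNReal.coe_lt_coe]
    push_cast
    have h3' : ‖a‖ < ρ / 3 := by simpa using h3
    linarith [norm_sub_le x a]
  rw [Metric.mem_eball, edist_eq_enorm_sub, lt_tsub_iff_right]
  exact lt_of_lt_of_le (by rw [enorm_eq_nnnorm]; exact_mod_cast h6) hρ.le

end Germs

section Germs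
variable {𝕜 : Type*} [NontriviallyNormedField 𝕜]
variable {ι : Type*} [Fintype ι] [DecidableEq ι]

/-- The monomial `x ^ k`. -/
def monom (k : ι → ℕ) (x : ι → 𝕜) : 𝕜 := ∏ i, x i ^ k i

lemma monom_add (k l : ι → ℕ) (x : ι → 𝕜) : monom (k + l) x = monom k x * monom l x := by
  simp [monom, pow_add, Finset.prod_mul_distrib]

lemma monom_zero (x : ι → 𝕜) : monom 0 x = 1 := by simp [monom]

lemma monom_single (i : ι) (e : ℕ) (x : ι → 𝕜) : monom (Pi.single i e) x = x i ^ e := by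
  rw [monom, Finset.prod_eq_single i]
  · simp
  · intro b _ hb; simp [hb]
  · simp

lemma monom_smul (e : ℕ) (k : ι → ℕ) (x : ι → 𝕜) : monom (e • k) x = monom k x ^ e := by
  simp [monom, mul_comm e, pow_mul, Finset.prod_pow]

lemma analyticAt_monom (k : ι → ℕ) (a : ι → 𝕜) : AnalyticAt 𝕜 (monom k) a :=
  Finset.analyticAt_fun_prod _ fun i _ => (analyticAt_coord i a).pow _

lemma monom_ne_zero {k : ι → ℕ} {x : ι → 𝕜} (h : ∀ i, x i = 0 → k i = 0) : monom k x ≠ 0 :=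
  Finset.prod_ne_zero_iff.2 fun i _ => by
    by_cases hx : x i = 0
    · simp [h i hx]
    · exact pow_ne_zero _ hx

lemma monom_eq_zero {k : ι → ℕ} {x : ι → 𝕜} {i : ι} (hx : x i = 0) (hk : k i ≠ 0) :
    monom k x = 0 :=
  Finset.prod_eq_zero (Finset.mem_univ i) (by simp [hx, hk])

/-- The germ of `F` at the origin is a monomial times a unit. -/
def MonUnit (F : (ι → 𝕜) → 𝕜) : Prop :=
  ∃ (k : ι → ℕ) (u : (ι → 𝕜) → 𝕜), AnalyticAt 𝕜 u 0 ∧ u 0 ≠ 0 ∧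
    F =ᶠ[𝓝 0] fun x => monom k x * u x

/-- Divisibility of analytic germs at the origin. -/
def GDvd (a B : (ι → 𝕜) → 𝕜) : Prop :=
  ∃ h : (ι → 𝕜) → 𝕜, AnalyticAt 𝕜 h 0 ∧ B =ᶠ[𝓝 0] fun x => a x * h x

lemma MonUnit.congr {F G : (ι → 𝕜) → 𝕜} (hF : MonUnit F) (h : G =ᶠ[𝓝 0] F) : MonUnit G := by
  obtain ⟨k, u, hu, hu0, he⟩ := hF
  exact ⟨k, u, hu, hu0, h.trans he⟩

lemma MonUnit.mul {F G : (ι → 𝕜) → 𝕜} (hF : MonUnit F) (hG : MonUnit G) :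
    MonUnit fun x => F x * G x := by
  obtain ⟨k, u, hu, hu0, he⟩ := hF
  obtain ⟨l, v, hv, hv0, he'⟩ := hG
  refine ⟨k + l, fun x => u x * v x, hu.mul hv, mul_ne_zero hu0 hv0, ?_⟩
  filter_upwards [he, he'] with x h1 h2
  rw [h1, h2, monom_add]; ring

lemma MonUnit.of_unit {u : (ι → 𝕜) → 𝕜} (hu : AnalyticAt 𝕜 u 0) (hu0 : u 0 ≠ 0) : MonUnit u :=
  ⟨0, u, hu, hu0, .of_forall fun x => by simp [monom_zero]⟩

lemma MonUnit.monom (k : ι → ℕ) : MonUnit (PadicOsc.monom k : (ι → 𝕜) → 𝕜) :=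
  ⟨k, fun _ => 1, analyticAt_const, one_ne_zero, .of_forall fun x => by simp⟩

lemma MonUnit.coord_pow (i : ι) (e : ℕ) : MonUnit fun x : ι → 𝕜 => x i ^ e :=
  (MonUnit.monom (Pi.single i e)).congr (.of_forall fun x => (monom_single i e x).symm)

lemma MonUnit.coord (i : ι) : MonUnit fun x : ι → 𝕜 => x i := by
  simpa using MonUnit.coord_pow (𝕜 := 𝕜) i 1

lemma MonUnit.analyticAt {F : (ι → 𝕜) → 𝕜} (hF : MonUnit F) : AnalyticAt 𝕜 F 0 := by
  obtain ⟨k, u, hu, hu0, he⟩ := hF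
  exact ((analyticAt_monom k 0).mul hu).congr he.symm

lemma exists_point_of_eventually {P : (ι → 𝕜) → Prop} (h : ∀ᶠ x in 𝓝 0, P x) (T : Set ι) :
    ∃ x, P x ∧ ∀ i, x i = 0 ↔ i ∈ T := by
  classical
  have ht : Tendsto (fun t : 𝕜 => fun i => if i ∈ T then 0 else t) (𝓝[≠] 0) (𝓝 (0 : ι → 𝕜)) := by
    rw [tendsto_pi_nhds]
    intro i
    by_cases hi : i ∈ T
    · simp [hi]
    · simp only [hi, if_false]
      exact tendsto_nhdsWithin_of_tendsto_nhds tendsto_id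
  obtain ⟨t, h1, h2⟩ := ((ht.eventually h).and self_mem_nhdsWithin).exists
  refine ⟨_, h1, fun i => ?_⟩
  by_cases hi : i ∈ T
  · simp [hi]
  · simpa [hi] using h2

lemma MonUnit.not_eventually_zero {F : (ι → 𝕜) → 𝕜} (hF : MonUnit F) : ¬ F =ᶠ[𝓝 0] 0 := by
  obtain ⟨k, u, hu, hu0, he⟩ := hF
  intro h
  obtain ⟨x, ⟨h1, h2, h3⟩, h4⟩ :=
    exists_point_of_eventually (h.and (he.and (hu.continuousAt.eventually_ne hu0))) ∅
  rw [h2] at h1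
  exact mul_ne_zero (monom_ne_zero fun i hi => absurd ((h4 i).1 hi) (by simp)) h3 h1

lemma continuous_update_const (i : ι) (c : 𝕜) :
    Continuous fun x : ι → 𝕜 => Function.update x i c :=
  continuous_id.update i continuous_const

lemma tendsto_update_zero (i : ι) :
    Tendsto (fun x : ι → 𝕜 => Function.update x i 0) (𝓝 0) (𝓝 0) := by
  have := (continuous_update_const (𝕜 := 𝕜) i 0).tendsto 0
  simpa using this

lemma AnalyticAt.comp_kill {f : (ι → 𝕜) → 𝕜} (hf : AnalyticAt 𝕜 f 0) (i : ι) :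
    AnalyticAt 𝕜 (fun x => f (Function.update x i 0)) 0 := by
  refine AnalyticAt.fun_comp_of_eq hf (y := 0) ?_ (by simp)
  exact analyticAt_update analyticAt_id analyticAt_const i

variable [CompleteSpace 𝕜]

lemma exists_coord_factor {f : (ι → 𝕜) → 𝕜} (hf : AnalyticAt 𝕜 f 0) {i : ι}
    (h : (fun x => f (Function.update x i 0)) =ᶠ[𝓝 0] 0) :
    ∃ g : (ι → 𝕜) → 𝕜, AnalyticAt 𝕜 g 0 ∧ f =ᶠ[𝓝 0] fun x => x i * g x := by
  obtain ⟨g, hg, he⟩ := exists_division hf i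
  refine ⟨g, hg, ?_⟩
  filter_upwards [he, h] with x h1 h2
  rw [h1, h2]; simp

lemma eventuallyEq_of_mul_left {f g h : (ι → 𝕜) → 𝕜} (hf : AnalyticAt 𝕜 f 0)
    (hg : AnalyticAt 𝕜 g 0) (hh : AnalyticAt 𝕜 h 0) (hf0 : ¬ f =ᶠ[𝓝 0] 0)
    (he : (fun x => f x * g x) =ᶠ[𝓝 0] fun x => f x * h x) : g =ᶠ[𝓝 0] h := by
  have := eventuallyEq_zero_or_of_mul hf (hg.sub hh) (by
    filter_upwards [he] with x hx
    simp [mul_sub, hx])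
  rcases this with h1 | h1
  · exact absurd h1 hf0
  · filter_upwards [h1] with x hx
    simpa [sub_eq_zero] using hx

lemma MonUnit.of_mul {a h : (ι → 𝕜) → 𝕜} (ha : AnalyticAt 𝕜 a 0)
    (hh : AnalyticAt 𝕜 h 0) (H : MonUnit fun x => a x * h x) : MonUnit a := by
  obtain ⟨k, u, hu, hu0, he⟩ := H
  induction hN : ∑ i, k i generalizing k a h with
  | zero =>
    have hk : k = 0 := by ext i; simpa using (Finset.sum_eq_zero_iff.1 hN) i (Finset.mem_univ i)
    subst hk
    refine .of_unit ha fun h0 => hu0 ?_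
    have := he.eq_of_nhds
    simpa [h0, monom_zero] using this.symm
  | succ N ih =>
    obtain ⟨i, hi⟩ : ∃ i, k i ≠ 0 := by
      by_contra! hc
      simp [hc] at hN
    obtain ⟨l, rfl⟩ : ∃ l : ι → ℕ, k = Pi.single i 1 + l := by
      refine ⟨k - Pi.single i 1, (add_tsub_cancel_of_le ?_).symm⟩
      intro j
      by_cases hj : j = i
      · subst hj; simp; omega
      · simp [hj]
    have hNl : ∑ i, l i = N := by
      simp [Finset.sum_add_distrib] at hN; omega
    have hz : (fun x => a (Function.update x i 0) * h (Function.update x i 0)) =ᶠ[𝓝 0] 0 := by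
      filter_upwards [(tendsto_update_zero i).eventually he] with x hx
      rw [hx, monom_eq_zero (i := i)] <;> simp
    have hcancel : ∀ b : (ι → 𝕜) → 𝕜, AnalyticAt 𝕜 b 0 →
        (fun x => a x * h x) =ᶠ[𝓝 0] (fun x => x i * b x) →
        b =ᶠ[𝓝 0] fun x => PadicOsc.monom l x * u x := by
      intro b hb hbe
      refine eventuallyEq_of_mul_left (analyticAt_coord i 0) hb ((analyticAt_monom l 0).mul hu)
        (MonUnit.coord i).not_eventually_zero ?_
      filter_upwards [hbe, he] with x h1 h2
      rw [← h1, h2, monom_add, monom_single]; ring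
    rcases eventuallyEq_zero_or_of_mul (AnalyticAt.comp_kill ha i) (AnalyticAt.comp_kill hh i) hz with h1 | h1
    · obtain ⟨a', ha', hae⟩ := exists_coord_factor ha h1
      have := ih ha' hh l (hcancel _ (ha'.mul hh) (by
        filter_upwards [hae] with x hx; rw [hx]; ring)) hNl
      exact ((MonUnit.coord i).mul this).congr hae
    · obtain ⟨h', hh', hhe⟩ := exists_coord_factor hh h1
      exact ih ha hh' l (hcancel _ (ha.mul hh') (by
        filter_upwards [hhe] with x hx; rw [hx]; ring)) hNl

lemma MonUnit.of_dvd {a B : (ι → 𝕜) → 𝕜} (ha : AnalyticAt 𝕜 a 0) (hB : MonUnit B)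
    (h : GDvd a B) : MonUnit a := by
  obtain ⟨h, hh, he⟩ := h
  exact (hB.congr he.symm).of_mul ha hh

lemma exponents_comparable {α β : ι → ℕ} {u v c : (ι → 𝕜) → 𝕜} (hu : AnalyticAt 𝕜 u 0)
    (hu0 : u 0 ≠ 0) (hv : AnalyticAt 𝕜 v 0) (hv0 : v 0 ≠ 0) (hc : c =ᶠ[𝓝 0] 0 ∨ MonUnit c)
    (he : (fun x => monom α x * u x - monom β x * v x) =ᶠ[𝓝 0] c) : α ≤ β ∨ β ≤ α := by
  by_contra! hcon
  obtain ⟨⟨i, hi⟩, ⟨j, hj⟩⟩ : (∃ i, β i < α i) ∧ ∃ j, α j < β j := by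
    simpa [Pi.le_def] using hcon
  set δ := α ⊓ β with hδ
  obtain ⟨α', hα⟩ : ∃ α', α = δ + α' := ⟨α - δ, (add_tsub_cancel_of_le inf_le_left).symm⟩
  obtain ⟨β', hβ⟩ : ∃ β', β = δ + β' := ⟨β - δ, (add_tsub_cancel_of_le inf_le_right).symm⟩
  have hd : ∀ l, α' l = 0 ∨ β' l = 0 := by
    intro l
    have h1 := congrFun hα l
    have h2 := congrFun hβ l
    have h3 : δ l = min (α l) (β l) := rfl
    simp only [Pi.add_apply] at h1 h2
    omega
  have hi' : α' i ≠ 0 ∧ β' i = 0 := by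
    have h1 := congrFun hα i
    have h2 := congrFun hβ i
    have := hd i
    simp only [Pi.add_apply] at h1 h2
    omega
  have hj' : β' j ≠ 0 ∧ α' j = 0 := by
    have h1 := congrFun hα j
    have h2 := congrFun hβ j
    have := hd j
    simp only [Pi.add_apply] at h1 h2
    omega
  set h : (ι → 𝕜) → 𝕜 := fun x => monom α' x * u x - monom β' x * v x with hh
  have hha : AnalyticAt 𝕜 h 0 := ((analyticAt_monom _ 0).mul hu).sub ((analyticAt_monom _ 0).mul hv)
  have hce : c =ᶠ[𝓝 0] fun x => monom δ x * h x := by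
    filter_upwards [he] with x hx
    rw [← hx, hα, hβ, monom_add, monom_add, hh]; ring
  have hun := (hu.continuousAt.eventually_ne hu0).and (hv.continuousAt.eventually_ne hv0)
  have hnz : ¬ h =ᶠ[𝓝 0] 0 := by
    intro hz
    obtain ⟨y, ⟨h1, h2, h3⟩, h4⟩ := exists_point_of_eventually (hz.and hun) {i}
    rw [hh] at h1
    simp only [Pi.zero_apply] at h1
    rw [monom_eq_zero ((h4 i).2 rfl) hi'.1, zero_mul, zero_sub, neg_eq_zero] at h1
    exact mul_ne_zero (monom_ne_zero fun l hl => by rw [(h4 l).1 hl]; exact hi'.2) h3 h1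
  have hcase : h =ᶠ[𝓝 0] 0 ∨ MonUnit h := by
    rcases hc with hc | hc
    · left
      refine eventuallyEq_of_mul_left (analyticAt_monom δ 0) hha analyticAt_const
        (MonUnit.monom δ).not_eventually_zero ?_
      filter_upwards [hc, hce] with x h1 h2
      rw [← h2, h1]; simp
    · right
      have := hc.congr hce.symm
      simp_rw [mul_comm (monom δ _)] at this
      exact this.of_mul hha (analyticAt_monom δ 0)
  rcases hcase with hz | ⟨γ, w, hw, hw0, hge⟩
  · exact hnz hz
  · by_cases hγ : γ = 0
    · have := hge.eq_of_nhds
      subst hγ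
      rw [monom_zero, one_mul] at this
      rw [hh] at this
      simp only at this
      rw [monom_eq_zero (i := i) rfl hi'.1, monom_eq_zero (i := j) rfl hj'.1] at this
      apply hw0
      simpa using this.symm
    · obtain ⟨k, hk⟩ : ∃ k, γ k ≠ 0 := by
        by_contra! hcc
        exact hγ (funext hcc)
      rcases hd k with hk0 | hk0
      · obtain ⟨y, ⟨h1, h2, h3⟩, h4⟩ := exists_point_of_eventually (hge.and hun) {j, k}
        rw [hh] at h1
        simp only at h1
        rw [monom_eq_zero (i := j) ((h4 j).2 (by simp)) hj'.1,
          monom_eq_zero (i := k) ((h4 k).2 (by simp)) hk, zero_mul, zero_mul, sub_zero] at h1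
        refine mul_ne_zero (monom_ne_zero fun l hl => ?_) h2 h1
        rcases (h4 l).1 hl with rfl | rfl
        · exact hj'.2
        · exact hk0
      · obtain ⟨y, ⟨h1, h2, h3⟩, h4⟩ := exists_point_of_eventually (hge.and hun) {i, k}
        rw [hh] at h1
        simp only at h1
        rw [monom_eq_zero (i := i) ((h4 i).2 (by simp)) hi'.1,
          monom_eq_zero (i := k) ((h4 k).2 (by simp)) hk, zero_mul, zero_mul, zero_sub,
          neg_eq_zero] at h1
        refine mul_ne_zero (monom_ne_zero fun l hl => ?_) h3 h1
        rcases (h4 l).1 hl with rfl | rfl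
        · exact hi'.2
        · exact hk0

end Germs

section Order
variable {𝕜 : Type*} [NontriviallyNormedField 𝕜]

/-- The one-variable germ `φ` vanishes to order exactly `j` at the origin. -/
def HasOrder (j : ℕ) (φ : 𝕜 → 𝕜) : Prop :=
  ∃ ψ : 𝕜 → 𝕜, AnalyticAt 𝕜 ψ 0 ∧ ψ 0 ≠ 0 ∧ φ =ᶠ[𝓝 0] fun t => t ^ j * ψ t

lemma HasOrder.analyticAt {j : ℕ} {φ : 𝕜 → 𝕜} (h : HasOrder j φ) : AnalyticAt 𝕜 φ 0 := by
  obtain ⟨ψ, h1, -, h3⟩ := h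
  exact ((analyticAt_id.pow j).mul h1).congr h3.symm

lemma HasOrder.order_eq {j : ℕ} {φ : 𝕜 → 𝕜} (h : HasOrder j φ) : analyticOrderAt φ 0 = j := by
  rw [h.analyticAt.analyticOrderAt_eq_natCast]
  obtain ⟨ψ, h1, h2, h3⟩ := h
  exact ⟨ψ, h1, h2, by simpa [EventuallyEq] using h3⟩

lemma HasOrder.unique {i j : ℕ} {φ : 𝕜 → 𝕜} (h : HasOrder i φ) (h' : HasOrder j φ) : i = j := by
  have := h.order_eq.symm.trans h'.order_eq
  exact_mod_cast this

lemma exists_hasOrder {φ : 𝕜 → 𝕜} (hφ : AnalyticAt 𝕜 φ 0) (h : ¬ φ =ᶠ[𝓝 0] 0) :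
    ∃ j, HasOrder j φ := by
  obtain ⟨n, g, h1, h2, h3⟩ := hφ.exists_eventuallyEq_pow_smul_nonzero_iff.2 h
  exact ⟨n, g, h1, h2, by simpa [EventuallyEq] using h3⟩

lemma exists_hasOrder_lt {φ ψ : 𝕜 → 𝕜} {c : ℕ → 𝕜} {d : ℕ} (hψ : AnalyticAt 𝕜 ψ 0)
    (he : φ =ᶠ[𝓝 0] fun t => ∑ i ∈ Finset.range d, c i * t ^ i + t ^ d * ψ t)
    (hc : ∃ i < d, c i ≠ 0) : ∃ j < d, HasOrder j φ := by
  classical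
  have hc' : ∃ i, i < d ∧ c i ≠ 0 := hc
  obtain ⟨h1, h2⟩ := Nat.find_spec hc'
  have hmin : ∀ i < Nat.find hc', c i = 0 := fun i hi => by
    have := Nat.find_min hc' hi
    by_contra h
    exact this ⟨hi.trans h1, h⟩
  generalize Nat.find hc' = j at h1 h2 hmin
  obtain ⟨m, rfl⟩ : ∃ m, d = j + (1 + m) := ⟨d - j - 1, by omega⟩
  refine ⟨j, h1, fun t => ∑ i ∈ Finset.range (1 + m), c (j + i) * t ^ i + t ^ (1 + m) * ψ t,
    ?_, ?_, ?_⟩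
  · exact (Finset.analyticAt_fun_sum _ fun i _ => analyticAt_const.mul (analyticAt_id.pow i)).add
      ((analyticAt_id.pow _).mul hψ)
  · simpa [Nat.add_comm 1 m, Finset.sum_range_succ'] using h2
  · filter_upwards [he] with t ht
    rw [ht, Finset.sum_range_add, Finset.sum_eq_zero (s := Finset.range j), zero_add, mul_add,
      Finset.mul_sum]
    · congr 1
      · exact Finset.sum_congr rfl fun i _ => by ring
      · ring
    · intro i hi
      rw [hmin i (Finset.mem_range.1 hi), zero_mul]

lemma HasOrder.coeff_eq_zero {φ ψ : 𝕜 → 𝕜} {c : ℕ → 𝕜} {d : ℕ} (h : HasOrder d φ)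
    (hψ : AnalyticAt 𝕜 ψ 0)
    (he : φ =ᶠ[𝓝 0] fun t => ∑ i ∈ Finset.range d, c i * t ^ i + t ^ d * ψ t) :
    (∀ i < d, c i = 0) ∧ ψ 0 ≠ 0 := by
  have h1 : ∀ i < d, c i = 0 := by
    by_contra! hc
    obtain ⟨j, hj, hj'⟩ := exists_hasOrder_lt hψ he hc
    exact hj.ne (hj'.unique h)
  refine ⟨h1, fun h0 => ?_⟩
  have he' : φ =ᶠ[𝓝 0] fun t => ∑ i ∈ Finset.range (d + 1), (0 : 𝕜) * t ^ i
      + t ^ d * ψ t := by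
    filter_upwards [he] with t ht
    rw [ht, Finset.sum_eq_zero, Finset.sum_eq_zero]
    · simp
    · intro i hi
      rw [h1 i (Finset.mem_range.1 hi), zero_mul]
  by_cases hz : φ =ᶠ[𝓝 0] 0
  · have h2 := h.order_eq
    rw [(analyticOrderAt_eq_top).2 hz] at h2
    exact absurd h2 (by simp)
  by_cases hz' : ψ =ᶠ[𝓝 0] 0
  · exact hz (by filter_upwards [he', hz'] with t h1 h2; rw [h1, h2]; simp)
  obtain ⟨m, χ, h3, h4, h5⟩ := exists_hasOrder hψ hz'
  have hm : m ≠ 0 := by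
    rintro rfl
    have := h5.eq_of_nhds
    rw [h0] at this
    exact h4 (by simpa using this.symm)
  have : HasOrder (d + m) φ := ⟨χ, h3, h4, by
    filter_upwards [he', h5] with t h6 h7
    rw [h6, h7]; simp; ring⟩
  have := this.unique h
  omega

end Order

section Germs
variable {𝕜 : Type*} [NontriviallyNormedField 𝕜]
variable {ι : Type*} [Fintype ι] [DecidableEq ι]

/-- Setting to zero the coordinates outside `S`. -/
noncomputable def restrictTo (S : Finset ι) : (ι → 𝕜) →L[𝕜] (ι → 𝕜) :=
  ContinuousLinearMap.pi fun j => if j ∈ S then ContinuousLinearMap.proj j else 0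

lemma restrictTo_apply (S : Finset ι) (x : ι → 𝕜) (i : ι) :
    restrictTo S x i = if i ∈ S then x i else 0 := by
  by_cases h : i ∈ S <;> simp [restrictTo, h]

lemma dependsOn_comp_restrictTo {β : Type*} (g : (ι → 𝕜) → β) (S : Finset ι) :
    DependsOn (fun x => g (restrictTo S x)) (S : Set ι) := by
  intro x y h
  simp only
  congr 1
  ext i
  rw [restrictTo_apply, restrictTo_apply]
  split_ifs with hi
  · exact h i hi
  · rfl

lemma DependsOn.apply_restrictTo {β : Type*} {f : (ι → 𝕜) → β} {S : Finset ι}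
    (hf : DependsOn f (S : Set ι)) (x : ι → 𝕜) : f (restrictTo S x) = f x :=
  hf fun i hi => by rw [restrictTo_apply, if_pos (by simpa using hi)]

lemma AnalyticAt.comp_restrictTo {f : (ι → 𝕜) → 𝕜} (hf : AnalyticAt 𝕜 f 0) (S : Finset ι) :
    AnalyticAt 𝕜 (fun x => f (restrictTo S x)) 0 :=
  AnalyticAt.fun_comp_of_eq hf ((restrictTo (𝕜 := 𝕜) S).analyticAt 0) (map_zero _)

lemma tendsto_restrictTo (S : Finset ι) :
    Tendsto (restrictTo S : (ι → 𝕜) → ι → 𝕜) (𝓝 0) (𝓝 0) := by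
  simpa using (restrictTo (𝕜 := 𝕜) S).continuous.tendsto 0

variable [CompleteSpace 𝕜]

lemma exists_division_dependsOn {f : (ι → 𝕜) → 𝕜} (hf : AnalyticAt 𝕜 f 0) {S : Finset ι}
    (hS : DependsOn f (S : Set ι)) {k : ι} (hk : k ∈ S) :
    ∃ g : (ι → 𝕜) → 𝕜, AnalyticAt 𝕜 g 0 ∧ DependsOn g (S : Set ι) ∧
      f =ᶠ[𝓝 0] fun x => f (Function.update x k 0) + x k * g x := by
  obtain ⟨g, hg, he⟩ := exists_division hf k
  refine ⟨fun x => g (restrictTo S x), AnalyticAt.comp_restrictTo hg S,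
    dependsOn_comp_restrictTo g S, ?_⟩
  filter_upwards [(tendsto_restrictTo S).eventually he] with x hx
  rw [DependsOn.apply_restrictTo hS, restrictTo_apply, if_pos hk] at hx
  rw [hx]
  congr 1
  refine hS fun i hi => ?_
  by_cases h : i = k
  · subst h; simp
  · simp only [ne_eq, h, not_false_eq_true, Function.update_of_ne]
    rw [restrictTo_apply, if_pos (by simpa using hi)]

lemma exists_expansion {f : (ι → 𝕜) → 𝕜} (hf : AnalyticAt 𝕜 f 0) {S : Finset ι}
    (hS : DependsOn f (S : Set ι)) {k : ι} (hk : k ∈ S) (d : ℕ) :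
    ∃ (a : ℕ → (ι → 𝕜) → 𝕜) (U : (ι → 𝕜) → 𝕜),
      (∀ i, AnalyticAt 𝕜 (a i) 0) ∧ (∀ i, DependsOn (a i) (S.erase k : Set ι)) ∧
      AnalyticAt 𝕜 U 0 ∧ DependsOn U (S : Set ι) ∧
      f =ᶠ[𝓝 0] fun x => ∑ i ∈ Finset.range d, a i x * x k ^ i + x k ^ d * U x := by
  induction d with
  | zero =>
    exact ⟨fun _ _ => 0, f, fun _ => analyticAt_const, fun _ _ _ _ => rfl, hf, hS,
      .of_forall fun x => by simp⟩
  | succ d ih =>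
    obtain ⟨a, U, h1, h2, h3, h4, h5⟩ := ih
    obtain ⟨V, h6, h7, h8⟩ := exists_division_dependsOn h3 h4 hk
    refine ⟨fun i => if i = d then fun x => U (Function.update x k 0) else a i, V, ?_, ?_, h6, h7, ?_⟩
    · intro i
      by_cases hi : i = d
      · simpa [hi] using AnalyticAt.comp_kill h3 k
      · simpa [hi] using h1 i
    · intro i
      by_cases hi : i = d
      · simp only [hi, if_true]
        intro x y hxy
        refine h4 fun j hj => ?_
        by_cases hjk : j = k
        · subst hjk; simp
        · simpa [hjk] using hxy j (by simpa [hjk] using hj)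
      · simpa [hi] using h2 i
    · filter_upwards [h5, h8] with x hx hx'
      have hs : ∑ i ∈ Finset.range d, (if i = d then fun x => U (Function.update x k 0) else a i) x
          * x k ^ i = ∑ i ∈ Finset.range d, a i x * x k ^ i :=
        Finset.sum_congr rfl fun i hi => by rw [if_neg (Finset.mem_range.1 hi).ne]
      rw [hx, Finset.sum_range_succ, hs, if_pos rfl, hx']
      ring

end Germs

section Germs
variable {𝕜 : Type*} [NontriviallyNormedField 𝕜]
variable {ι : Type*} [Fintype ι] [DecidableEq ι]

/-- The partial derivative in the direction of the `k`-th coordinate. -/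
noncomputable def dirD (k : ι) (F : (ι → 𝕜) → 𝕜) (x : ι → 𝕜) : 𝕜 :=
  deriv (fun t => F (x + Pi.single k t)) 0

lemma hasDerivAt_line {F : (ι → 𝕜) → 𝕜} {x : ι → 𝕜} (hF : DifferentiableAt 𝕜 F x) (k : ι) :
    HasDerivAt (fun t => F (x + Pi.single k t)) (fderiv 𝕜 F x (Pi.single k 1)) 0 := by
  have h1 : HasDerivAt (fun t : 𝕜 => x + Pi.single k t) (Pi.single k (1 : 𝕜)) 0 := by
    have := ((hasDerivAt_id (0 : 𝕜)).smul_const (Pi.single k (1 : 𝕜) : ι → 𝕜)).const_add x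
    simp only [id, one_smul] at this
    refine this.congr_of_eventuallyEq (.of_forall fun t => ?_)
    simp [← Pi.single_smul]
  exact hF.hasFDerivAt.comp_hasDerivAt_of_eq 0 h1 (by simp)

lemma hasDerivAt_dirD {F : (ι → 𝕜) → 𝕜} {x : ι → 𝕜} (hF : DifferentiableAt 𝕜 F x) (k : ι) :
    HasDerivAt (fun t => F (x + Pi.single k t)) (dirD k F x) 0 := by
  rw [dirD, (hasDerivAt_line hF k).deriv]
  exact hasDerivAt_line hF k

lemma AnalyticAt.dirD [CompleteSpace 𝕜] {F : (ι → 𝕜) → 𝕜} {x : ι → 𝕜} (hF : AnalyticAt 𝕜 F x)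
    (k : ι) : AnalyticAt 𝕜 (dirD k F) x := by
  have h1 : AnalyticAt 𝕜 (fun y => fderiv 𝕜 F y (Pi.single k 1)) x :=
    ((ContinuousLinearMap.apply 𝕜 𝕜 (Pi.single k (1 : 𝕜) : ι → 𝕜)).analyticAt _).fun_comp hF.fderiv
  refine h1.congr ?_
  filter_upwards [hF.eventually_analyticAt] with y hy
  exact (hasDerivAt_line hy.differentiableAt k).deriv.symm

lemma tendsto_line (x : ι → 𝕜) (k : ι) :
    Tendsto (fun t : 𝕜 => x + Pi.single k t) (𝓝 0) (𝓝 x) := by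
  have : Continuous (fun t : 𝕜 => x + Pi.single k t) :=
    continuous_const.add (continuous_single (A := fun _ : ι => 𝕜) k)
  simpa using this.tendsto 0

lemma dirD_congr {F G : (ι → 𝕜) → 𝕜} {x : ι → 𝕜} (h : F =ᶠ[𝓝 x] G) (k : ι) :
    dirD k F =ᶠ[𝓝 x] dirD k G := by
  filter_upwards [eventually_eventually_nhds.2 h] with y hy
  exact Filter.EventuallyEq.deriv_eq ((tendsto_line y k).eventually hy)

lemma DependsOn.dirD {F : (ι → 𝕜) → 𝕜} {S : Set ι} (h : DependsOn F S) (k : ι) :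
    DependsOn (dirD k F) S := by
  intro x y hxy
  rw [PadicOsc.dirD, PadicOsc.dirD]
  congr 1
  ext t
  exact h fun i hi => by simp [hxy i hi]

lemma dirD_expansion_step [CompleteSpace 𝕜] {F U : (ι → 𝕜) → 𝕜} {a : ℕ → (ι → 𝕜) → 𝕜} {k : ι}
    {j : ℕ} (ha : ∀ i, DependsOn (a i) ({k}ᶜ : Set ι)) (hU : AnalyticAt 𝕜 U 0)
    (he : F =ᶠ[𝓝 0] fun x => ∑ i ∈ Finset.range (j + 1), a i x * x k ^ i + x k ^ (j + 1) * U x) :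
    dirD k F =ᶠ[𝓝 0] fun x => ∑ i ∈ Finset.range j, ((i + 1 : ℕ) * a (i + 1) x) * x k ^ i
      + x k ^ j * ((j + 1 : ℕ) * U x + x k * dirD k U x) := by
  refine (dirD_congr he k).trans ?_
  filter_upwards [hU.eventually_analyticAt] with x hx
  rw [dirD]
  have h1 : (fun t => ∑ i ∈ Finset.range (j + 1), a i (x + Pi.single k t : ι → 𝕜) *
      (x + Pi.single k t : ι → 𝕜) k ^ i + (x + Pi.single k t : ι → 𝕜) k ^ (j + 1) * U (x + Pi.single k t)) =
      fun t => ∑ i ∈ Finset.range (j + 1), a i x * (x k + t) ^ i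
        + (x k + t) ^ (j + 1) * U (x + Pi.single k t) := by
    ext t
    simp only [Pi.add_apply, Pi.single_eq_same]
    congr 1
    refine Finset.sum_congr rfl fun i _ => ?_
    congr 1
    refine ha i fun l hl => ?_
    have : l ≠ k := by simpa using hl
    simp [this]
  rw [h1]
  have hp : ∀ i : ℕ, HasDerivAt (fun t => (x k + t) ^ i) (i * x k ^ (i - 1)) 0 := by
    intro i
    simpa using ((hasDerivAt_id (0 : 𝕜)).const_add (x k)).fun_pow i
  have h2 := (HasDerivAt.fun_sum fun i (_ : i ∈ Finset.range (j + 1)) =>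
    (hp i).const_mul (a i x)).add ((hp (j + 1)).mul (hasDerivAt_dirD hx.differentiableAt k))
  refine h2.deriv.trans ?_
  rw [Finset.sum_range_succ']
  simp only [add_tsub_cancel_right, Nat.cast_zero, zero_mul, mul_zero, add_zero, Pi.single_zero]
  congr 1
  · exact Finset.sum_congr rfl fun i _ => by ring
  · ring

lemma dirD_iterate_expansion [CompleteSpace 𝕜] {F U : (ι → 𝕜) → 𝕜} {a : ℕ → (ι → 𝕜) → 𝕜} {k : ι}
    {d : ℕ} (ha : ∀ i, DependsOn (a i) ({k}ᶜ : Set ι)) (hU : AnalyticAt 𝕜 U 0)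
    (he : F =ᶠ[𝓝 0] fun x => ∑ i ∈ Finset.range d, a i x * x k ^ i + x k ^ d * U x) :
    ∀ᶠ x in 𝓝 0, x k = 0 → (dirD k)^[d] F x = d.factorial * U x := by
  induction d generalizing F U a with
  | zero =>
    filter_upwards [he] with x hx _
    simpa using hx
  | succ d ih =>
    have h1 := dirD_expansion_step ha hU he
    have h2 := ih (a := fun i x => (i + 1 : ℕ) * a (i + 1) x)
      (U := fun x => (d + 1 : ℕ) * U x + x k * dirD k U x)
      (fun i x y h => by simp only; rw [ha (i + 1) h])
      ((analyticAt_const.mul hU).add ((analyticAt_coord k 0).mul (AnalyticAt.dirD hU k))) h1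
    filter_upwards [h2] with x hx hk
    rw [Function.iterate_succ_apply, hx hk, hk, Nat.factorial_succ]
    push_cast; ring

lemma dirD_comp_shear {F : (ι → 𝕜) → 𝕜} {c : (ι → 𝕜) → 𝕜} {k : ι}
    (hc : DependsOn c ({k}ᶜ : Set ι)) (d : ℕ) :
    (dirD k)^[d] (fun x => F (Function.update x k (x k + c x))) =
      fun x => (dirD k)^[d] F (Function.update x k (x k + c x)) := by
  induction d generalizing F with
  | zero => rfl
  | succ d ih =>
    rw [Function.iterate_succ_apply, Function.iterate_succ_apply]
    have : dirD k (fun x => F (Function.update x k (x k + c x))) =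
        fun x => dirD k F (Function.update x k (x k + c x)) := by
      ext x
      rw [dirD, dirD]
      congr 1
      ext t
      have h1 : c (x + Pi.single k t) = c x := hc fun l hl => by
        have : l ≠ k := by simpa using hl
        simp [this]
      rw [h1]
      congr 1
      ext l
      by_cases hl : l = k
      · subst hl; simp; ring
      · simp [hl]
    rw [this, ih]

end Germs

section Germs
variable {𝕜 : Type*} [NontriviallyNormedField 𝕜] [CompleteSpace 𝕜]
variable {ι : Type*} [Fintype ι] [DecidableEq ι]

/-- Analytic germs admit globally continuous representatives depending only on the
coordinates in `S`, after restriction to those coordinates. -/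
lemma exists_continuous_restrict [IsUltrametricDist 𝕜] {c : (ι → 𝕜) → 𝕜} (hc : AnalyticAt 𝕜 c 0)
    (S : Finset ι) : ∃ c' : (ι → 𝕜) → 𝕜, AnalyticAt 𝕜 c' 0 ∧ Continuous c' ∧
      DependsOn c' (S : Set ι) ∧ ∀ᶠ x in 𝓝 0, c' x = c (restrictTo S x) := by
  classical
  obtain ⟨r, hr, hb⟩ := Metric.eventually_nhds_iff_ball.1 hc.eventually_continuousAt
  let c' : (ι → 𝕜) → 𝕜 := fun x =>
    if restrictTo S x ∈ Metric.ball (0 : ι → 𝕜) r then c (restrictTo S x) else 0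
  have hcl : IsClopen (Metric.ball (0 : ι → 𝕜) r) := IsUltrametricDist.isClopen_ball _ _
  have he : ∀ᶠ x in 𝓝 0, c' x = c (restrictTo S x) := by
    filter_upwards [(tendsto_restrictTo S).eventually (Metric.ball_mem_nhds 0 hr)] with x hx
    exact if_pos hx
  refine ⟨c', (AnalyticAt.comp_restrictTo hc S).congr (he.mono fun x hx => hx.symm), ?_, ?_, he⟩
  · rw [continuous_iff_continuousAt]
    intro x
    by_cases hx : restrictTo S x ∈ Metric.ball (0 : ι → 𝕜) r
    · have h1 : ∀ᶠ y in 𝓝 x, c' y = c (restrictTo S y) := by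
        filter_upwards [(restrictTo (𝕜 := 𝕜) S).continuous.continuousAt.eventually_mem
          (hcl.isOpen.mem_nhds hx)] with y hy
        exact if_pos hy
      refine ContinuousAt.congr ?_ (h1.mono fun y hy => hy.symm)
      exact ContinuousAt.comp (hb _ hx) (restrictTo (𝕜 := 𝕜) S).continuous.continuousAt
    · have h1 : ∀ᶠ y in 𝓝 x, c' y = 0 := by
        filter_upwards [(restrictTo (𝕜 := 𝕜) S).continuous.continuousAt.eventually_mem
          (hcl.compl.isOpen.mem_nhds hx)] with y hy
        exact if_neg hy
      exact continuousAt_const.congr (h1.mono fun y hy => hy.symm)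
  · exact dependsOn_comp_restrictTo
      (fun y => if y ∈ Metric.ball (0 : ι → 𝕜) r then c y else 0) S

lemma exists_implicit_center [CharZero 𝕜] [IsUltrametricDist 𝕜] {G : (ι → 𝕜) → 𝕜}
    (hG : AnalyticAt 𝕜 G 0)
    {S : Finset ι} (hS : DependsOn G (S : Set ι)) {k : ι} (hG0 : G 0 = 0)
    (hDG : dirD k G 0 ≠ 0) :
    ∃ c : (ι → 𝕜) → 𝕜, AnalyticAt 𝕜 c 0 ∧ Continuous c ∧ c 0 = 0 ∧
      DependsOn c (S.erase k : Set ι) ∧ ∀ᶠ x in 𝓝 0, G (Function.update x k (c x)) = 0 := by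
  let Θ : (ι → 𝕜) → (ι → 𝕜) := fun x => Function.update x k (G x)
  have hΘ0 : Θ 0 = 0 := by simp [Θ, hG0]
  have hΘ : AnalyticAt 𝕜 Θ 0 := analyticAt_update analyticAt_id hG k
  set f' := fderiv 𝕜 Θ 0 with hf'
  have hcoord : ∀ v j, f' v j = if j = k then fderiv 𝕜 G 0 v else v j := by
    intro v j
    have h1 : HasFDerivAt (fun x => Θ x j) ((ContinuousLinearMap.proj j).comp f') 0 :=
      (hasFDerivAt_pi'.1 hΘ.differentiableAt.hasFDerivAt) j
    by_cases hj : j = k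
    · subst hj
      have h2 : HasFDerivAt (fun x => Θ x j) (fderiv 𝕜 G 0) 0 := by
        simpa [Θ] using hG.differentiableAt.hasFDerivAt
      simpa using DFunLike.congr_fun (h1.unique h2) v
    · have h2 : HasFDerivAt (fun x => Θ x j) (ContinuousLinearMap.proj j : (ι → 𝕜) →L[𝕜] 𝕜) 0 := by
        simp only [Θ, ne_eq, hj, not_false_eq_true, Function.update_of_ne]
        exact (ContinuousLinearMap.proj (R := 𝕜) (φ := fun _ : ι => 𝕜) j).hasFDerivAt
      simpa [hj] using DFunLike.congr_fun (h1.unique h2) v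
  have hinj : Function.Injective (f' : (ι → 𝕜) →ₗ[𝕜] (ι → 𝕜)) := by
    rw [← LinearMap.ker_eq_bot, LinearMap.ker_eq_bot']
    intro v hv
    have hv' : ∀ j, f' v j = 0 := fun j => congrFun hv j
    have h1 : v = Pi.single k (v k) := by
      ext j
      by_cases hj : j = k
      · subst hj; simp
      · have := hv' j
        rw [hcoord, if_neg hj] at this
        simp [hj, this]
    have h2 := hv' k
    rw [hcoord, if_pos rfl, h1, ← mul_one (v k), ← smul_eq_mul, Pi.single_smul, map_smul] at h2
    rw [dirD, (hasDerivAt_line hG.differentiableAt k).deriv] at hDG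
    have h3 : v k = 0 := by simpa [hDG] using h2
    rw [h1, h3]; simp
  let i : (ι → 𝕜) ≃L[𝕜] (ι → 𝕜) :=
    (LinearEquiv.ofInjectiveEndo _ hinj).toContinuousLinearEquiv
  have hi : (i : (ι → 𝕜) →L[𝕜] (ι → 𝕜)) = f' := by
    ext1 v; rfl
  have hst : HasStrictFDerivAt Θ (i : (ι → 𝕜) →L[𝕜] (ι → 𝕜)) 0 := by
    rw [hi]; exact hΘ.hasStrictFDerivAt
  let R := hst.toOpenPartialHomeomorph Θ
  have hR0 : (0 : ι → 𝕜) ∈ R.source := hst.mem_toOpenPartialHomeomorph_source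
  have hRΘ : ∀ x, R x = Θ x := fun x => rfl
  have hsymm : AnalyticAt 𝕜 R.symm 0 := by
    have := R.analyticAt_symm' (a := 0) (i := i) hR0 hΘ hi.symm
    rwa [hRΘ, hΘ0] at this
  have hs0 : R.symm 0 = 0 := by
    have := R.left_inv hR0
    rwa [hRΘ, hΘ0] at this
  let c₀ : (ι → 𝕜) → 𝕜 := fun x => R.symm (Function.update x k 0) k
  have hc₀ : AnalyticAt 𝕜 c₀ 0 := by
    refine (analyticAt_coord k _).fun_comp (AnalyticAt.fun_comp_of_eq hsymm
      (analyticAt_update analyticAt_id analyticAt_const k) (by simp))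
  have hc₀0 : c₀ 0 = 0 := by simp [c₀, hs0]
  have hev : ∀ᶠ x in 𝓝 (0 : ι → 𝕜), G (Function.update x k (c₀ x)) = 0 := by
    have ht : (0 : ι → 𝕜) ∈ R.target := by
      have := R.map_source hR0
      rwa [hRΘ, hΘ0] at this
    filter_upwards [(tendsto_update_zero k).eventually (R.open_target.mem_nhds ht)] with x hx
    have h1 : Θ (R.symm (Function.update x k 0)) = Function.update x k 0 := by
      rw [← hRΘ]; exact R.right_inv hx
    have h2 : R.symm (Function.update x k 0) = Function.update x k (c₀ x) := by
      ext j
      by_cases hj : j = k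
      · subst hj; simp [c₀]
      · have := congrFun h1 j
        simpa [Θ, hj] using this
    have h3 := congrFun h1 k
    rw [h2] at h3
    simpa [Θ] using h3
  obtain ⟨c, h1, h2, h3, h4⟩ := exists_continuous_restrict hc₀ (S.erase k)
  refine ⟨c, h1, h2, ?_, h3, ?_⟩
  · rw [h4.self_of_nhds, map_zero, hc₀0]
  · filter_upwards [h4, (tendsto_restrictTo (S.erase k)).eventually hev] with x h5 h6
    rw [← h6, h5]
    refine hS fun j hj => ?_
    by_cases hjk : j = k
    · subst hjk; simp
    · simp only [ne_eq, hjk, not_false_eq_true, Function.update_of_ne, restrictTo_apply]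
      rw [if_pos (Finset.mem_erase.2 ⟨hjk, hj⟩)]

lemma analyticAt_shear {c : (ι → 𝕜) → 𝕜} {a : ι → 𝕜} (hc : AnalyticAt 𝕜 c a) (k : ι) :
    AnalyticAt 𝕜 (fun x : ι → 𝕜 => Function.update x k (x k + c x)) a :=
  analyticAt_update analyticAt_id ((analyticAt_coord k _).add hc) k

lemma exists_tschirnhausen [CharZero 𝕜] [IsUltrametricDist 𝕜] {F : (ι → 𝕜) → 𝕜}
    (hF : AnalyticAt 𝕜 F 0) {S : Finset ι} (hS : DependsOn F (S : Set ι)) {k : ι} (hk : k ∈ S)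
    {d : ℕ} (hd : HasOrder (d + 1) fun t => F (Pi.single k t)) :
    ∃ (c : (ι → 𝕜) → 𝕜) (a : ℕ → (ι → 𝕜) → 𝕜) (U : (ι → 𝕜) → 𝕜),
      AnalyticAt 𝕜 c 0 ∧ Continuous c ∧ c 0 = 0 ∧ DependsOn c (S.erase k : Set ι) ∧
      (∀ i, AnalyticAt 𝕜 (a i) 0) ∧ (∀ i, DependsOn (a i) (S.erase k : Set ι)) ∧
      AnalyticAt 𝕜 U 0 ∧ DependsOn U (S : Set ι) ∧ U 0 ≠ 0 ∧
      (fun x => F (Function.update x k (x k + c x))) =ᶠ[𝓝 0] fun x =>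
        ∑ i ∈ Finset.range d, a i x * x k ^ i + x k ^ (d + 1) * U x := by
  have herase : ∀ {b : (ι → 𝕜) → 𝕜}, DependsOn b (S.erase k : Set ι) →
      DependsOn b ({k}ᶜ : Set ι) := fun hb => hb.mono (by simp)
  have hline : Tendsto (fun t : 𝕜 => (Pi.single k t : ι → 𝕜)) (𝓝 0) (𝓝 0) := by
    simpa using tendsto_line (𝕜 := 𝕜) 0 k
  have hlineA : ∀ {U : (ι → 𝕜) → 𝕜}, AnalyticAt 𝕜 U 0 →
      AnalyticAt 𝕜 (fun t : 𝕜 => U (Pi.single k t)) 0 := fun hU =>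
    AnalyticAt.fun_comp_of_eq hU ((ContinuousLinearMap.single 𝕜 (fun _ : ι => 𝕜) k).analyticAt 0)
      (by simp)
  have hcoef : ∀ {F U : (ι → 𝕜) → 𝕜} {a : ℕ → (ι → 𝕜) → 𝕜},
      (∀ i, DependsOn (a i) (S.erase k : Set ι)) → AnalyticAt 𝕜 U 0 →
      F =ᶠ[𝓝 0] (fun x => ∑ i ∈ Finset.range (d + 1), a i x * x k ^ i + x k ^ (d + 1) * U x) →
      HasOrder (d + 1) (fun t => F (Pi.single k t)) → (∀ i < d + 1, a i 0 = 0) ∧ U 0 ≠ 0 := by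
    intro F U a ha hU he hord
    have := hord.coeff_eq_zero (c := fun i => a i 0) (hlineA hU) (by
      filter_upwards [hline.eventually he] with t ht
      rw [ht]
      simp only [Pi.single_eq_same]
      congr 1
      refine Finset.sum_congr rfl fun i _ => ?_
      rw [herase (ha i) (y := 0)]
      intro j hj
      have : j ≠ k := by simpa using hj
      simp [this])
    simpa using this
  obtain ⟨a, U, h1, h2, h3, h4, h5⟩ := exists_expansion hF hS hk (d + 1)
  obtain ⟨h6, h7⟩ := hcoef h2 h3 h5 hd
  have hGan : ∀ m, AnalyticAt 𝕜 ((dirD k)^[m] F) 0 := by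
    intro m
    induction m with
    | zero => exact hF
    | succ m ih => rw [Function.iterate_succ_apply']; exact AnalyticAt.dirD ih k
  have hGdep : ∀ m, DependsOn ((dirD k)^[m] F) (S : Set ι) := by
    intro m
    induction m with
    | zero => exact hS
    | succ m ih => rw [Function.iterate_succ_apply']; exact DependsOn.dirD ih k
  have hval : ∀ {F U : (ι → 𝕜) → 𝕜} {a : ℕ → (ι → 𝕜) → 𝕜},
      (∀ i, DependsOn (a i) (S.erase k : Set ι)) → AnalyticAt 𝕜 U 0 → AnalyticAt 𝕜 (a d) 0 →
      F =ᶠ[𝓝 0] (fun x => ∑ i ∈ Finset.range (d + 1), a i x * x k ^ i + x k ^ (d + 1) * U x) →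
      ∀ᶠ x in 𝓝 0, x k = 0 → (dirD k)^[d] F x = d.factorial * a d x := by
    intro F U a ha hU had he
    have := dirD_iterate_expansion (F := F) (a := a) (U := fun x => a d x + x k * U x) (d := d)
      (fun i => herase (ha i)) (had.add ((analyticAt_coord k 0).mul hU)) (by
        filter_upwards [he] with x hx
        rw [hx, Finset.sum_range_succ]; ring)
    filter_upwards [this] with x hx hk
    rw [hx hk, hk]; ring
  have hG0 : (dirD k)^[d] F 0 = 0 := by
    rw [(hval h2 h3 (h1 d) h5).self_of_nhds rfl, h6 d (by omega), mul_zero]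
  have hDG : dirD k ((dirD k)^[d] F) 0 ≠ 0 := by
    have e : dirD k ((dirD k)^[d] F) = (dirD k)^[d + 1] F :=
      (Function.iterate_succ_apply' (dirD k) d F).symm
    rw [e, (dirD_iterate_expansion (fun i => herase (h2 i)) h3 h5).self_of_nhds rfl]
    exact mul_ne_zero (by exact_mod_cast Nat.factorial_ne_zero _) h7
  obtain ⟨c, hc1, hc2, hc3, hc4, hc5⟩ := exists_implicit_center (hGan d) (hGdep d) hG0 hDG
  have hsh := analyticAt_shear hc1 k
  have hF' : AnalyticAt 𝕜 (fun x => F (Function.update x k (x k + c x))) 0 :=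
    AnalyticAt.fun_comp_of_eq hF hsh (by simp [hc3])
  have hS' : DependsOn (fun x => F (Function.update x k (x k + c x))) (S : Set ι) := by
    intro x y hxy
    refine hS fun j hj => ?_
    have : c x = c y := hc4 fun l hl => hxy l (Finset.mem_of_mem_erase hl)
    by_cases hjk : j = k
    · subst hjk; simp [hxy j hj, this]
    · simp [hjk, hxy j hj]
  have hd' : HasOrder (d + 1) fun t => F (Function.update (Pi.single k t) k
      ((Pi.single k t : ι → 𝕜) k + c (Pi.single k t))) := by
    refine hd.imp fun ψ hψ => ⟨hψ.1, hψ.2.1, ?_⟩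
    filter_upwards [hψ.2.2] with t ht
    rw [← ht, herase hc4 (y := 0), hc3]
    · simp only [Pi.single_eq_same, add_zero]
      congr 1
      ext j
      by_cases hj : j = k
      · subst hj; simp
      · simp [hj]
    · intro j hj
      have : j ≠ k := by simpa using hj
      simp [this]
  obtain ⟨b, V, g1, g2, g3, g4, g5⟩ := exists_expansion hF' hS' hk (d + 1)
  obtain ⟨g6, g7⟩ := hcoef g2 g3 g5 hd'
  refine ⟨c, b, V, hc1, hc2, hc3, hc4, g1, g2, g3, g4, g7, ?_⟩
  have hbd : b d =ᶠ[𝓝 0] 0 := by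
    have e1 := (tendsto_update_zero k).eventually (hval g2 g3 (g1 d) g5)
    rw [dirD_comp_shear (herase hc4) d] at e1
    filter_upwards [e1, hc5] with x hx hx'
    have e2 := hx (by simp)
    have e3 : c (Function.update x k 0) = c x := herase hc4 fun j hj => by
      have : j ≠ k := by simpa using hj
      simp [this]
    have e4 : b d (Function.update x k 0) = b d x := herase (g2 d) fun j hj => by
      have : j ≠ k := by simpa using hj
      simp [this]
    rw [e3, e4] at e2
    simp only [Function.update_self, zero_add, Function.update_idem] at e2
    rw [hx'] at e2
    rcases mul_eq_zero.1 e2.symm with e5 | e5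
    · exact absurd e5 (by exact_mod_cast Nat.factorial_ne_zero _)
    · exact e5
  filter_upwards [g5, hbd] with x hx hx'
  rw [hx, Finset.sum_range_succ, hx']; simp

end Germs

section Germs
variable {𝕜 : Type*} [NontriviallyNormedField 𝕜]
variable {ι : Type*} [Fintype ι] [DecidableEq ι]

/-- The families of charts used to monomialize a germ. Each chart comes with its Jacobian, up to
a constant factor. -/
inductive IsCover (S : Finset ι) : Set (((ι → 𝕜) → ι → 𝕜) × ((ι → 𝕜) → 𝕜)) → Prop
  | shear (i : ι) (hi : i ∈ S) (c : (ι → 𝕜) → 𝕜) (hc : AnalyticAt 𝕜 c 0) (hc' : Continuous c)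
      (hc0 : c 0 = 0) (hS : DependsOn c (S.erase i : Set ι)) :
      IsCover S {(fun x => Function.update x i (x i + c x), fun _ => 1)}
  | pow (i : ι) (hi : i ∈ S) (e : ℕ) (he : 1 ≤ e) :
      IsCover S {χ | ∃ a : 𝕜, a ≠ 0 ∧
        χ = (fun x => Function.update x i (a * x i ^ e), fun x => x i ^ (e - 1))}
  | blow (i j : ι) (hi : i ∈ S) (hj : j ∈ S) (hij : i ≠ j) :
      IsCover S (insert (fun x => Function.update x i (x j * x i), fun x => x j)
        {χ | ∃ v : 𝕜, χ = (fun x => Function.update x j (x i * (v + x j)), fun x => x i)})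

/-- Properties shared by all the charts occurring in covers. -/
structure IsChart (S : Finset ι) (φ : (ι → 𝕜) → ι → 𝕜) (J : (ι → 𝕜) → 𝕜) : Prop where
  analyticAt : AnalyticAt 𝕜 φ 0
  map_zero : φ 0 = 0
  analyticAt_jac : AnalyticAt 𝕜 J 0
  dependsOn_jac : DependsOn J (S : Set ι)
  apply_of_notMem : ∀ x, ∀ i ∉ S, φ x i = x i
  dependsOn_apply : ∀ i ∈ S, DependsOn (fun x => φ x i) (S : Set ι)

lemma IsChart.tendsto {S : Finset ι} {φ : (ι → 𝕜) → ι → 𝕜} {J : (ι → 𝕜) → 𝕜}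
    (h : IsChart S φ J) : Tendsto φ (𝓝 0) (𝓝 0) := by
  have := h.analyticAt.continuousAt.tendsto
  rwa [h.map_zero] at this

lemma IsChart.comp {S : Finset ι} {φ : (ι → 𝕜) → ι → 𝕜} {J : (ι → 𝕜) → 𝕜}
    (h : IsChart S φ J) {F : (ι → 𝕜) → 𝕜} (hF : AnalyticAt 𝕜 F 0) :
    AnalyticAt 𝕜 (fun x => F (φ x)) 0 :=
  AnalyticAt.fun_comp_of_eq hF h.analyticAt h.map_zero

lemma IsChart.dependsOn_comp {S T : Finset ι} {φ : (ι → 𝕜) → ι → 𝕜} {J : (ι → 𝕜) → 𝕜}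
    (h : IsChart S φ J) (hST : S ⊆ T) {β : Type*} {F : (ι → 𝕜) → β}
    (hF : DependsOn F (T : Set ι)) : DependsOn (fun x => F (φ x)) (T : Set ι) := by
  intro x y hxy
  refine hF fun i hi => ?_
  by_cases hiS : i ∈ S
  · exact h.dependsOn_apply i hiS fun j hj => hxy j (hST hj)
  · rw [h.apply_of_notMem _ _ hiS, h.apply_of_notMem _ _ hiS, hxy i hi]

lemma isChart_update {S : Finset ι} {i : ι} (hi : i ∈ S) {ψ J : (ι → 𝕜) → 𝕜}
    (hψ : AnalyticAt 𝕜 ψ 0) (h0 : ψ 0 = 0) (hS : DependsOn ψ (S : Set ι))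
    (hJ : AnalyticAt 𝕜 J 0) (hJS : DependsOn J (S : Set ι)) :
    IsChart S (fun x => Function.update x i (ψ x)) J where
  analyticAt := analyticAt_update analyticAt_id hψ i
  map_zero := by simp [h0]
  analyticAt_jac := hJ
  dependsOn_jac := hJS
  apply_of_notMem x j hj := by
    rw [Function.update_of_ne]
    rintro rfl; exact hj hi
  dependsOn_apply j hj x y hxy := by
    by_cases h : j = i
    · subst h; simpa using hS hxy
    · simpa [h] using hxy j hj

lemma IsCover.isChart {S : Finset ι} {𝒞 : Set (((ι → 𝕜) → ι → 𝕜) × ((ι → 𝕜) → 𝕜))}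
    (h : IsCover S 𝒞) {χ : ((ι → 𝕜) → ι → 𝕜) × ((ι → 𝕜) → 𝕜)} (hχ : χ ∈ 𝒞) :
    IsChart S χ.1 χ.2 := by
  have hcoord : ∀ {i : ι}, i ∈ S → DependsOn (fun x : ι → 𝕜 => x i) (S : Set ι) :=
    fun hi x y hxy => hxy _ hi
  cases h with
  | shear i hi c hc hc' hc0 hS =>
    obtain rfl := hχ
    refine isChart_update hi ((analyticAt_coord i 0).add hc) (by simp [hc0]) ?_ analyticAt_const
      (fun _ _ _ => rfl)
    intro x y hxy
    have : c x = c y := hS fun j hj => hxy j (Finset.mem_of_mem_erase hj)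
    simp [this, hxy i hi]
  | pow i hi e he =>
    obtain ⟨a, ha, rfl⟩ := hχ
    refine isChart_update hi (analyticAt_const.mul ((analyticAt_coord i 0).pow e)) ?_ ?_
      ((analyticAt_coord i 0).pow _) ?_
    · simp [Nat.one_le_iff_ne_zero.1 he]
    · intro x y hxy; simp [hxy i hi]
    · intro x y hxy; simp [hxy i hi]
  | blow i j hi hj hij =>
    obtain rfl | ⟨v, rfl⟩ := hχ
    · refine isChart_update hi ((analyticAt_coord j 0).mul (analyticAt_coord i 0)) (by simp) ?_
        (analyticAt_coord j 0) (hcoord hj)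
      intro x y hxy; simp [hxy i hi, hxy j hj]
    · refine isChart_update hj ((analyticAt_coord i 0).mul
        (analyticAt_const.add (analyticAt_coord j 0))) (by simp) ?_
        (analyticAt_coord i 0) (hcoord hi)
      intro x y hxy; simp [hxy i hi, hxy j hj]

lemma IsCover.mono {S T : Finset ι} {𝒞 : Set (((ι → 𝕜) → ι → 𝕜) × ((ι → 𝕜) → 𝕜))}
    (h : IsCover S 𝒞) (hST : S ⊆ T) : IsCover T 𝒞 := by
  cases h with
  | shear i hi c hc hc' hc0 hS =>
    exact .shear i (hST hi) c hc hc' hc0 fun x y hxy => hS fun j hj => hxy j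
      (Finset.erase_subset_erase i hST hj)
  | pow i hi e he => exact .pow i (hST hi) e he
  | blow i j hi hj hij => exact .blow i j (hST hi) (hST hj) hij

/-- Germs that become a monomial times a unit after finitely many changes of charts in the
coordinates from `S`. -/
inductive Mon (S : Finset ι) : ((ι → 𝕜) → 𝕜) → Prop
  | unit (F : (ι → 𝕜) → 𝕜) (hF : MonUnit F) : Mon S F
  | step (F : (ι → 𝕜) → 𝕜) (𝒞 : Set (((ι → 𝕜) → ι → 𝕜) × ((ι → 𝕜) → 𝕜))) (h𝒞 : IsCover S 𝒞)
      (h : ∀ χ ∈ 𝒞, Mon S fun x => F (χ.1 x) * χ.2 x) : Mon S F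

lemma Mon.congr {S : Finset ι} {F G : (ι → 𝕜) → 𝕜} (hF : Mon S F) (h : G =ᶠ[𝓝 0] F) :
    Mon S G := by
  induction hF generalizing G with
  | unit F hF => exact .unit G (hF.congr h)
  | step F 𝒞 h𝒞 _ ih =>
    refine .step G 𝒞 h𝒞 fun χ hχ => ih χ hχ ?_
    filter_upwards [(h𝒞.isChart hχ).tendsto.eventually h] with x hx
    rw [hx]

lemma Mon.shear {S : Finset ι} {F c : (ι → 𝕜) → 𝕜} {i : ι} (hi : i ∈ S) (hc : AnalyticAt 𝕜 c 0)
    (hc' : Continuous c) (hc0 : c 0 = 0) (hS : DependsOn c (S.erase i : Set ι))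
    (h : Mon S fun x => F (Function.update x i (x i + c x))) : Mon S F :=
  .step F _ (.shear i hi c hc hc' hc0 hS) (by rintro χ rfl; simpa using h)

lemma Mon.mul_coord_pow_mul_unit {S S' : Finset ι} {A : (ι → 𝕜) → 𝕜} {k : ι} (hk : k ∉ S')
    (hS : S' ⊆ S) (hA : Mon S' A) {u : (ι → 𝕜) → 𝕜} (hu : AnalyticAt 𝕜 u 0) (hu0 : u 0 ≠ 0)
    (m : ℕ) : Mon S fun x => x k ^ m * u x * A x := by
  induction hA generalizing u with
  | unit A hA => exact .unit _ (((MonUnit.coord_pow k m).mul (.of_unit hu hu0)).mul hA)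
  | step A 𝒞 h𝒞 _ ih =>
    refine .step _ 𝒞 (h𝒞.mono hS) fun χ hχ => ?_
    have hχ' := h𝒞.isChart hχ
    refine (ih χ hχ (hχ'.comp hu) (by rwa [hχ'.map_zero])).congr (.of_forall fun x => ?_)
    simp only [hχ'.apply_of_notMem x k hk]
    ring

lemma Mon.pow_all {S T : Finset ι} (hT : T ⊆ S) {N : ℕ} (hN : 1 ≤ N) {F : (ι → 𝕜) → 𝕜}
    (h : ∀ a : ι → 𝕜, (∀ i, a i ≠ 0) →
      Mon S fun x => F (fun i => if i ∈ T then a i * x i ^ N else x i) * ∏ i ∈ T, x i ^ (N - 1)) :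
    Mon S F := by
  induction T using Finset.induction_on generalizing F with
  | empty => simpa using h 1 (by simp)
  | insert j T hj ih =>
    refine .step F _ (.pow j (hT (Finset.mem_insert_self _ _)) N hN) ?_
    rintro χ ⟨b, hb, rfl⟩
    refine ih ((Finset.subset_insert _ _).trans hT) fun a ha => ?_
    refine (h (Function.update a j b) fun i => ?_).congr (.of_forall fun x => ?_)
    · by_cases hi : i = j
      · subst hi; simpa using hb
      · simpa [hi] using ha i
    · simp only [Finset.prod_insert hj, if_neg hj]
      rw [mul_assoc]
      congr 2
      ext i
      by_cases hi : i = j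
      · subst hi; simp
      · simp [hi, Finset.mem_insert]

/-- Enough linear shears make a nonzero germ have finite order along a given axis. -/
lemma Mon.linear_shear {S T : Finset ι} {k : ι} (hk : k ∈ S) (hT : T ⊆ S.erase k) (l : ι → 𝕜)
    {F : (ι → 𝕜) → 𝕜}
    (h : Mon S fun x => F (fun i => if i ∈ T then x i + l i * x k else x i)) : Mon S F := by
  induction T using Finset.induction_on generalizing F with
  | empty => simpa using h
  | insert j T hj ih =>
    have hjS := Finset.mem_erase.1 (hT (Finset.mem_insert_self _ _))
    refine Mon.shear (i := j) (c := fun x => l j * x k) hjS.2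
      (analyticAt_const.mul (analyticAt_coord k 0)) (by fun_prop) (by simp)
      (fun x y hxy => by simp [hxy k (Finset.mem_coe.2 (Finset.mem_erase.2 ⟨hjS.1.symm, hk⟩))]) ?_
    refine ih ((Finset.subset_insert _ _).trans hT) (h.congr (.of_forall fun x => ?_))
    have hkT : k ∉ T := fun hkT => absurd (hT (Finset.mem_insert_of_mem hkT)) (by simp)
    simp only [if_neg hj, if_neg hkT]
    congr 1
    ext i
    by_cases hi : i = j
    · subst hi; simp
    · simp [hi, Finset.mem_insert]

end Germs

section Germs
variable {𝕜 : Type*} [NontriviallyNormedField 𝕜] [CompleteSpace 𝕜]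
variable {ι : Type*} [Fintype ι] [DecidableEq ι]

lemma exists_line_ne_zero {E : Type*} [NormedAddCommGroup E] [NormedSpace 𝕜 E] {F : E → 𝕜}
    (hF : AnalyticAt 𝕜 F 0) (h : ¬ F =ᶠ[𝓝 0] 0) :
    ∃ a : E, ¬ (fun t : 𝕜 => F (t • a)) =ᶠ[𝓝 0] 0 := by
  by_contra! hcon
  obtain ⟨P, r, hP⟩ := hF
  refine h ?_
  have hco : ∀ a : E, ∀ n, P n (fun _ => a) = 0 := by
    intro a n
    have h1 : HasFPowerSeriesAt (fun t : 𝕜 => F (t • a))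
        (P.compContinuousLinearMap (ContinuousLinearMap.toSpanSingleton 𝕜 a)) 0 := by
      have := HasFPowerSeriesAt.compContinuousLinearMap
        (u := ContinuousLinearMap.toSpanSingleton 𝕜 a) (x := (0 : 𝕜)) (f := F) (pf := P)
        (by simpa using hP.hasFPowerSeriesAt)
      simpa [Function.comp_def] using this
    have h2 := (h1.congr (hcon a)).eq_zero
    have h3 := congrArg (fun p => p n fun _ => (1 : 𝕜)) h2
    rw [FormalMultilinearSeries.compContinuousLinearMap_apply] at h3
    simp only [Function.comp_def, ContinuousLinearMap.toSpanSingleton_apply, one_smul] at h3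
    exact h3
  filter_upwards [hP.eventually_hasSum] with y hy
  simp only [zero_add, hco] at hy
  exact hy.unique hasSum_zero

lemma exists_shear_hasOrder {F : (ι → 𝕜) → 𝕜} (hF : AnalyticAt 𝕜 F 0) {S : Finset ι}
    (hS : DependsOn F (S : Set ι)) (h : ¬ F =ᶠ[𝓝 0] 0) {k : ι} (hk : k ∈ S) :
    ∃ (l : ι → 𝕜) (d : ℕ), HasOrder d fun t : 𝕜 =>
      F (fun i => if i ∈ S.erase k then (Pi.single k t : ι → 𝕜) i + l i * (Pi.single k t : ι → 𝕜) k
        else (Pi.single k t : ι → 𝕜) i) := by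
  have hG : ¬ (fun x : ι → 𝕜 => x k * F x) =ᶠ[𝓝 0] 0 := by
    intro h0
    rcases eventuallyEq_zero_or_of_mul (analyticAt_coord k 0) hF h0 with h1 | h1
    · exact (MonUnit.coord k).not_eventually_zero h1
    · exact h h1
  obtain ⟨a, ha⟩ := exists_line_ne_zero ((analyticAt_coord k 0).mul hF) hG
  have hak : a k ≠ 0 := by
    intro h0
    exact ha (.of_forall fun t => by simp [h0])
  have hlin : ∀ b : ι → 𝕜, AnalyticAt 𝕜 (fun t : 𝕜 => t • b) 0 := fun b =>
    (ContinuousLinearMap.toSpanSingleton 𝕜 b).analyticAt 0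
  refine ⟨fun i => a i / a k, ?_⟩
  have he : ∀ t : 𝕜, F (fun i => if i ∈ S.erase k then
      (Pi.single k t : ι → 𝕜) i + a i / a k * (Pi.single k t : ι → 𝕜) k
        else (Pi.single k t : ι → 𝕜) i) = F (t • (a k)⁻¹ • a) := by
    intro t
    refine hS fun i hi => ?_
    have hi' : i ∈ S := hi
    by_cases hik : i = k
    · subst hik; simp [hak]
    · simp [hik, hi']; field_simp
  simp only [he]
  refine exists_hasOrder (AnalyticAt.fun_comp_of_eq hF (hlin _) (by simp)) fun h0 => ha ?_
  have ht : Tendsto (fun t : 𝕜 => t * a k) (𝓝 0) (𝓝 0) := by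
    have : Continuous fun t : 𝕜 => t * a k := by fun_prop
    simpa using this.tendsto 0
  filter_upwards [ht.eventually h0] with t ht
  have : (t * a k) • (a k)⁻¹ • a = t • a := by
    rw [smul_smul, mul_assoc, mul_inv_cancel₀ hak, mul_one]
  rw [this] at ht
  simp [ht]

lemma MonUnit.exists_dependsOn {F : (ι → 𝕜) → 𝕜} (hF : MonUnit F) {S : Finset ι}
    (hS : DependsOn F (S : Set ι)) :
    ∃ (k : ι → ℕ) (u : (ι → 𝕜) → 𝕜), (∀ i ∉ S, k i = 0) ∧ AnalyticAt 𝕜 u 0 ∧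
      DependsOn u (S : Set ι) ∧ u 0 ≠ 0 ∧ F =ᶠ[𝓝 0] fun x => PadicOsc.monom k x * u x := by
  have hne := hF.not_eventually_zero
  obtain ⟨k, u, hu, hu0, he⟩ := hF
  have hk : ∀ i ∉ S, k i = 0 := by
    intro i hi
    by_contra hki
    refine hne ?_
    filter_upwards [(tendsto_restrictTo (𝕜 := 𝕜) S).eventually he] with x hx
    rw [DependsOn.apply_restrictTo hS] at hx
    rw [hx, monom_eq_zero (i := i) (by simp [restrictTo_apply, hi]) hki]
    simp
  refine ⟨k, fun x => u (restrictTo S x), hk, AnalyticAt.comp_restrictTo hu S,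
    dependsOn_comp_restrictTo u S, by simpa using hu0, ?_⟩
  filter_upwards [(tendsto_restrictTo (𝕜 := 𝕜) S).eventually he] with x hx
  rw [DependsOn.apply_restrictTo hS] at hx
  rw [hx]
  congr 1
  refine Finset.prod_congr rfl fun i _ => ?_
  by_cases hi : i ∈ S
  · simp [restrictTo_apply, hi]
  · simp [hk i hi]

lemma GDvd.mul_left {a B : (ι → 𝕜) → 𝕜} (h : GDvd a B) {C : (ι → 𝕜) → 𝕜}
    (hC : AnalyticAt 𝕜 C 0) : GDvd a fun x => C x * B x := by
  obtain ⟨g, hg, he⟩ := h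
  refine ⟨fun x => C x * g x, hC.mul hg, ?_⟩
  filter_upwards [he] with x hx
  rw [hx]; ring

lemma GDvd.prod {α : Type*} {s : Finset α} {f : α → (ι → 𝕜) → 𝕜}
    (hf : ∀ i ∈ s, AnalyticAt 𝕜 (f i) 0) {i : α} (hi : i ∈ s) :
    GDvd (f i) fun x => ∏ j ∈ s, f j x := by
  classical
  refine ⟨fun x => ∏ j ∈ s.erase i, f j x,
    Finset.analyticAt_fun_prod _ fun j hj => hf j (Finset.mem_of_mem_erase hj),
    .of_forall fun x => (Finset.mul_prod_erase s (fun j => f j x) hi).symm⟩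

lemma GDvd.comp_chart {S : Finset ι} {φ : (ι → 𝕜) → ι → 𝕜} {J : (ι → 𝕜) → 𝕜}
    (hφ : IsChart S φ J) {a B : (ι → 𝕜) → 𝕜} (h : GDvd a B) :
    GDvd (fun x => a (φ x)) fun x => B (φ x) * J x := by
  obtain ⟨g, hg, he⟩ := h
  refine ⟨fun x => g (φ x) * J x, (hφ.comp hg).mul hφ.analyticAt_jac, ?_⟩
  filter_upwards [hφ.tendsto.eventually he] with x hx
  rw [hx]; ring

lemma GDvd.comp_chart_mul {S : Finset ι} {φ : (ι → 𝕜) → ι → 𝕜} {J : (ι → 𝕜) → 𝕜}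
    (hφ : IsChart S φ J) {a B : (ι → 𝕜) → 𝕜} (h : GDvd a B) :
    GDvd (fun x => a (φ x) * J x) fun x => B (φ x) * J x := by
  obtain ⟨g, hg, he⟩ := h
  refine ⟨fun x => g (φ x), hφ.comp hg, ?_⟩
  filter_upwards [hφ.tendsto.eventually he] with x hx
  rw [hx]; ring

lemma not_eventuallyEq_zero_mul {f g : (ι → 𝕜) → 𝕜} (hf : AnalyticAt 𝕜 f 0)
    (hg : AnalyticAt 𝕜 g 0) (hf0 : ¬ f =ᶠ[𝓝 0] 0) (hg0 : ¬ g =ᶠ[𝓝 0] 0) :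
    ¬ (fun x => f x * g x) =ᶠ[𝓝 0] 0 := fun h =>
  (eventuallyEq_zero_or_of_mul hf hg h).elim hf0 hg0

lemma not_eventuallyEq_zero_prod {α : Type*} {s : Finset α} {f : α → (ι → 𝕜) → 𝕜}
    (hf : ∀ i ∈ s, AnalyticAt 𝕜 (f i) 0) (hf0 : ∀ i ∈ s, ¬ f i =ᶠ[𝓝 0] 0) :
    ¬ (fun x => ∏ j ∈ s, f j x) =ᶠ[𝓝 0] 0 := by
  classical
  induction s using Finset.induction_on with
  | empty =>
    intro h
    simpa using h.self_of_nhds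
  | insert i s hi ih =>
    simp only [Finset.prod_insert hi]
    exact not_eventuallyEq_zero_mul (hf i (by simp))
      (Finset.analyticAt_fun_prod _ fun j hj => hf j (by simp [hj])) (hf0 i (by simp))
      (ih (fun j hj => hf j (by simp [hj])) fun j hj => hf0 j (by simp [hj]))

end Germs

section Germs
variable {𝕜 : Type*} [NontriviallyNormedField 𝕜]

lemma exists_hasOrder_shifted [CharZero 𝕜] {n : ℕ} (c : ℕ → 𝕜) {v w : 𝕜} (hv : v ≠ 0)
    (hw : w ≠ 0) :
    ∃ j < n + 1, HasOrder j fun t : 𝕜 =>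
      ∑ i ∈ Finset.range n, c i * (v + t) ^ i + (v + t) ^ (n + 1) * w := by
  open Polynomial in
  let P : 𝕜[X] := ∑ i ∈ Finset.range n, C (c i) * (X + C v) ^ i + (X + C v) ^ (n + 1) * C w
  have hdeg : P.natDegree < n + 2 := by
    refine Nat.lt_succ_of_le (Polynomial.natDegree_add_le_of_degree_le ?_ ?_)
    · refine Polynomial.natDegree_sum_le_of_forall_le _ _ fun i hi => ?_
      refine (Polynomial.natDegree_C_mul_le _ _).trans ?_
      rw [Polynomial.natDegree_pow, Polynomial.natDegree_X_add_C]
      have := Finset.mem_range.1 hi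
      omega
    · refine (Polynomial.natDegree_mul_C_le _ _).trans ?_
      rw [Polynomial.natDegree_pow, Polynomial.natDegree_X_add_C]
      omega
  have hco : P.coeff n ≠ 0 := by
    have h1 : P.coeff n = v * (n + 1 : 𝕜) * w := by
      simp only [P, Polynomial.coeff_add, Polynomial.finsetSum_coeff, Polynomial.coeff_C_mul,
        Polynomial.coeff_mul_C, Polynomial.coeff_X_add_C_pow]
      rw [Finset.sum_eq_zero]
      · simp
      · intro i hi
        rw [Nat.choose_eq_zero_of_lt (Finset.mem_range.1 hi)]
        simp
    rw [h1]
    have : (n + 1 : 𝕜) ≠ 0 := by exact_mod_cast Nat.succ_ne_zero n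
    positivity
  refine exists_hasOrder_lt (ψ := fun _ => P.coeff (n + 1)) (c := P.coeff) (d := n + 1)
    analyticAt_const (.of_forall fun t => ?_) ⟨n, by omega, hco⟩
  have h2 : P.eval t = ∑ i ∈ Finset.range n, c i * (v + t) ^ i + (v + t) ^ (n + 1) * w := by
    simp [P, Polynomial.eval_finsetSum, add_comm t v]
  beta_reduce
  rw [← h2, Polynomial.eval_eq_sum_range' hdeg, Finset.sum_range_succ]
  ring

variable {ι : Type*} [Fintype ι] [DecidableEq ι]

lemma monom_mul (k : ι → ℕ) (x y : ι → 𝕜) :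
    monom k (fun i => x i * y i) = monom k x * monom k y := by
  simp [monom, mul_pow, Finset.prod_mul_distrib]

lemma monom_update_mul (k : ι → ℕ) (i : ι) (x : ι → 𝕜) (y : 𝕜) :
    monom k (Function.update x i (y * x i)) = y ^ k i * monom k x := by
  have h : Function.update x i (y * x i) = fun j => (Function.update 1 i y : ι → 𝕜) j * x j := by
    ext j
    by_cases hj : j = i
    · subst hj; simp
    · simp [hj]
  rw [h, monom_mul]
  congr 1
  rw [monom, Finset.prod_eq_single i]
  · simp
  · intro j _ hj; simp [hj]
  · simp

lemma MonUnit.comp_update_mul {A : (ι → 𝕜) → 𝕜} (hA : MonUnit A) (i j : ι) :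
    MonUnit fun x => A (Function.update x i (x j * x i)) := by
  obtain ⟨k, u, hu, hu0, he⟩ := hA
  have hφ : AnalyticAt 𝕜 (fun x : ι → 𝕜 => Function.update x i (x j * x i)) 0 :=
    analyticAt_update analyticAt_id ((analyticAt_coord j 0).mul (analyticAt_coord i 0)) i
  have hφ0 : (fun x : ι → 𝕜 => Function.update x i (x j * x i)) 0 = 0 := by simp
  have hu' : AnalyticAt 𝕜 (fun x : ι → 𝕜 => u (Function.update x i (x j * x i))) 0 :=
    AnalyticAt.fun_comp_of_eq hu hφ hφ0
  refine (((MonUnit.coord_pow j (k i)).mul (.monom k)).mul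
    (.of_unit hu' (by simpa using hu0))).congr ?_
  have ht : Tendsto (fun x : ι → 𝕜 => Function.update x i (x j * x i)) (𝓝 0) (𝓝 0) := by
    simpa using hφ.continuousAt.tendsto
  filter_upwards [ht.eventually he] with x hx
  rw [hx, monom_update_mul]

/-- The induction hypothesis on the order of vanishing along the axis `k`. -/
def MonOfOrder (𝕜 : Type*) [NontriviallyNormedField 𝕜] {ι : Type*} [Fintype ι] [DecidableEq ι]
    (S : Finset ι) (k : ι) (d : ℕ) : Prop :=
  ∀ F A : (ι → 𝕜) → 𝕜, AnalyticAt 𝕜 F 0 → DependsOn F (S : Set ι) →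
    HasOrder d (fun t => F (Pi.single k t)) → AnalyticAt 𝕜 A 0 →
    DependsOn A (S.erase k : Set ι) → ¬ A =ᶠ[𝓝 0] 0 → Mon S fun x => F x * A x

lemma dependsOn_monom {S : Finset ι} {α : ι → ℕ} (hα : ∀ i ∉ S, α i = 0) :
    DependsOn (monom α : (ι → 𝕜) → 𝕜) (S : Set ι) := by
  intro x y hxy
  refine Finset.prod_congr rfl fun i _ => ?_
  by_cases hi : i ∈ S
  · rw [hxy i hi]
  · simp [hα i hi]

lemma mon_of_weighted [CharZero 𝕜] {S : Finset ι} {k : ι} (hk : k ∈ S) {n : ℕ}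
    (claim : ∀ d < n + 1, MonOfOrder 𝕜 S k d) {α : ι → ℕ} (hα : ∀ i ∉ S.erase k, α i = 0)
    {b : ℕ → (ι → 𝕜) → 𝕜} (hb : ∀ i, AnalyticAt 𝕜 (b i) 0)
    (hbS : ∀ i, DependsOn (b i) (S.erase k : Set ι)) (hb0 : ∃ i < n, b i 0 ≠ 0)
    {U : (ι → 𝕜) → 𝕜} (hU : AnalyticAt 𝕜 U 0) (hUS : DependsOn U (S : Set ι)) (hU0 : U 0 ≠ 0)
    {A : (ι → 𝕜) → 𝕜} (hA : MonUnit A) (hAS : DependsOn A (S.erase k : Set ι)) :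
    Mon S fun x => (∑ i ∈ Finset.range n, monom ((n + 1 - i) • α) x * b i x * x k ^ i +
      x k ^ (n + 1) * U x) * A x := by
  have hsub : S.erase k ⊆ S := Finset.erase_subset _ _
  have hline : ∀ {c : (ι → 𝕜) → 𝕜}, DependsOn c (S.erase k : Set ι) → ∀ t : 𝕜,
      c (Pi.single k t) = c 0 := by
    intro c hc t
    refine hc fun j hj => ?_
    have : j ≠ k := by
      rintro rfl; simp at hj
    simp [this]
  have hupd : ∀ {c : (ι → 𝕜) → 𝕜}, DependsOn c (S.erase k : Set ι) → ∀ (x : ι → 𝕜) (t : 𝕜),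
      c (Function.update x k t) = c x := by
    intro c hc x t
    refine hc fun j hj => ?_
    have : j ≠ k := by
      rintro rfl; simp at hj
    simp [this]
  have hcS : DependsOn (fun x : ι → 𝕜 => x k) (S : Set ι) := fun x y hxy => hxy k hk
  have hlineA : ∀ {U : (ι → 𝕜) → 𝕜}, AnalyticAt 𝕜 U 0 →
      AnalyticAt 𝕜 (fun t : 𝕜 => U (Pi.single k t)) 0 := fun hU =>
    AnalyticAt.fun_comp_of_eq hU ((ContinuousLinearMap.single 𝕜 (fun _ : ι => 𝕜) k).analyticAt 0)
      (by simp)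
  induction hN : ∑ i, α i generalizing α U A with
  | zero =>
    have h0 : α = 0 := by
      ext i; simpa using (Finset.sum_eq_zero_iff.1 hN) i (Finset.mem_univ i)
    subst h0
    simp only [smul_zero, monom_zero, one_mul]
    obtain ⟨j, hj, hord⟩ := exists_hasOrder_lt
      (φ := fun t : 𝕜 => ∑ i ∈ Finset.range n, b i (Pi.single k t) * (Pi.single k t : ι → 𝕜) k ^ i +
        (Pi.single k t : ι → 𝕜) k ^ (n + 1) * U (Pi.single k t))
      (ψ := fun t => t * U (Pi.single k t)) (c := fun i => b i 0) (d := n)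
      (analyticAt_id.mul (hlineA hU)) (.of_forall fun t => by
        simp only [hline (hbS _), Pi.single_eq_same]; ring) hb0
    refine claim j (by omega) _ A ?_ ?_ hord hA.analyticAt hAS hA.not_eventually_zero
    · exact (Finset.analyticAt_fun_sum _ fun i _ => (hb i).mul ((analyticAt_coord k 0).pow i)).add
        (((analyticAt_coord k 0).pow _).mul hU)
    · intro x y hxy
      have h1 : ∀ i, b i x = b i y := fun i => hbS i fun j hj => hxy j (hsub hj)
      simp only [h1, hUS hxy, hxy k hk]
  | succ N ih =>
    obtain ⟨j, -, hj⟩ : ∃ j ∈ Finset.univ, α j ≠ 0 := by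
      by_contra! h
      rw [Finset.sum_eq_zero h] at hN
      omega
    have hjS : j ∈ S.erase k := by
      by_contra h
      exact hj (hα j h)
    have hjk : j ≠ k := (Finset.mem_erase.1 hjS).1
    have hαk : α k = 0 := hα k (by simp)
    obtain ⟨β, rfl⟩ : ∃ β : ι → ℕ, α = β + Pi.single j 1 := by
      refine ⟨α - Pi.single j 1, ?_⟩
      ext i
      by_cases hi : i = j
      · subst hi; simp; omega
      · simp [hi]
    have hβ : ∀ i ∉ S.erase k, β i = 0 := fun i hi => by
      have := hα i hi
      simp at this
      exact this.1
    have hβk : β k = 0 := hβ k (by simp)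
    have hβN : ∑ i, β i = N := by
      have : ∑ i, (β + Pi.single j 1 : ι → ℕ) i = ∑ i, β i + 1 := by
        simp [Finset.sum_add_distrib]
      omega
    have hmon : ∀ (m : ℕ) (x : ι → 𝕜), monom (m • (β + Pi.single j 1)) x =
        monom (m • β) x * x j ^ m := by
      intro m x
      rw [smul_add, monom_add, monom_smul m (Pi.single j 1), monom_single, pow_one]
    have hmonS : ∀ m : ℕ, DependsOn (monom (m • β) : (ι → 𝕜) → 𝕜) (S.erase k : Set ι) :=
      fun m => dependsOn_monom fun i hi => by simp [hβ i hi]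
    have hcov : IsCover S _ := IsCover.blow (𝕜 := 𝕜) j k (hsub hjS) hk hjk
    refine .step _ _ hcov fun χ hχ => ?_
    have hchart := hcov.isChart hχ
    obtain rfl | ⟨v, rfl⟩ := hχ
    · have hU' := hchart.comp hU
      simp only at hU' hchart ⊢
      have hB : AnalyticAt 𝕜 (fun x : ι → 𝕜 => ∑ i ∈ Finset.range n,
          monom ((n + 1 - i) • (β + Pi.single j 1)) x * x k ^ ((n + 1 - i) * β j) *
            b i (Function.update x j (x k * x j)) + U (Function.update x j (x k * x j))) 0 :=
        (Finset.analyticAt_fun_sum _ fun i _ => ((analyticAt_monom _ 0).mul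
          ((analyticAt_coord k 0).pow _)).mul (hchart.comp (hb i))).add hU'
      refine .unit _ ((((MonUnit.coord_pow k (n + 2)).mul (.of_unit hB ?_)).mul
        (hA.comp_update_mul j k)).congr (.of_forall fun x => ?_))
      · rw [Finset.sum_eq_zero]
        · simpa using hU0
        · intro i hi
          rw [monom_eq_zero (i := j) rfl]
          · simp
          · have := Finset.mem_range.1 hi
            simp; omega
      · simp only [monom_update_mul, Function.update_of_ne hjk.symm]
        have : ∑ i ∈ Finset.range n, x k ^ ((n + 1 - i) • (β + Pi.single j 1) : ι → ℕ) j *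
            monom ((n + 1 - i) • (β + Pi.single j 1)) x * b i (Function.update x j (x k * x j)) *
              x k ^ i = x k ^ (n + 1) * ∑ i ∈ Finset.range n,
            monom ((n + 1 - i) • (β + Pi.single j 1)) x * x k ^ ((n + 1 - i) * β j) *
              b i (Function.update x j (x k * x j)) := by
          rw [Finset.mul_sum]
          refine Finset.sum_congr rfl fun i hi => ?_
          have hi' := Finset.mem_range.1 hi
          have e1 : ((n + 1 - i) • (β + Pi.single j 1) : ι → ℕ) j = (n + 1 - i) * β j + (n + 1 - i) := by
            simp [mul_add]
          have e2 : x k ^ (n + 1) = x k ^ (n + 1 - i) * x k ^ i := by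
            rw [← pow_add]; congr 1; omega
          rw [e1, e2, pow_add]
          ring
        rw [this]
        ring
    · have hU' := hchart.comp hU
      have hUS' := hchart.dependsOn_comp le_rfl hUS
      simp only at hU' hUS' hchart ⊢
      have hA' : MonUnit fun x : ι → 𝕜 => x j ^ (n + 2) * A x := (MonUnit.coord_pow j _).mul hA
      have hAS' : DependsOn (fun x : ι → 𝕜 => x j ^ (n + 2) * A x) (S.erase k : Set ι) := by
        intro x y hxy
        simp only [hAS hxy, hxy j hjS]
      have key : ∀ x : ι → 𝕜, (∑ i ∈ Finset.range n,
          monom ((n + 1 - i) • β) x * b i x * (v + x k) ^ i +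
          (v + x k) ^ (n + 1) * U (Function.update x k (x j * (v + x k)))) *
            (x j ^ (n + 2) * A x) =
          (∑ i ∈ Finset.range n, monom ((n + 1 - i) • (β + Pi.single j 1))
            (Function.update x k (x j * (v + x k))) *
            b i (Function.update x k (x j * (v + x k))) *
            (Function.update x k (x j * (v + x k)) k) ^ i +
          (Function.update x k (x j * (v + x k)) k) ^ (n + 1) *
            U (Function.update x k (x j * (v + x k)))) *
            A (Function.update x k (x j * (v + x k))) * x j := by
        intro x
        simp only [Function.update_self, hupd hAS, hupd (hbS _), hmon, hupd (hmonS _),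
          Function.update_of_ne hjk]
        have : ∑ i ∈ Finset.range n, monom ((n + 1 - i) • β) x * x j ^ (n + 1 - i) * b i x *
            (x j * (v + x k)) ^ i = x j ^ (n + 1) * ∑ i ∈ Finset.range n,
              monom ((n + 1 - i) • β) x * b i x * (v + x k) ^ i := by
          rw [Finset.mul_sum]
          refine Finset.sum_congr rfl fun i hi => ?_
          have hi' := Finset.mem_range.1 hi
          have e2 : x j ^ (n + 1) = x j ^ (n + 1 - i) * x j ^ i := by
            rw [← pow_add]; congr 1; omega
          rw [e2, mul_pow]
          ring
        rw [this, mul_pow]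
        ring
      by_cases hv : v = 0
      · subst hv
        refine (ih hβ hU' hUS' (by simpa using hU0) hA' hAS' hβN).congr (.of_forall fun x => ?_)
        beta_reduce
        rw [← key]
        simp only [zero_add]
      · have hφ0 : ∀ t : 𝕜, Function.update (Pi.single k t : ι → 𝕜) k
            ((Pi.single k t : ι → 𝕜) j * (v + t)) = 0 := by
          intro t
          ext i
          by_cases hi : i = k
          · subst hi; simp [hjk]
          · simp [hi]
        obtain ⟨m, hm, hord⟩ := exists_hasOrder_shifted (n := n)
          (fun i => monom ((n + 1 - i) • β) 0 * b i 0) hv hU0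
        refine (claim m hm (fun x => ∑ i ∈ Finset.range n,
          monom ((n + 1 - i) • β) x * b i x * (v + x k) ^ i +
          (v + x k) ^ (n + 1) * U (Function.update x k (x j * (v + x k)))) _ ?_ ?_ ?_
          hA'.analyticAt hAS' hA'.not_eventually_zero).congr (.of_forall fun x => (key x).symm)
        · exact (Finset.analyticAt_fun_sum _ fun i _ => ((analyticAt_monom _ 0).mul (hb i)).mul
            ((analyticAt_const.add (analyticAt_coord k 0)).pow i)).add
            (((analyticAt_const.add (analyticAt_coord k 0)).pow _).mul hU')
        · intro x y hxy
          have h1 : ∀ i, b i x = b i y := fun i => hbS i fun j hj => hxy j (hsub hj)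
          have h2 : ∀ m : ℕ, monom (m • β) x = monom (m • β) y :=
            fun i => hmonS i fun j hj => hxy j (hsub hj)
          have h3 := hUS' hxy
          simp only at h3
          simp only [h1, h2]
          rw [h3, hxy k hk]
        · simpa only [hline (hmonS _), hline (hbS _), hφ0, Pi.single_eq_same] using hord

end Germs

section Germs
variable {𝕜 : Type*} [NontriviallyNormedField 𝕜]
variable {ι : Type*} [Fintype ι] [DecidableEq ι]

/-- The substitution `x i ↦ a i * x i ^ N` in the coordinates from `T`. -/
def powMap (T : Finset ι) (N : ℕ) (a x : ι → 𝕜) : ι → 𝕜 :=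
  fun i => if i ∈ T then a i * x i ^ N else x i

lemma analyticAt_powMap (T : Finset ι) (N : ℕ) (a : ι → 𝕜) : AnalyticAt 𝕜 (powMap T N a) 0 := by
  rw [analyticAt_pi_iff]
  intro i
  by_cases hi : i ∈ T
  · simp only [powMap, if_pos hi]
    exact analyticAt_const.mul ((analyticAt_coord i 0).pow N)
  · simp only [powMap, if_neg hi]
    exact analyticAt_coord i 0

lemma powMap_zero (T : Finset ι) {N : ℕ} (hN : 1 ≤ N) (a : ι → 𝕜) : powMap T N a 0 = 0 := by
  ext i
  by_cases hi : i ∈ T <;> simp [powMap, hi, Nat.one_le_iff_ne_zero.1 hN]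

lemma AnalyticAt.comp_powMap {F : (ι → 𝕜) → 𝕜} (hF : AnalyticAt 𝕜 F 0) (T : Finset ι) {N : ℕ}
    (hN : 1 ≤ N) (a : ι → 𝕜) : AnalyticAt 𝕜 (fun x => F (powMap T N a x)) 0 :=
  AnalyticAt.fun_comp_of_eq hF (analyticAt_powMap T N a) (powMap_zero T hN a)

lemma tendsto_powMap (T : Finset ι) {N : ℕ} (hN : 1 ≤ N) (a : ι → 𝕜) :
    Tendsto (powMap T N a) (𝓝 0) (𝓝 0) := by
  have := (analyticAt_powMap T N a).continuousAt.tendsto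
  rwa [powMap_zero T hN] at this

lemma monom_powMap {T : Finset ι} {k : ι → ℕ} (hk : ∀ i ∉ T, k i = 0) (N : ℕ) (a x : ι → 𝕜) :
    monom k (powMap T N a x) = monom k a * monom (N • k) x := by
  simp only [monom, ← Finset.prod_mul_distrib]
  refine Finset.prod_congr rfl fun i _ => ?_
  by_cases hi : i ∈ T
  · simp [powMap, hi, mul_pow, pow_mul]
  · simp [hk i hi]

lemma dependsOn_comp_powMap {β : Type*} {F : (ι → 𝕜) → β} {S : Finset ι}
    (hF : DependsOn F (S : Set ι)) (T : Finset ι) (N : ℕ) (a : ι → 𝕜) :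
    DependsOn (fun x => F (powMap T N a x)) (S : Set ι) := by
  intro x y hxy
  refine hF fun i hi => ?_
  simp only [powMap, hxy i hi]

variable [CompleteSpace 𝕜]

lemma MonUnit.comp_powMap {A : (ι → 𝕜) → 𝕜} (hA : MonUnit A) {T : Finset ι}
    (hT : DependsOn A (T : Set ι)) {N : ℕ} (hN : 1 ≤ N) {a : ι → 𝕜} (ha : ∀ i, a i ≠ 0) :
    MonUnit fun x => A (powMap T N a x) * ∏ i ∈ T, x i ^ (N - 1) := by
  obtain ⟨k, u, hk, hu, -, hu0, he⟩ := hA.exists_dependsOn hT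
  have h1 : AnalyticAt 𝕜 (fun x => PadicOsc.monom k a * u (powMap T N a x)) 0 :=
    analyticAt_const.mul (AnalyticAt.comp_powMap hu T hN a)
  refine (((MonUnit.monom (N • k)).mul (.of_unit h1 ?_)).mul
    (.monom fun i => if i ∈ T then N - 1 else 0)).congr ?_
  · rw [powMap_zero T hN]
    exact mul_ne_zero (monom_ne_zero fun i hi => absurd hi (ha i)) hu0
  · filter_upwards [(tendsto_powMap T hN a).eventually he] with x hx
    rw [hx, monom_powMap hk]
    have : ∏ i ∈ T, x i ^ (N - 1) = PadicOsc.monom (fun i => if i ∈ T then N - 1 else 0) x := by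
      simp [PadicOsc.monom, pow_ite, Finset.prod_ite_mem]
    rw [this]
    ring

variable [CharZero 𝕜]

lemma mon_of_coeffs_monUnit {S : Finset ι} {k : ι} (hk : k ∈ S) {n : ℕ}
    (claim : ∀ d < n + 1, MonOfOrder 𝕜 S k d)
    {a : ℕ → (ι → 𝕜) → 𝕜} (haS : ∀ i, DependsOn (a i) (S.erase k : Set ι))
    (ha : ∀ i < n, a i =ᶠ[𝓝 0] 0 ∨ MonUnit (a i)) (ha0 : ∃ i < n, ¬ a i =ᶠ[𝓝 0] 0)
    (hd : ∀ i < n, ∀ j < n,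
      (fun x => a i x ^ ((n + 1).factorial / (n + 1 - i)) -
        a j x ^ ((n + 1).factorial / (n + 1 - j))) =ᶠ[𝓝 0] 0 ∨
      MonUnit fun x => a i x ^ ((n + 1).factorial / (n + 1 - i)) -
        a j x ^ ((n + 1).factorial / (n + 1 - j)))
    {U : (ι → 𝕜) → 𝕜} (hU : AnalyticAt 𝕜 U 0) (hUS : DependsOn U (S : Set ι)) (hU0 : U 0 ≠ 0)
    {A : (ι → 𝕜) → 𝕜} (hA : MonUnit A) (hAS : DependsOn A (S.erase k : Set ι)) :
    Mon S fun x => (∑ i ∈ Finset.range n, a i x * x k ^ i + x k ^ (n + 1) * U x) * A x := by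
  classical
  set N := (n + 1).factorial with hNdef
  have hN : 1 ≤ N := Nat.one_le_iff_ne_zero.2 (Nat.factorial_ne_zero _)
  have hrep : ∀ i, i < n ∧ ¬ a i =ᶠ[𝓝 0] 0 → ∃ (β : ι → ℕ) (u : (ι → 𝕜) → 𝕜),
      (∀ l ∉ S.erase k, β l = 0) ∧ AnalyticAt 𝕜 u 0 ∧ DependsOn u (S.erase k : Set ι) ∧
      u 0 ≠ 0 ∧ a i =ᶠ[𝓝 0] fun x => monom β x * u x := fun i hi =>
    ((ha i hi.1).resolve_left hi.2).exists_dependsOn (haS i)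
  choose! β u hβ hu huS hu0 he using hrep
  set e : ℕ → ℕ := fun i => N / (n + 1 - i) with hedef
  have hdiv : ∀ i < n, (n + 1 - i) * e i = N := fun i hi =>
    Nat.mul_div_cancel' (Nat.dvd_factorial (by omega) (by omega))
  have hcomp : ∀ i j, (i < n ∧ ¬ a i =ᶠ[𝓝 0] 0) → (j < n ∧ ¬ a j =ᶠ[𝓝 0] 0) →
      e i • β i ≤ e j • β j ∨ e j • β j ≤ e i • β i := by
    intro i j hi hj
    refine exponents_comparable ((hu i hi).pow (e i)) (pow_ne_zero _ (hu0 i hi))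
      ((hu j hj).pow (e j)) (pow_ne_zero _ (hu0 j hj)) (hd i hi.1 j hj.1) ?_
    filter_upwards [he i hi, he j hj] with x h1 h2
    simp only [Pi.pow_apply]
    rw [h1, h2, monom_smul, monom_smul, mul_pow, mul_pow]
  obtain ⟨i0, hi0, hmin⟩ : ∃ i0, (i0 < n ∧ ¬ a i0 =ᶠ[𝓝 0] 0) ∧
      ∀ j, (j < n ∧ ¬ a j =ᶠ[𝓝 0] 0) → e i0 • β i0 ≤ e j • β j := by
    let s := (Finset.range n).filter fun i => ¬ a i =ᶠ[𝓝 0] 0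
    have hs : ∀ i, i ∈ s ↔ (i < n ∧ ¬ a i =ᶠ[𝓝 0] 0) := fun i => by simp [s]
    obtain ⟨i1, h1, h2⟩ := ha0
    obtain ⟨i0, hi0, h3⟩ := Finset.exists_min_image s (fun i => ∑ l, (e i • β i) l)
      ⟨i1, (hs i1).2 ⟨h1, h2⟩⟩
    refine ⟨i0, (hs i0).1 hi0, fun j hj => ?_⟩
    rcases hcomp i0 j ((hs i0).1 hi0) hj with h4 | h4
    · exact h4
    · refine le_of_eq ?_
      by_contra hne
      have h5 : ∃ l, (e j • β j) l < (e i0 • β i0) l := by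
        by_contra! h6
        exact hne (le_antisymm h6 h4)
      have h7 := Finset.sum_lt_sum (s := Finset.univ) (fun l _ => h4 l) (by simpa using h5)
      exact absurd (h3 j ((hs j).2 hj)) (by simpa using h7)
  set α := e i0 • β i0 with hα
  have hle : ∀ j, (j < n ∧ ¬ a j =ᶠ[𝓝 0] 0) → (n + 1 - j) • α ≤ N • β j := by
    intro j hj
    calc (n + 1 - j) • α ≤ (n + 1 - j) • (e j • β j) := nsmul_le_nsmul_right (hmin j hj) _
      _ = N • β j := by rw [smul_smul, hdiv j hj.1]
  refine Mon.pow_all (T := S.erase k) (Finset.erase_subset _ _) hN fun c hc => ?_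
  have hpk : ∀ x, powMap (S.erase k) N c x k = x k := fun x => by simp [powMap]
  let b : ℕ → (ι → 𝕜) → 𝕜 := fun j x => if j < n ∧ ¬ a j =ᶠ[𝓝 0] 0 then
    monom (β j) c * monom (N • β j - (n + 1 - j) • α) x * u j (powMap (S.erase k) N c x) else 0
  have hb : ∀ j, AnalyticAt 𝕜 (b j) 0 := by
    intro j
    by_cases hj : j < n ∧ ¬ a j =ᶠ[𝓝 0] 0
    · simp only [b, if_pos hj]
      exact (analyticAt_const.mul (analyticAt_monom _ 0)).mul
        (AnalyticAt.comp_powMap (hu j hj) _ hN c)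
    · simp only [b, if_neg hj]
      exact analyticAt_const
  have hbS : ∀ j, DependsOn (b j) (S.erase k : Set ι) := by
    intro j x y hxy
    by_cases hj : j < n ∧ ¬ a j =ᶠ[𝓝 0] 0
    · have h1 := dependsOn_comp_powMap (huS j hj) (S.erase k) N c hxy
      have h2 : monom (N • β j - (n + 1 - j) • α) x = monom (N • β j - (n + 1 - j) • α) y :=
        dependsOn_monom (fun i hi => by simp [hβ j hj i hi]) hxy
      simp only at h1
      simp only [b, if_pos hj, h1, h2]
    · simp only [b, if_neg hj]
  have hb0 : ∃ i < n, b i 0 ≠ 0 := by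
    refine ⟨i0, hi0.1, ?_⟩
    have h1 : N • β i0 - (n + 1 - i0) • α = 0 := by
      rw [hα, smul_smul, hdiv i0 hi0.1, tsub_self]
    simp only [b, if_pos hi0, h1, monom_zero, mul_one, powMap_zero _ hN]
    exact mul_ne_zero (monom_ne_zero fun i hi => absurd hi (hc i)) (hu0 i0 hi0)
  refine (mon_of_weighted hk claim (α := α) (fun i hi => by simp [hα, hβ i0 hi0 i hi]) hb hbS hb0
    (AnalyticAt.comp_powMap hU (S.erase k) hN c) (dependsOn_comp_powMap hUS _ N c)
    (by rwa [powMap_zero _ hN]) (hA.comp_powMap hAS hN hc) ?_).congr ?_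
  · intro x y hxy
    have h1 := dependsOn_comp_powMap hAS (S.erase k) N c hxy
    simp only at h1 ⊢
    rw [h1]
    congr 1
    exact Finset.prod_congr rfl fun i hi => by rw [hxy i hi]
  · have hall : ∀ᶠ x in 𝓝 (0 : ι → 𝕜), ∀ j ∈ Finset.range n,
        a j (powMap (S.erase k) N c x) = monom ((n + 1 - j) • α) x * b j x := by
      rw [Filter.eventually_all_finset]
      intro j hj
      have hjn := Finset.mem_range.1 hj
      by_cases h0 : a j =ᶠ[𝓝 0] 0
      · filter_upwards [(tendsto_powMap (S.erase k) hN c).eventually h0] with x hx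
        simp only [b, h0, not_true_eq_false, and_false, if_false, mul_zero]
        exact hx
      · have hj' : j < n ∧ ¬ a j =ᶠ[𝓝 0] 0 := ⟨hjn, h0⟩
        filter_upwards [(tendsto_powMap (S.erase k) hN c).eventually (he j hj')] with x hx
        simp only [b, if_pos hj']
        have h1 : monom (N • β j) x = monom ((n + 1 - j) • α) x *
            monom (N • β j - (n + 1 - j) • α) x := by
          rw [← monom_add, add_tsub_cancel_of_le (hle j hj')]
        rw [hx, monom_powMap (hβ j hj'), h1]
        ring
    filter_upwards [hall] with x hx
    change (∑ i ∈ Finset.range n, a i (powMap (S.erase k) N c x) *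
      powMap (S.erase k) N c x k ^ i + powMap (S.erase k) N c x k ^ (n + 1) *
        U (powMap (S.erase k) N c x)) * A (powMap (S.erase k) N c x) *
          ∏ i ∈ S.erase k, x i ^ (N - 1) = _
    rw [hpk, Finset.sum_congr rfl fun j hj => by rw [hx j hj]]
    ring

lemma mon_of_coeffs {S : Finset ι} {k : ι} (hk : k ∈ S) {n : ℕ}
    (claim : ∀ d < n + 1, MonOfOrder 𝕜 S k d) {B : (ι → 𝕜) → 𝕜} (hB : Mon (S.erase k) B)
    {a : ℕ → (ι → 𝕜) → 𝕜} (haA : ∀ i, AnalyticAt 𝕜 (a i) 0)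
    (haS : ∀ i, DependsOn (a i) (S.erase k : Set ι))
    (ha : ∀ i < n, a i =ᶠ[𝓝 0] 0 ∨ GDvd (a i) B) (ha0 : ∃ i < n, GDvd (a i) B)
    (hd : ∀ i < n, ∀ j < n,
      (fun x => a i x ^ ((n + 1).factorial / (n + 1 - i)) -
        a j x ^ ((n + 1).factorial / (n + 1 - j))) =ᶠ[𝓝 0] 0 ∨
      GDvd (fun x => a i x ^ ((n + 1).factorial / (n + 1 - i)) -
        a j x ^ ((n + 1).factorial / (n + 1 - j))) B)
    {U : (ι → 𝕜) → 𝕜} (hU : AnalyticAt 𝕜 U 0) (hUS : DependsOn U (S : Set ι)) (hU0 : U 0 ≠ 0)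
    {A : (ι → 𝕜) → 𝕜} (hA : AnalyticAt 𝕜 A 0) (hAB : GDvd A B)
    (hAS : DependsOn A (S.erase k : Set ι)) :
    Mon S fun x => (∑ i ∈ Finset.range n, a i x * x k ^ i + x k ^ (n + 1) * U x) * A x := by
  induction hB generalizing a U A with
  | unit B hB =>
    refine mon_of_coeffs_monUnit hk claim haS (fun i hi => (ha i hi).imp_right fun h =>
      .of_dvd (haA i) hB h) ?_ (fun i hi j hj => (hd i hi j hj).imp_right fun h =>
      .of_dvd (((haA i).pow _).sub ((haA j).pow _)) hB h) hU hUS hU0 (.of_dvd hA hB hAB) hAS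
    obtain ⟨i, hi, h⟩ := ha0
    exact ⟨i, hi, (MonUnit.of_dvd (haA i) hB h).not_eventually_zero⟩
  | step B 𝒞 h𝒞 _ ih =>
    refine .step _ 𝒞 (h𝒞.mono (Finset.erase_subset _ _)) fun χ hχ => ?_
    have hχ' := h𝒞.isChart hχ
    refine (ih χ hχ (a := fun i x => a i (χ.1 x)) (U := fun x => U (χ.1 x))
      (A := fun x => A (χ.1 x) * χ.2 x) (fun i => hχ'.comp (haA i))
      (fun i => hχ'.dependsOn_comp le_rfl (haS i)) (fun i hi => (ha i hi).imp ?_ ?_) ?_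
      (fun i hi j hj => (hd i hi j hj).imp ?_ ?_) (hχ'.comp hU)
      (hχ'.dependsOn_comp (Finset.erase_subset _ _) hUS) (by rwa [hχ'.map_zero])
      ((hχ'.comp hA).mul hχ'.analyticAt_jac) (hAB.comp_chart_mul hχ') ?_).congr
      (.of_forall fun x => ?_)
    · exact fun h => hχ'.tendsto.eventually h
    · exact fun h => h.comp_chart hχ'
    · obtain ⟨i, hi, h⟩ := ha0
      exact ⟨i, hi, h.comp_chart hχ'⟩
    · exact fun h => hχ'.tendsto.eventually h
    · exact fun h => h.comp_chart hχ'
    · intro x y hxy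
      have h1 := hχ'.dependsOn_comp le_rfl hAS hxy
      simp only at h1 ⊢
      rw [h1, hχ'.dependsOn_jac hxy]
    · simp only [hχ'.apply_of_notMem x k (by simp)]
      ring

variable [IsUltrametricDist 𝕜]

lemma monOfOrder {S : Finset ι} {k : ι} (hk : k ∈ S)
    (IH : ∀ F : (ι → 𝕜) → 𝕜, AnalyticAt 𝕜 F 0 → DependsOn F (S.erase k : Set ι) →
      ¬ F =ᶠ[𝓝 0] 0 → Mon (S.erase k) F) (d : ℕ) : MonOfOrder 𝕜 S k d := by
  classical
  induction d using Nat.strong_induction_on with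
  | _ d ih =>
  intro F A hF hFS hord hA hAS hA0
  have hkS : k ∉ S.erase k := by simp
  have hsub : S.erase k ⊆ S := Finset.erase_subset _ _
  rcases d with _ | n
  · have hF0 : F 0 ≠ 0 := by
      obtain ⟨ψ, -, h2, h3⟩ := hord
      have := h3.self_of_nhds
      simp only [Pi.single_zero, pow_zero, one_mul] at this
      rwa [this]
    simpa using Mon.mul_coord_pow_mul_unit hkS hsub (IH A hA hAS hA0) hF hF0 0
  · obtain ⟨c, a, U, hc, hc', hc0, hcS, ha, haS, hU, hUS, hU0, he⟩ :=
      exists_tschirnhausen hF hFS hk hord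
    refine Mon.shear hk hc hc' hc0 hcS ?_
    have hupd : ∀ (x : ι → 𝕜) (t : 𝕜), A (Function.update x k t) = A x := by
      intro x t
      refine hAS fun j hj => ?_
      have : j ≠ k := by
        rintro rfl; simp at hj
      simp [this]
    suffices h : Mon S fun x =>
        (∑ i ∈ Finset.range n, a i x * x k ^ i + x k ^ (n + 1) * U x) * A x by
      refine h.congr ?_
      filter_upwards [he] with x hx
      rw [hx, hupd]
    by_cases hall : ∀ i < n, a i =ᶠ[𝓝 0] 0
    · refine (Mon.mul_coord_pow_mul_unit hkS hsub (IH A hA hAS hA0) hU hU0 (n + 1)).congr ?_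
      have : ∀ᶠ x in 𝓝 (0 : ι → 𝕜), ∀ i ∈ Finset.range n, a i x = 0 :=
        (Filter.eventually_all_finset _).2 fun i hi => hall i (Finset.mem_range.1 hi)
      filter_upwards [this] with x hx
      rw [Finset.sum_eq_zero fun i hi => by rw [hx i hi, zero_mul], zero_add]
    · push Not at hall
      obtain ⟨i0, hi0, hai0⟩ := hall
      let nz : ((ι → 𝕜) → 𝕜) → (ι → 𝕜) → 𝕜 := fun f => if f =ᶠ[𝓝 0] 0 then fun _ => 1 else f
      have hnzA : ∀ {f : (ι → 𝕜) → 𝕜}, AnalyticAt 𝕜 f 0 → AnalyticAt 𝕜 (nz f) 0 := by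
        intro f hf
        by_cases h : f =ᶠ[𝓝 0] 0
        · simp only [nz, if_pos h]; exact analyticAt_const
        · simp only [nz, if_neg h]; exact hf
      have hnzS : ∀ {f : (ι → 𝕜) → 𝕜}, DependsOn f (S.erase k : Set ι) →
          DependsOn (nz f) (S.erase k : Set ι) := by
        intro f hf
        by_cases h : f =ᶠ[𝓝 0] 0
        · simp only [nz, if_pos h]; exact fun _ _ _ => rfl
        · simp only [nz, if_neg h]; exact hf
      have hnz0 : ∀ f : (ι → 𝕜) → 𝕜, ¬ nz f =ᶠ[𝓝 0] 0 := by
        intro f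
        by_cases h : f =ᶠ[𝓝 0] 0
        · simp only [nz, if_pos h]
          intro h'
          simpa using h'.self_of_nhds
        · simp only [nz, if_neg h]; exact h
      let D : ℕ × ℕ → (ι → 𝕜) → 𝕜 := fun q x => a q.1 x ^ ((n + 1).factorial / (n + 1 - q.1)) -
        a q.2 x ^ ((n + 1).factorial / (n + 1 - q.2))
      have hDA : ∀ q, AnalyticAt 𝕜 (D q) 0 := fun q => ((ha q.1).pow _).sub ((ha q.2).pow _)
      have hDS : ∀ q, DependsOn (D q) (S.erase k : Set ι) := by
        intro q x y hxy
        simp only [D, haS q.1 hxy, haS q.2 hxy]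
      let B1 : (ι → 𝕜) → 𝕜 := fun x => ∏ i ∈ Finset.range n, nz (a i) x
      let B2 : (ι → 𝕜) → 𝕜 := fun x => ∏ q ∈ Finset.range n ×ˢ Finset.range n, nz (D q) x
      have hB1 : AnalyticAt 𝕜 B1 0 := Finset.analyticAt_fun_prod _ fun i _ => hnzA (ha i)
      have hB2 : AnalyticAt 𝕜 B2 0 := Finset.analyticAt_fun_prod _ fun q _ => hnzA (hDA q)
      have hB10 : ¬ B1 =ᶠ[𝓝 0] 0 :=
        not_eventuallyEq_zero_prod (fun i _ => hnzA (ha i)) fun i _ => hnz0 _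
      have hB20 : ¬ B2 =ᶠ[𝓝 0] 0 :=
        not_eventuallyEq_zero_prod (fun i _ => hnzA (hDA i)) fun i _ => hnz0 _
      have hB1d : ∀ i < n, ¬ a i =ᶠ[𝓝 0] 0 → GDvd (a i) B1 := by
        intro i hi h
        have := GDvd.prod (f := fun i => nz (a i)) (fun i _ => hnzA (ha i)) (Finset.mem_range.2 hi)
        simpa only [nz, if_neg h] using this
      have hB2d : ∀ q ∈ Finset.range n ×ˢ Finset.range n, ¬ D q =ᶠ[𝓝 0] 0 → GDvd (D q) B2 := by
        intro q hq h
        have := GDvd.prod (f := fun q => nz (D q)) (fun q _ => hnzA (hDA q)) hq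
        simpa only [nz, if_neg h] using this
      let B : (ι → 𝕜) → 𝕜 := fun x => A x * (B1 x * B2 x)
      have hB : Mon (S.erase k) B := by
        refine IH B (hA.mul (hB1.mul hB2)) ?_
          (not_eventuallyEq_zero_mul hA (hB1.mul hB2) hA0 (not_eventuallyEq_zero_mul hB1 hB2 hB10 hB20))
        intro x y hxy
        have h1 : B1 x = B1 y := Finset.prod_congr rfl fun i _ => hnzS (haS i) hxy
        have h2 : B2 x = B2 y := Finset.prod_congr rfl fun q _ => hnzS (hDS q) hxy
        simp only [B, h1, h2, hAS hxy]
      have hd1 : ∀ i < n, ¬ a i =ᶠ[𝓝 0] 0 → GDvd (a i) B := by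
        intro i hi h
        have h1 := ((hB1d i hi h).mul_left hB2).mul_left hA
        simpa only [B, mul_comm (B1 _)] using h1
      refine mon_of_coeffs hk ih hB ha haS (fun i hi => or_iff_not_imp_left.2 (hd1 i hi))
        ⟨i0, hi0, hd1 i0 hi0 hai0⟩ (fun i hi j hj => or_iff_not_imp_left.2 fun h => ?_) hU hUS hU0
        hA ⟨fun x => B1 x * B2 x, hB1.mul hB2, .of_forall fun x => rfl⟩ hAS
      have h1 := ((hB2d (i, j) (by simp [hi, hj]) h).mul_left hB1).mul_left hA
      exact h1

/-- Local monomialization of nonzero analytic germs. -/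
theorem mon_of_analyticAt (S : Finset ι) : ∀ F : (ι → 𝕜) → 𝕜, AnalyticAt 𝕜 F 0 →
    DependsOn F (S : Set ι) → ¬ F =ᶠ[𝓝 0] 0 → Mon S F := by
  induction S using Finset.induction_on with
  | empty =>
    intro F hF hS h0
    have hconst : ∀ x, F x = F 0 := fun x => hS fun j hj => by simp at hj
    refine .unit F (.of_unit hF fun h => h0 (.of_forall fun x => ?_))
    rw [hconst, h]; rfl
  | insert k S' hk ih =>
    intro F hF hS h0
    have hkS : k ∈ insert k S' := Finset.mem_insert_self _ _
    obtain ⟨l, d, hord⟩ := exists_shear_hasOrder hF hS h0 hkS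
    refine Mon.linear_shear (T := (insert k S').erase k) hkS le_rfl l ?_
    have hord' := monOfOrder (𝕜 := 𝕜) hkS (by rwa [Finset.erase_insert hk]) d
    have hφ : AnalyticAt 𝕜 (fun x : ι → 𝕜 => fun i =>
        if i ∈ (insert k S').erase k then x i + l i * x k else x i) 0 := by
      rw [analyticAt_pi_iff]
      intro i
      split_ifs
      · exact (analyticAt_coord i 0).add (analyticAt_const.mul (analyticAt_coord k 0))
      · exact analyticAt_coord i 0
    refine (hord' _ (fun _ => 1) (AnalyticAt.fun_comp_of_eq hF hφ ?_) ?_ hord analyticAt_const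
      (fun _ _ _ => rfl) ?_).congr (.of_forall fun x => (mul_one _).symm)
    · ext i; simp
    · intro x y hxy
      refine hS fun i hi => ?_
      simp only [hxy i hi, hxy k hkS]
    · intro h
      simpa using h.self_of_nhds

end Germs

section Sequences
open Polynomial

/-- The shift of complex sequences. -/
noncomputable def seqShift : Module.End ℂ (ℕ → ℂ) := LinearMap.funLeft ℂ ℂ (· + 1)

lemma seqShift_apply (s : ℕ → ℂ) (n : ℕ) : seqShift s n = s (n + 1) := rfl

lemma seqShift_pow_apply (i : ℕ) (s : ℕ → ℂ) (n : ℕ) : (seqShift ^ i) s n = s (n + i) := by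
  induction i generalizing n with
  | zero => rfl
  | succ i ih => rw [pow_succ', Module.End.mul_apply, seqShift_apply, ih]; congr 1; ring

lemma aeval_seqShift_apply (P : ℂ[X]) (s : ℕ → ℂ) (n : ℕ) :
    aeval seqShift P s n = P.sum fun i b => b * s (n + i) := by
  rw [aeval_endomorphism, Polynomial.sum, Finset.sum_apply, Polynomial.sum]
  simp [seqShift_pow_apply]

/-- The sequences `n ↦ l ^ n * n ^ j`. -/
def expPoly (q : ℂ × ℕ) (n : ℕ) : ℂ := q.1 ^ n * (n : ℂ) ^ q.2

/-- Exponential polynomials with bases in `Λ` and degree less than `N`. -/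
def expPolySpan (Λ : Finset ℂ) (N : ℕ) : Submodule ℂ (ℕ → ℂ) :=
  Submodule.span ℂ (expPoly '' (Λ ×ˢ Finset.range N : Finset (ℂ × ℕ)))

lemma expPoly_mem {Λ : Finset ℂ} {N : ℕ} {l : ℂ} (hl : l ∈ Λ) {j : ℕ} (hj : j < N) :
    expPoly (l, j) ∈ expPolySpan Λ N :=
  Submodule.subset_span ⟨(l, j), by simp [hl, hj], rfl⟩

lemma expPolySpan_mono {Λ Λ' : Finset ℂ} (h : Λ ⊆ Λ') {N N' : ℕ} (hN : N ≤ N') :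
    expPolySpan Λ N ≤ expPolySpan Λ' N' := by
  refine Submodule.span_mono (Set.image_mono ?_)
  rintro ⟨l, j⟩ hl
  simp only [Finset.coe_product, Finset.coe_range, Set.mem_prod, Finset.mem_coe, Set.mem_Iio]
    at hl ⊢
  exact ⟨h hl.1, hl.2.trans_le hN⟩

lemma pow_mul_poly_mem {Λ : Finset ℂ} {l : ℂ} (hl : l ∈ Λ) {N : ℕ} {Q : ℂ[X]}
    (hQ : Q.degree < N) : (fun n : ℕ => l ^ n * Q.eval (n : ℂ)) ∈ expPolySpan Λ N := by
  have h : (fun n : ℕ => l ^ n * Q.eval (n : ℂ)) =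
      ∑ j ∈ Finset.range N, Q.coeff j • expPoly (l, j) := by
    ext n
    have h1 : Q.eval (n : ℂ) = ∑ j ∈ Finset.range N, Q.coeff j * (n : ℂ) ^ j := by
      by_cases h0 : Q = 0
      · simp [h0]
      · exact Polynomial.eval_eq_sum_range' ((Polynomial.natDegree_lt_iff_degree_lt h0).2 hQ) _
    rw [h1, Finset.sum_apply, Finset.mul_sum]
    refine Finset.sum_congr rfl fun j _ => ?_
    simp [expPoly]; ring
  rw [h]
  exact Submodule.sum_mem _ fun j hj => Submodule.smul_mem _ _
    (expPoly_mem hl (Finset.mem_range.1 hj))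

lemma degree_succ_pow_sub (N : ℕ) : ((X + 1 : ℂ[X]) ^ N - X ^ N).degree < (N : WithBot ℕ) := by
  have h1 : ((X + 1 : ℂ[X]) ^ N).degree = N := by
    rw [show (X + 1 : ℂ[X]) = X + C 1 by simp, Polynomial.degree_pow, Polynomial.degree_X_add_C]
    simp
  have := Polynomial.degree_sub_lt_left (p := (X + 1 : ℂ[X]) ^ N) (q := X ^ N) (by rw [h1]; simp)
    (by rw [← Polynomial.degree_ne_bot, h1]; simp) (by
      rw [show (X + 1 : ℂ[X]) = X + C 1 by simp, (Polynomial.monic_X_add_C 1).pow N |>.leadingCoeff]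
      simp)
  rwa [h1] at this

lemma exists_seqShift_sub_eq {Λ : Finset ℂ} (hΛ : ∀ l ∈ Λ, l ≠ 0) (l : ℂ) {N : ℕ} :
    ∀ t ∈ expPolySpan Λ N, ∃ s ∈ expPolySpan Λ (N + 1), seqShift s - l • s = t := by
  suffices h : expPolySpan Λ N ≤ (expPolySpan Λ (N + 1)).map (seqShift - l • LinearMap.id) by
    intro t ht
    obtain ⟨s, hs, h⟩ := h ht
    exact ⟨s, hs, by simpa using h⟩
  induction N with
  | zero => simp [expPolySpan]
  | succ N ih =>
    have ih' : expPolySpan Λ N ≤ (expPolySpan Λ (N + 1 + 1)).map (seqShift - l • LinearMap.id) :=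
      ih.trans (Submodule.map_mono (expPolySpan_mono le_rfl (by omega)))
    refine Submodule.span_le.2 ?_
    rintro _ ⟨⟨μ, j⟩, hμj, rfl⟩
    have hμj' : μ ∈ Λ ∧ j < N + 1 := by simpa using hμj
    obtain ⟨hμ, hj⟩ := hμj'
    rcases Nat.lt_succ_iff_lt_or_eq.1 hj with hj' | rfl
    · exact ih' (expPoly_mem hμ hj')
    -- the leading term
    have key : ∀ (m : ℕ) (c : ℂ) (r : ℕ → ℂ), m < j + 2 → c ≠ 0 → r ∈ expPolySpan Λ j →
        (seqShift - l • LinearMap.id : Module.End ℂ (ℕ → ℂ)) (expPoly (μ, m)) =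
          c • expPoly (μ, j) + r → expPoly (μ, j) ∈
          (expPolySpan Λ (j + 1 + 1)).map (seqShift - l • LinearMap.id) := by
      intro m c r hm hc hr he
      have h1 : expPoly (μ, j) = c⁻¹ • ((seqShift - l • LinearMap.id : Module.End ℂ (ℕ → ℂ))
          (expPoly (μ, m)) - r) := by
        rw [he, add_sub_cancel_right, smul_smul, inv_mul_cancel₀ hc, one_smul]
      rw [h1]
      exact Submodule.smul_mem _ _ (Submodule.sub_mem _
        (Submodule.mem_map_of_mem (expPoly_mem hμ hm)) (ih' hr))
    by_cases hne : μ = l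
    · subst hne
      have hdeg : ((X + 1 : ℂ[X]) ^ (j + 1) - X ^ (j + 1) - C ((j : ℂ) + 1) * X ^ j).degree <
          (j : WithBot ℕ) := by
        refine (Polynomial.degree_lt_iff_coeff_zero _ _).2 fun m hm => ?_
        rw [show (X + 1 : ℂ[X]) = X + C 1 by simp]
        simp only [Polynomial.coeff_sub, Polynomial.coeff_X_add_C_pow, Polynomial.coeff_X_pow,
          Polynomial.coeff_C_mul, one_pow, one_mul]
        rcases hm.eq_or_lt with rfl | hm
        · simp [Nat.choose_succ_self_right]
        · rcases Nat.eq_or_lt_of_le (Nat.succ_le_of_lt hm) with rfl | hm'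
          · simp
          · have e1 : ¬ m = j + 1 := by omega
            have e2 : ¬ m = j := by omega
            rw [Nat.choose_eq_zero_of_lt (by omega)]
            simp [e1, e2]
      refine key (j + 1) (μ * (j + 1)) (fun n => μ ^ n * (C μ * ((X + 1 : ℂ[X]) ^ (j + 1) -
        X ^ (j + 1) - C ((j : ℂ) + 1) * X ^ j)).eval (n : ℂ)) (by omega)
        (mul_ne_zero (hΛ _ hμ) (by exact_mod_cast Nat.succ_ne_zero j)) (pow_mul_poly_mem hμ ?_) ?_
      · rw [Polynomial.degree_C_mul (hΛ _ hμ)]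
        exact hdeg
      · ext n
        simp [expPoly, seqShift_apply, pow_succ]
        ring
    · refine key j (μ - l) (fun n => μ ^ n * (C μ * ((X + 1 : ℂ[X]) ^ j - X ^ j)).eval (n : ℂ))
        (by omega) (sub_ne_zero.2 hne) (pow_mul_poly_mem hμ ?_) ?_
      · rw [Polynomial.degree_C_mul (hΛ _ hμ)]
        exact degree_succ_pow_sub j
      · ext n
        simp [expPoly, seqShift_apply, pow_succ]
        ring

lemma exists_expPoly_of_multiset {Λ : Finset ℂ} (hΛ : ∀ l ∈ Λ, l ≠ 0) (n₀ : ℕ) (R : Multiset ℂ)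
    (hR : ∀ l ∈ R, l ∈ Λ) (s : ℕ → ℂ)
    (hs : ∀ n, n₀ ≤ n → aeval seqShift (R.map fun l => X - C l).prod s n = 0) :
    ∃ v ∈ expPolySpan Λ (Multiset.card R), ∀ n, n₀ ≤ n → s n = v n := by
  induction R using Multiset.induction_on generalizing s with
  | empty => exact ⟨0, Submodule.zero_mem _, fun n hn => by simpa using hs n hn⟩
  | cons l R ih =>
    have hl := hR l (Multiset.mem_cons_self l R)
    obtain ⟨v, hv, hsv⟩ := ih (fun m hm => hR m (Multiset.mem_cons_of_mem hm))
      (seqShift s - l • s) fun n hn => by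
        have := hs n hn
        rw [Multiset.map_cons, Multiset.prod_cons, mul_comm, map_mul, Module.End.mul_apply] at this
        simpa [Algebra.algebraMap_eq_smul_one] using this
    obtain ⟨w, hw, hwv⟩ := exists_seqShift_sub_eq hΛ l v hv
    refine ⟨w + ((s n₀ - w n₀) / l ^ n₀) • expPoly (l, 0), ?_, ?_⟩
    · rw [Multiset.card_cons]
      exact Submodule.add_mem _ hw (Submodule.smul_mem _ _ (expPoly_mem hl (by omega)))
    · have hl0 := hΛ l hl
      intro n hn
      induction n, hn using Nat.le_induction with
      | base => simp [expPoly]; field_simp; ring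
      | succ n hn ihn =>
        have h1 := hsv n hn
        have h2 := congrFun hwv n
        simp only [Pi.sub_apply, seqShift_apply, Pi.smul_apply, smul_eq_mul] at h1 h2
        simp only [Pi.add_apply, Pi.smul_apply, expPoly, pow_zero, mul_one, smul_eq_mul] at ihn ⊢
        have h3 : s (n + 1) = v n + l * s n := by rw [← h1]; ring
        have h4 : w (n + 1) = v n + l * w n := by rw [← h2]; ring
        rw [h3, h4, ihn, pow_succ]; ring

lemma exists_expPoly {P : ℂ[X]} (hP : P ≠ 0) (h0 : ∀ l, P.IsRoot l → l ≠ 0) (n₀ : ℕ) (s : ℕ → ℂ)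
    (hs : ∀ n, n₀ ≤ n → aeval seqShift P s n = 0) :
    ∃ c : ℂ → ℕ → ℂ, ∀ n, n₀ ≤ n → s n = ∑ l ∈ P.roots.toFinset,
      ∑ j ∈ Finset.range (Multiset.card P.roots), c l j * (l ^ n * (n : ℂ) ^ j) := by
  obtain ⟨v, hv, hsv⟩ := exists_expPoly_of_multiset (Λ := P.roots.toFinset) (fun l hl =>
    h0 l (Polynomial.isRoot_of_mem_roots (Multiset.mem_toFinset.1 hl))) n₀ P.roots
    (fun l hl => Multiset.mem_toFinset.2 hl) s fun n hn => by
      have h1 := hs n hn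
      have h2 := (IsAlgClosed.splits P).eq_prod_roots
      rw [h2, map_mul, Module.End.mul_apply] at h1
      simp only [aeval_C, Module.algebraMap_end_apply, Pi.smul_apply, smul_eq_mul] at h1
      exact (mul_eq_zero.1 h1).resolve_left (Polynomial.leadingCoeff_ne_zero.2 hP)
  obtain ⟨c, hc⟩ := (Submodule.mem_span_image_finset_iff_exists_fun ℂ).1 hv
  refine ⟨fun l j => if h : (l, j) ∈ P.roots.toFinset ×ˢ Finset.range (Multiset.card P.roots)
    then c ⟨(l, j), h⟩ else 0, fun n hn => ?_⟩
  rw [hsv n hn, ← hc, ← Finset.sum_product', Finset.sum_apply,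
    ← Finset.sum_coe_sort (P.roots.toFinset ×ˢ Finset.range (Multiset.card P.roots))]
  refine Finset.sum_congr rfl fun q _ => ?_
  have hq := q.2
  beta_reduce
  rw [dif_pos hq]
  simp [expPoly]

end Sequences

section Asymptotics
open Polynomial
variable (p : ℕ) [Fact p.Prime]

/-- The operator `h ↦ h (p * ·)` on functions on `ℚ_[p]`. -/
noncomputable def padicShift : Module.End ℂ (ℚ_[p] → ℂ) :=
  LinearMap.funLeft ℂ ℂ fun z => (p : ℚ_[p]) * z

variable {p}

lemma padicShift_pow_apply (i : ℕ) (h : ℚ_[p] → ℂ) (z : ℚ_[p]) :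
    (padicShift p ^ i) h z = h ((p : ℚ_[p]) ^ i * z) := by
  induction i generalizing z with
  | zero => simp
  | succ i ih =>
    rw [pow_succ', Module.End.mul_apply]
    change (padicShift p ^ i) h (p * z) = _
    rw [ih, pow_succ, mul_assoc]

lemma aeval_padicShift_apply (P : ℂ[X]) (h : ℚ_[p] → ℂ) (z : ℚ_[p]) :
    aeval (padicShift p) P h z = P.sum fun i b => b * h ((p : ℚ_[p]) ^ i * z) := by
  rw [aeval_endomorphism, Polynomial.sum, Finset.sum_apply, Polynomial.sum]
  simp [padicShift_pow_apply]

lemma padic_prime_ne_zero : (p : ℚ_[p]) ≠ 0 :=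
  Nat.cast_ne_zero.2 (Fact.out : p.Prime).ne_zero

lemma tendsto_mul_left_nhdsNE {a : ℚ_[p]} (ha : a ≠ 0) :
    Tendsto (fun z => a * z) (𝓝[≠] 0) (𝓝[≠] 0) := by
  refine tendsto_nhdsWithin_iff.2 ⟨?_, ?_⟩
  · have : Tendsto (fun z => a * z) (𝓝 0) (𝓝 (a * 0)) := (continuous_const_mul a).tendsto 0
    rw [mul_zero] at this
    exact this.mono_left nhdsWithin_le_nhds
  · filter_upwards [self_mem_nhdsWithin] with z hz
    exact mul_ne_zero ha hz

lemma eventually_aeval_padicShift_eq_zero {h : ℚ_[p] → ℂ} (hh : ∀ᶠ z in 𝓝[≠] 0, h z = 0)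
    (P : ℂ[X]) : ∀ᶠ z in 𝓝[≠] 0, aeval (padicShift p) P h z = 0 := by
  have h1 : ∀ᶠ z in 𝓝[≠] (0 : ℚ_[p]), ∀ i ∈ P.support, h ((p : ℚ_[p]) ^ i * z) = 0 :=
    (Filter.eventually_all_finset _).2 fun i _ =>
      (tendsto_mul_left_nhdsNE (pow_ne_zero i padic_prime_ne_zero)).eventually hh
  filter_upwards [h1] with z hz
  rw [aeval_padicShift_apply, Polynomial.sum]
  exact Finset.sum_eq_zero fun i hi => by rw [hz i hi, mul_zero]

/-- Near the origin, `h` is invariant under multiplication by `u` with `‖u - 1‖ ≤ p ^ (-M)`. -/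
def UnitInvariant (M : ℕ) (h : ℚ_[p] → ℂ) : Prop :=
  ∀ᶠ z in 𝓝[≠] (0 : ℚ_[p]), ∀ u : ℚ_[p], ‖u - 1‖ ≤ (p : ℝ) ^ (-(M : ℤ)) → h (u * z) = h z

lemma UnitInvariant.mono {M N : ℕ} (hMN : M ≤ N) {h : ℚ_[p] → ℂ} (hM : UnitInvariant M h) :
    UnitInvariant N h := by
  filter_upwards [hM] with z hz u hu
  refine hz u (hu.trans (zpow_le_zpow_right₀ ?_ (by omega)))
  exact_mod_cast (Fact.out : p.Prime).one_lt.le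

variable (p) in
/-- The functions which near the origin are unit invariant and satisfy a linear recurrence along
`z ↦ p * z`, all of whose characteristic roots are nonzero and of absolute value less than `1`. -/
noncomputable def asym : Submodule ℂ (ℚ_[p] → ℂ) where
  carrier := {h | ∃ M, UnitInvariant M h ∧ ∃ P : ℂ[X], P ≠ 0 ∧
    (∀ l, P.IsRoot l → l ≠ 0 ∧ ‖l‖ < 1) ∧ ∀ᶠ z in 𝓝[≠] 0, aeval (padicShift p) P h z = 0}
  zero_mem' := ⟨0, .of_forall fun _ _ _ => rfl, 1, one_ne_zero,
    fun l hl => by simp at hl, .of_forall fun _ => by simp⟩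
  add_mem' := by
    rintro a b ⟨M, hM, P, hP, hPr, hPa⟩ ⟨N, hN, Q, hQ, hQr, hQb⟩
    refine ⟨max M N, ?_, P * Q, mul_ne_zero hP hQ, fun l hl => ?_, ?_⟩
    · filter_upwards [hM.mono (le_max_left M N), hN.mono (le_max_right M N)] with z h1 h2 u hu
      simp [h1 u hu, h2 u hu]
    · exact (Polynomial.root_mul.1 hl).elim (hPr l) (hQr l)
    · filter_upwards [eventually_aeval_padicShift_eq_zero hPa Q,
        eventually_aeval_padicShift_eq_zero hQb P] with z h1 h2
      rw [← Module.End.mul_apply, ← map_mul] at h1 h2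
      rw [map_add, Pi.add_apply, h2, mul_comm, h1, add_zero]
  smul_mem' := by
    rintro c a ⟨M, hM, P, hP, hPr, hPa⟩
    refine ⟨M, ?_, P, hP, hPr, ?_⟩
    · filter_upwards [hM] with z h1 u hu
      simp [h1 u hu]
    · filter_upwards [hPa] with z h1
      simp [h1]

lemma asym_of_eventually_eq_zero {h : ℚ_[p] → ℂ} (hh : ∀ᶠ z in 𝓝[≠] 0, h z = 0) :
    h ∈ asym p := by
  refine ⟨1, ?_, 1, one_ne_zero, fun l hl => by simp at hl, by simpa using hh⟩
  obtain ⟨r, hr, hr'⟩ := Metric.eventually_nhds_iff.1 (eventually_nhdsWithin_iff.1 hh)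
  refine eventually_nhdsWithin_iff.2 (Metric.eventually_nhds_iff.2 ⟨r, hr, fun z hz hz0 u hu => ?_⟩)
  have hu1 : ‖u - 1‖ < 1 := hu.trans_lt (by
    rw [zpow_neg]
    exact inv_lt_one_of_one_lt₀ (by simpa using (Fact.out : p.Prime).one_lt))
  have hu2 : ‖u‖ = 1 := by
    have := IsUltrametricDist.norm_add_eq_max_of_norm_ne_norm (x := u - 1) (y := 1)
      (by rw [norm_one]; exact hu1.ne)
    rw [sub_add_cancel, norm_one, max_eq_right hu1.le] at this
    exact this
  rw [hr' hz hz0, hr' (by simpa [hu2] using hz)]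
  refine mul_ne_zero ?_ hz0
  rintro rfl
  simp at hu2

/-- A choice of coefficients of a sequence of exponential polynomial type. -/
noncomputable def expCoeff (Λ : Finset ℂ) (N n₀ : ℕ) (s : ℕ → ℂ) : ℂ → ℕ → ℂ :=
  Classical.epsilon fun c => ∀ n, n₀ ≤ n → s n = ∑ l ∈ Λ, ∑ j ∈ Finset.range N,
    c l j * (l ^ n * (n : ℂ) ^ j)

lemma expCoeff_spec {Λ : Finset ℂ} {N n₀ : ℕ} {s : ℕ → ℂ}
    (h : ∃ c : ℂ → ℕ → ℂ, ∀ n, n₀ ≤ n → s n = ∑ l ∈ Λ, ∑ j ∈ Finset.range N,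
      c l j * (l ^ n * (n : ℂ) ^ j)) {n : ℕ} (hn : n₀ ≤ n) :
    s n = ∑ l ∈ Λ, ∑ j ∈ Finset.range N, expCoeff Λ N n₀ s l j * (l ^ n * (n : ℂ) ^ j) :=
  Classical.epsilon_spec h n hn

lemma exists_expansion_of_mem_asym {h : ℚ_[p] → ℂ} (hh : h ∈ asym p) :
    ∃ (Γ : Finset ℂ) (m : ℂ → ℕ) (e : ℂ → ℕ → ℚ_[p] → ℂ) (δ : ℝ),
      0 < δ ∧ (∀ γ ∈ Γ, 0 < γ.re) ∧ (∀ γ ∈ Γ, 1 ≤ m γ) ∧ (∀ γ i, IsLocallyConstant (e γ i)) ∧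
      ∀ z : ℚ_[p], z ≠ 0 → ‖z‖ < δ →
        h z = ∑ γ ∈ Γ, ∑ i ∈ Finset.Icc 1 (m γ),
            e γ i (z * (p : ℚ_[p]) ^ (-z.valuation)) *
              ((‖z‖ : ℝ) : ℂ) ^ γ * ((Real.log ‖z‖ : ℝ) : ℂ) ^ (i - 1) := by
  classical
  obtain ⟨M, hM, P, hP, hPr, hPh⟩ := hh
  have hp1 : 1 < (p : ℝ) := by exact_mod_cast (Fact.out : p.Prime).one_lt
  have hp0 : 0 < (p : ℝ) := one_pos.trans hp1
  have hlog : 0 < Real.log p := Real.log_pos hp1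
  have hlogC : (Real.log p : ℂ) ≠ 0 := by exact_mod_cast hlog.ne'
  obtain ⟨r, hr, hrz⟩ := Metric.eventually_nhds_iff.1
    (eventually_nhdsWithin_iff.1 (hM.and hPh))
  obtain ⟨n₀, hn₀⟩ := exists_pow_lt_of_lt_one hr (inv_lt_one_of_one_lt₀ hp1)
  have hsmall : ∀ (n : ℕ) (w : ℚ_[p]), n₀ ≤ n → ‖w‖ = 1 →
      dist ((p : ℚ_[p]) ^ n * w) 0 < r ∧ (p : ℚ_[p]) ^ n * w ≠ 0 := by
    intro n w hn hw
    constructor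
    · rw [dist_zero_right, norm_mul, hw, mul_one, norm_pow, Padic.norm_p]
      exact (pow_le_pow_of_le_one (by positivity) (inv_le_one_of_one_le₀ hp1.le) hn).trans_lt hn₀
    · refine mul_ne_zero (pow_ne_zero _ padic_prime_ne_zero) ?_
      rintro rfl; simp at hw
  set Λ := P.roots.toFinset with hΛ
  set N := Multiset.card P.roots with hN
  have hΛr : ∀ l ∈ Λ, l ≠ 0 ∧ ‖l‖ < 1 := fun l hl =>
    hPr l (Polynomial.isRoot_of_mem_roots (Multiset.mem_toFinset.1 hl))
  let s : ℚ_[p] → ℕ → ℂ := fun w n => if n₀ ≤ n then h ((p : ℚ_[p]) ^ n * w) else 0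
  have hs : ∀ w : ℚ_[p], ‖w‖ = 1 → ∃ c : ℂ → ℕ → ℂ, ∀ n, n₀ ≤ n →
      s w n = ∑ l ∈ Λ, ∑ j ∈ Finset.range N, c l j * (l ^ n * (n : ℂ) ^ j) := by
    intro w hw
    refine exists_expPoly hP (fun l hl => (hPr l hl).1) n₀ (s w) fun n hn => ?_
    have h1 := (hrz (hsmall n w hn hw).1 (hsmall n w hn hw).2).2
    rw [aeval_padicShift_apply] at h1
    rw [aeval_seqShift_apply, ← h1]
    refine Finset.sum_congr rfl fun i _ => ?_
    simp only [s, if_pos (le_add_right hn), pow_add]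
    congr 2; ring
  let lam : ℂ → ℂ := fun γ => Complex.exp (-γ * Real.log p)
  let gam : ℂ → ℂ := fun l => -Complex.log l / Real.log p
  have hlg : ∀ l, l ≠ 0 → lam (gam l) = l := by
    intro l hl
    simp only [lam, gam]
    rw [neg_div, neg_neg, div_mul_cancel₀ _ hlogC, Complex.exp_log hl]
  have hinj : Set.InjOn gam (Λ : Set ℂ) := by
    intro a ha b hb hab
    rw [← hlg a (hΛr a ha).1, hab, hlg b (hΛr b hb).1]
  refine ⟨Λ.image gam, fun _ => N, fun γ i w => if ‖w‖ = 1 then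
    expCoeff Λ N n₀ (s w) (lam γ) (i - 1) * (-1 / (Real.log p : ℂ)) ^ (i - 1) else 0,
    (p : ℝ)⁻¹ ^ n₀, by positivity, ?_, ?_, ?_, ?_⟩
  · intro γ hγ
    obtain ⟨l, hl, rfl⟩ := Finset.mem_image.1 hγ
    simp only [gam]
    rw [Complex.div_ofReal_re, Complex.neg_re, Complex.log_re]
    exact div_pos (neg_pos.2 (Real.log_neg (norm_pos_iff.2 (hΛr l hl).1) (hΛr l hl).2)) hlog
  · intro γ hγ
    obtain ⟨l, hl, rfl⟩ := Finset.mem_image.1 hγ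
    exact Multiset.card_pos_iff_exists_mem.2 ⟨l, Multiset.mem_toFinset.1 hl⟩
  · intro γ i
    refine (IsLocallyConstant.iff_eventually_eq _).2 fun w => ?_
    by_cases hw : ‖w‖ = 1
    · have hball : Metric.ball w ((p : ℝ) ^ (-(M : ℤ))) ∈ 𝓝 w :=
        Metric.ball_mem_nhds w (by positivity)
      filter_upwards [hball] with w' hw'
      rw [Metric.mem_ball, dist_eq_norm] at hw'
      have hlt : ‖w' - w‖ < 1 := hw'.trans_le (zpow_le_one_of_nonpos₀ hp1.le (by omega))
      have hw0 : w ≠ 0 := by rintro rfl; simp at hw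
      have hw1 : ‖w'‖ = 1 := by
        have := IsUltrametricDist.norm_add_eq_max_of_norm_ne_norm (x := w' - w) (y := w)
          (by rw [hw]; exact hlt.ne)
        rwa [sub_add_cancel, hw, max_eq_right hlt.le] at this
      have hss : s w' = s w := by
        ext n
        by_cases hn : n₀ ≤ n
        · simp only [s, if_pos hn]
          have := (hrz (hsmall n w hn hw).1 (hsmall n w hn hw).2).1 (w' / w) (by
            rw [div_sub_one hw0, norm_div, hw, div_one]; exact hw'.le)
          rw [← this]
          congr 1
          field_simp
        · simp only [s, if_neg hn]
      simp only [hw, hw1, hss]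
    · have : ∀ᶠ w' in 𝓝 w, ‖w'‖ ≠ 1 := continuous_norm.continuousAt.eventually_ne hw
      filter_upwards [this] with w' hw'
      rw [if_neg hw, if_neg hw']
  · intro z hz hzδ
    have hnorm : ‖z‖ = (p : ℝ) ^ (-z.valuation) := Padic.norm_eq_zpow_neg_valuation hz
    have hval : (n₀ : ℤ) < z.valuation := by
      rw [hnorm, inv_pow, ← zpow_natCast, ← zpow_neg, zpow_lt_zpow_iff_right₀ hp1] at hzδ
      omega
    obtain ⟨n, hn⟩ := Int.eq_ofNat_of_zero_le (show 0 ≤ z.valuation by omega)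
    rw [hn] at hval hnorm ⊢
    have hn0 : n₀ ≤ n := by omega
    set w := z * (p : ℚ_[p]) ^ (-(n : ℤ)) with hw
    have hw1 : ‖w‖ = 1 := by
      rw [hw, norm_mul, norm_zpow, Padic.norm_p, hnorm, inv_zpow, zpow_neg, inv_inv]
      exact inv_mul_cancel₀ (by positivity)
    have hzw : (p : ℚ_[p]) ^ n * w = z := by
      rw [hw, zpow_neg, zpow_natCast]
      have := pow_ne_zero n (padic_prime_ne_zero (p := p))
      field_simp
    have hsz : s w n = h z := by simp only [s, if_pos hn0, hzw]
    have hlz : Real.log ‖z‖ = -n * Real.log p := by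
      rw [hnorm, Real.log_zpow]; push_cast; ring
    rw [← hsz, expCoeff_spec (hs w hw1) hn0, Finset.sum_image hinj]
    refine Finset.sum_congr rfl fun l hl => ?_
    have hpow : ((‖z‖ : ℝ) : ℂ) ^ gam l = l ^ n := by
      have hz0 : ((‖z‖ : ℝ) : ℂ) ≠ 0 := by exact_mod_cast (norm_pos_iff.2 hz).ne'
      rw [Complex.cpow_def_of_ne_zero hz0, ← Complex.ofReal_log (norm_nonneg z), hlz]
      conv_rhs => rw [← hlg l (hΛr l hl).1]
      simp only [lam]
      rw [← Complex.exp_nat_mul]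
      congr 1; push_cast; ring
    beta_reduce
    rw [hlg l (hΛr l hl).1, hpow]
    refine Finset.sum_nbij' (· + 1) (· - 1) (by simp) (by simp; omega) (by simp)
      (by simp; omega) fun i _ => ?_
    rw [if_pos hw1, hlz, Nat.add_sub_cancel]
    have : (n : ℂ) ^ i = (-1 / (Real.log p : ℂ)) ^ i *
        ((-(n : ℝ) * Real.log p : ℝ) : ℂ) ^ i := by
      rw [← mul_pow, Complex.ofReal_mul, Complex.ofReal_neg, Complex.ofReal_natCast]
      congr 1
      field_simp
    rw [this]; ring

end Asymptotics
open MeasureTheory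
open scoped ENNReal NNReal

section Partition
/-- A compact set in an ultrametric space which is a union of closed balls of prescribed radii is a
finite disjoint union of such balls. -/
lemma exists_closedBall_partition {X : Type*} [PseudoMetricSpace X] [IsUltrametricDist X]
    {C : Set X} (hC : IsCompact C) (ρ : X → ℝ)
    (hρ : ∀ a ∈ C, 0 < ρ a ∧ Metric.closedBall a (ρ a) ⊆ C) :
    ∃ t : Finset X, (∀ a ∈ t, a ∈ C) ∧
      (t : Set X).PairwiseDisjoint (fun a => Metric.closedBall a (ρ a)) ∧
      C = ⋃ a ∈ t, Metric.closedBall a (ρ a) := by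
  classical
  have hne : {t : Finset X | (∀ a ∈ t, a ∈ C) ∧
      C ⊆ ⋃ a ∈ t, Metric.closedBall a (ρ a)}.Nonempty := by
    obtain ⟨t, ht, hCt⟩ := hC.elim_nhds_subcover (fun a => Metric.closedBall a (ρ a))
      fun a ha => Metric.closedBall_mem_nhds a (hρ a ha).1
    exact ⟨t, ht, hCt⟩
  obtain ⟨t, ⟨htC, hCt⟩, hmin⟩ := (measure (Finset.card (α := X))).wf.has_min _ hne
  refine ⟨t, htC, ?_, subset_antisymm hCt (iUnion₂_subset fun a ha => (hρ a (htC a ha)).2)⟩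
  have key : ∀ a ∈ t, ∀ b ∈ t, a ≠ b →
      ¬ Metric.closedBall a (ρ a) ⊆ Metric.closedBall b (ρ b) := by
    intro a ha b hb hab hsub
    refine hmin (t.erase a) ⟨fun c hc => htC c (Finset.mem_of_mem_erase hc), fun x hx => ?_⟩
      (Finset.card_erase_lt_of_mem ha)
    obtain ⟨c, hc, hxc⟩ := mem_iUnion₂.1 (hCt hx)
    by_cases hca : c = a
    · exact mem_iUnion₂.2 ⟨b, Finset.mem_erase.2 ⟨hab.symm, hb⟩, hsub (hca ▸ hxc)⟩
    · exact mem_iUnion₂.2 ⟨c, Finset.mem_erase.2 ⟨hca, hc⟩, hxc⟩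
  intro a ha b hb hab
  rcases IsUltrametricDist.closedBall_subset_trichotomy (x := a) (y := b) (r := ρ a) (s := ρ b)
    with h | h | h
  · exact absurd h (key a ha b hb hab)
  · exact absurd h (key b hb a ha hab.symm)
  · exact h

end Partition

section OneVariable
variable {p : ℕ} [Fact p.Prime] [MeasurableSpace ℚ_[p]] [BorelSpace ℚ_[p]]
variable (ν : Measure ℚ_[p]) [ν.IsAddHaarMeasure]

lemma exists_lintegral_comp_mul {a : ℚ_[p]} (ha : a ≠ 0) :
    ∃ c : ℝ≥0∞, ∀ f : ℚ_[p] → ℝ≥0∞, Measurable f → ∫⁻ t, f (a * t) ∂ν = c * ∫⁻ t, f t ∂ν := by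
  let e : ℚ_[p] ≃+ ℚ_[p] := { Equiv.mulLeft₀ a ha with map_add' := fun x y => mul_add a x y }
  have he : Continuous e := continuous_const_mul a
  have hes : Continuous e.symm := continuous_const_mul a⁻¹
  have := e.isAddHaarMeasure_map ν he hes
  refine ⟨Measure.addHaarScalarFactor (ν.map e) ν, fun f hf => ?_⟩
  have h1 : ∫⁻ t, f t ∂(ν.map e) = ∫⁻ t, f (a * t) ∂ν := lintegral_map hf he.measurable
  have h2 := Measure.isAddLeftInvariant_eq_smul (ν.map e) ν
  rw [← h1]
  conv_lhs => rw [h2]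
  rw [lintegral_smul_measure]
  rfl

lemma measurableSet_norm_le (r : ℝ) : MeasurableSet {t : ℚ_[p] | ‖t‖ ≤ r} :=
  measurableSet_le continuous_norm.measurable measurable_const

lemma measure_norm_le_one :
    ν {t : ℚ_[p] | ‖t‖ ≤ 1} = p * ν {t : ℚ_[p] | ‖t‖ ≤ (p : ℝ)⁻¹} := by
  have hlt : ∀ t : ℚ_[p], ‖t‖ ≤ (p : ℝ)⁻¹ ↔ ‖t‖ < 1 := fun t => by
    have := Padic.norm_le_pow_iff_norm_lt_pow_add_one t (-1)
    simpa using this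
  have hp1 : (p : ℝ)⁻¹ ≤ 1 := inv_le_one_of_one_le₀ (by exact_mod_cast (Fact.out : p.Prime).one_le)
  have hU : {t : ℚ_[p] | ‖t‖ ≤ 1} =
      ⋃ i ∈ Finset.range p, (fun t => -(i : ℚ_[p]) + t) ⁻¹' {t : ℚ_[p] | ‖t‖ ≤ (p : ℝ)⁻¹} := by
    ext t
    simp only [mem_ofPred_eq, mem_iUnion, mem_preimage, Finset.mem_range, exists_prop]
    constructor
    · intro ht
      obtain ⟨y, rfl⟩ : ∃ y : ℤ_[p], (y : ℚ_[p]) = t := ⟨⟨t, ht⟩, rfl⟩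
      obtain ⟨i, hi, h⟩ := PadicInt.exists_mem_range y
      refine ⟨i, hi, (hlt _).2 ?_⟩
      rw [IsLocalRing.mem_maximalIdeal, PadicInt.mem_nonunits, PadicInt.norm_def] at h
      rw [neg_add_eq_sub]
      rwa [PadicInt.coe_sub, PadicInt.coe_natCast] at h
    · rintro ⟨i, hi, h⟩
      have h2 : ‖(i : ℚ_[p])‖ ≤ 1 := by
        have := (i : ℤ_[p]).norm_le_one
        rwa [PadicInt.norm_def, PadicInt.coe_natCast] at this
      have := IsUltrametricDist.norm_add_le_max (i : ℚ_[p]) (-(i : ℚ_[p]) + t)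
      rw [add_neg_cancel_left] at this
      exact this.trans (max_le h2 (h.trans hp1))
  rw [hU, measure_biUnion_finset]
  · simp only [measure_preimage_add, Finset.sum_const, Finset.card_range, nsmul_eq_mul]
  · intro i hi j hj hij
    refine Set.disjoint_left.2 fun t ht1 ht2 => hij ?_
    simp only [mem_preimage, mem_ofPred_eq] at ht1 ht2
    rw [hlt] at ht1 ht2
    have h3 : ‖(j : ℚ_[p]) - i‖ < 1 := by
      have := IsUltrametricDist.norm_add_le_max (-(i : ℚ_[p]) + t) (-(-(j : ℚ_[p]) + t))
      rw [norm_neg, show -(i : ℚ_[p]) + t + -(-j + t) = j - i by ring] at this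
      exact this.trans_lt (max_lt ht1 ht2)
    have h4 : ‖(((j : ℤ) - i : ℤ) : ℚ_[p])‖ < 1 := by push_cast; exact h3
    rw [Padic.norm_intCast_lt_one_iff] at h4
    simp only [Finset.coe_range, Set.mem_Iio] at hi hj
    have h5 := Int.eq_zero_of_abs_lt_dvd h4 (by rw [abs_lt]; omega)
    omega
  · exact fun i _ => (measurable_const_add _) (measurableSet_norm_le _)

lemma measure_norm_le_ne_top (r : ℝ) : ν {t : ℚ_[p] | ‖t‖ ≤ r} ≠ ∞ := by
  have : {t : ℚ_[p] | ‖t‖ ≤ r} = Metric.closedBall 0 r := by ext; simp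
  rw [this]
  exact (isCompact_closedBall 0 r).measure_ne_top

lemma measure_norm_le_ne_zero {r : ℝ} (hr : 0 < r) : ν {t : ℚ_[p] | ‖t‖ ≤ r} ≠ 0 := by
  have : {t : ℚ_[p] | ‖t‖ ≤ r} = Metric.closedBall 0 r := by ext; simp
  rw [this]
  exact (Metric.measure_closedBall_pos ν 0 hr).ne'

lemma lintegral_comp_mul_left {a : ℚ_[p]} (ha : a ≠ 0) {f : ℚ_[p] → ℝ≥0∞} (hf : Measurable f) :
    (∫⁻ t, f (a * t) ∂ν) * ‖a‖ₑ = ∫⁻ t, f t ∂ν := by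
  let A : ℚ_[p] → Prop := fun a => ∀ f : ℚ_[p] → ℝ≥0∞, Measurable f →
    (∫⁻ t, f (a * t) ∂ν) * ‖a‖ₑ = ∫⁻ t, f t ∂ν
  have hmeas : ∀ b : ℚ_[p], Measurable fun t => b * t := fun b => measurable_const_mul b
  have hmul : ∀ a b, A a → A b → A (a * b) := by
    intro a b ha hb f hf
    have h1 := hb _ (hf.comp (hmeas a))
    simp only [Function.comp_apply, ← mul_assoc] at h1
    rw [← ha f hf, ← h1, enorm_mul, mul_assoc, mul_comm ‖b‖ₑ]
  have hinv : ∀ a, a ≠ 0 → A a → A a⁻¹ := by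
    intro a ha h f hf
    have h1 := h _ (hf.comp (hmeas a⁻¹))
    simp only [Function.comp_apply, inv_mul_cancel_left₀ ha] at h1
    rw [← h1, mul_assoc, ← enorm_mul, mul_inv_cancel₀ ha, enorm_one, mul_one]
  have hunit : ∀ u : ℚ_[p], ‖u‖ = 1 → A u := by
    intro u hu f hf
    have hu0 : u ≠ 0 := by rintro rfl; simp at hu
    obtain ⟨c, hc⟩ := exists_lintegral_comp_mul ν hu0
    have h1 := hc _ (measurable_one.indicator (measurableSet_norm_le (p := p) 1))
    have h2 : (fun t => {t : ℚ_[p] | ‖t‖ ≤ 1}.indicator (1 : ℚ_[p] → ℝ≥0∞) (u * t)) =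
        {t : ℚ_[p] | ‖t‖ ≤ 1}.indicator 1 := by
      ext t; simp [indicator, hu]
    rw [h2, lintegral_indicator_one (measurableSet_norm_le 1)] at h1
    have h3 : c = 1 := by
      refine (ENNReal.mul_left_inj (measure_norm_le_ne_zero ν one_pos)
        (measure_norm_le_ne_top ν 1)).1 ?_
      rw [← h1, one_mul]
    rw [hc f hf, h3, one_mul, ← ofReal_norm, hu, ENNReal.ofReal_one, mul_one]
  have hp0 : (0 : ℝ) < p := by exact_mod_cast (Fact.out : p.Prime).pos
  have hprime : A p := by
    intro f hf
    obtain ⟨c, hc⟩ := exists_lintegral_comp_mul ν (padic_prime_ne_zero (p := p))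
    have h1 := hc _ (measurable_one.indicator (measurableSet_norm_le (p := p) (p : ℝ)⁻¹))
    have h2 : (fun t => {t : ℚ_[p] | ‖t‖ ≤ (p : ℝ)⁻¹}.indicator (1 : ℚ_[p] → ℝ≥0∞) (p * t)) =
        {t : ℚ_[p] | ‖t‖ ≤ 1}.indicator 1 := by
      ext t
      have : (p : ℝ)⁻¹ * ‖t‖ ≤ (p : ℝ)⁻¹ ↔ ‖t‖ ≤ 1 := by
        rw [inv_mul_le_iff₀ hp0, mul_inv_cancel₀ hp0.ne']
      simp only [indicator, mem_ofPred_eq, norm_mul, Padic.norm_p, this, Pi.one_apply]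
    rw [h2, lintegral_indicator_one (measurableSet_norm_le _),
      lintegral_indicator_one (measurableSet_norm_le _), measure_norm_le_one] at h1
    have h3 : c = p := ((ENNReal.mul_left_inj (measure_norm_le_ne_zero ν (inv_pos.2 hp0))
        (measure_norm_le_ne_top ν _)).1 h1).symm
    rw [hc f hf, h3, ← ofReal_norm, Padic.norm_p, mul_right_comm, ENNReal.ofReal_inv_of_pos hp0,
      ENNReal.ofReal_natCast, ENNReal.mul_inv_cancel (by exact_mod_cast hp0.ne') (by simp), one_mul]
  have hnat : ∀ n : ℕ, A ((p : ℚ_[p]) ^ n) := by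
    intro n
    induction n with
    | zero => rw [pow_zero]; exact hunit 1 norm_one
    | succ n ih => rw [pow_succ]; exact hmul _ _ ih hprime
  have hzpow : ∀ n : ℤ, A ((p : ℚ_[p]) ^ n) := by
    intro n
    obtain ⟨m, rfl | rfl⟩ := n.eq_nat_or_neg
    · rw [zpow_natCast]; exact hnat m
    · rw [zpow_neg, zpow_natCast]; exact hinv _ (pow_ne_zero _ padic_prime_ne_zero) (hnat m)
  have hpz := zpow_ne_zero a.valuation (padic_prime_ne_zero (p := p))
  have : A ((p : ℚ_[p]) ^ a.valuation * (a / (p : ℚ_[p]) ^ a.valuation)) := by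
    refine hmul _ _ (hzpow _) (hunit _ ?_)
    rw [norm_div, Padic.norm_p_zpow, Padic.norm_eq_zpow_neg_valuation ha]
    exact div_self (zpow_pos hp0 _).ne'
  rw [mul_div_cancel₀ _ hpz] at this
  exact this f hf

end OneVariable

section Power
variable {p : ℕ} [Fact p.Prime] [MeasurableSpace ℚ_[p]] [BorelSpace ℚ_[p]]
variable (ν : Measure ℚ_[p]) [ν.IsAddHaarMeasure]

/-- The elements of valuation between `0` and `e - 1`. -/
def shell (p : ℕ) [Fact p.Prime] (e : ℕ) : Set ℚ_[p] :=
  {a | (p : ℝ) ^ (-((e - 1 : ℕ) : ℤ)) ≤ ‖a‖ ∧ ‖a‖ ≤ 1}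

lemma isOpen_norm_le_norm (r : ℝ) : IsOpen {a : ℚ_[p] | r ≤ ‖a‖} := by
  have : {a : ℚ_[p] | r ≤ ‖a‖} = (Metric.ball 0 r)ᶜ := by ext; simp
  rw [this]
  exact (IsUltrametricDist.isClopen_ball 0 r).compl.isOpen

lemma isOpen_norm_le (r : ℝ) (hr : 0 < r) : IsOpen {a : ℚ_[p] | ‖a‖ ≤ r} := by
  have : {a : ℚ_[p] | ‖a‖ ≤ r} = Metric.closedBall 0 r := by ext; simp
  rw [this]
  exact (IsUltrametricDist.isClopen_closedBall 0 hr.ne').isOpen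

lemma prime_pos_real : (0 : ℝ) < p := by exact_mod_cast (Fact.out : p.Prime).pos

lemma one_lt_prime_real : (1 : ℝ) < p := by exact_mod_cast (Fact.out : p.Prime).one_lt

lemma isOpen_shell (e : ℕ) : IsOpen (shell p e) :=
  (isOpen_norm_le_norm _).inter (isOpen_norm_le 1 one_pos)

lemma isCompact_shell (e : ℕ) : IsCompact (shell p e) :=
  (isCompact_closedBall (0 : ℚ_[p]) 1).of_isClosed_subset
    ((isClosed_le continuous_const continuous_norm).inter
      (isClosed_le continuous_norm continuous_const)) fun a ha => by simpa using ha.2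

lemma ne_zero_of_mem_shell {e : ℕ} {a : ℚ_[p]} (ha : a ∈ shell p e) : a ≠ 0 := by
  rintro rfl
  have := ha.1
  rw [norm_zero] at this
  exact absurd this (not_le.2 (zpow_pos prime_pos_real _))

lemma div_pow_mem_shell_iff {e : ℕ} (he : 1 ≤ e) {s : ℚ_[p]} (hs : s ≠ 0) (t : ℚ_[p]) :
    s / t ^ e ∈ shell p e ↔ ‖t‖ = ‖(p : ℚ_[p]) ^ (s.valuation / e)‖ := by
  by_cases ht : t = 0
  · subst ht
    rw [zero_pow (by omega), div_zero, norm_zero]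
    refine iff_of_false (fun h => ne_zero_of_mem_shell h rfl) (norm_ne_zero_iff.2
      (zpow_ne_zero _ padic_prime_ne_zero)).symm
  · have hp := one_lt_prime_real (p := p)
    rw [shell, mem_ofPred_eq, norm_div, norm_pow, Padic.norm_p_zpow,
      Padic.norm_eq_zpow_neg_valuation hs, Padic.norm_eq_zpow_neg_valuation ht, ← zpow_natCast,
      ← zpow_mul, ← zpow_sub₀ prime_pos_real.ne', zpow_le_zpow_iff_right₀ hp,
      zpow_le_one_iff_right₀ hp, zpow_right_inj₀ prime_pos_real hp.ne', neg_inj]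
    have he' : (0 : ℤ) < e := by exact_mod_cast he
    rw [eq_comm, Int.ediv_eq_iff_of_pos he']
    push_cast [he]
    constructor <;> rintro ⟨h1, h2⟩ <;> constructor <;> nlinarith

lemma lintegral_norm_eq_inv {b : ℚ_[p]} (hb : b ≠ 0) :
    ∫⁻ t, {t : ℚ_[p] | ‖t‖ = ‖b‖}.indicator (fun t => ‖t‖ₑ⁻¹) t ∂ν = ν {t | ‖t‖ = 1} := by
  have hm : ∀ r : ℝ, MeasurableSet {t : ℚ_[p] | ‖t‖ = r} := fun r =>
    measurableSet_eq_fun continuous_norm.measurable measurable_const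
  have hmi : Measurable fun t : ℚ_[p] => ‖t‖ₑ⁻¹ := measurable_enorm.inv
  rw [← lintegral_comp_mul_left ν hb (hmi.indicator (hm _)),
    ← lintegral_mul_const _ (by
      exact (hmi.indicator (hm _)).comp (measurable_const_mul b)),
    ← lintegral_indicator_one (hm 1)]
  congr 1 with t
  have hb' : ‖b‖ ≠ 0 := norm_ne_zero_iff.2 hb
  by_cases ht : ‖t‖ = 1
  · have h1 : b * t ∈ {t : ℚ_[p] | ‖t‖ = ‖b‖} := by simp [ht]
    have h2 : ‖b * t‖ₑ = ‖b‖ₑ := by rw [enorm_mul, ← ofReal_norm t, ht]; simp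
    rw [indicator_of_mem h1, indicator_of_mem (show t ∈ {t : ℚ_[p] | ‖t‖ = 1} from ht), h2,
      Pi.one_apply, ENNReal.inv_mul_cancel (enorm_ne_zero.2 hb) enorm_ne_top]
  · have h1 : b * t ∉ {t : ℚ_[p] | ‖t‖ = ‖b‖} := by
      simpa [hb'] using ht
    rw [indicator_of_notMem h1, indicator_of_notMem (show t ∉ {t : ℚ_[p] | ‖t‖ = 1} from ht),
      zero_mul]

/-- The integral of `f` over the coset of `e`-th powers of `a`. -/
noncomputable def powIntegral (e : ℕ) (f : ℚ_[p] → ℝ≥0∞) (a : ℚ_[p]) : ℝ≥0∞ :=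
  ∫⁻ t, f (a * t ^ e) * ‖t‖ₑ ^ (e - 1) ∂ν

lemma powIntegral_mul_pow {e : ℕ} {f : ℚ_[p] → ℝ≥0∞} (hf : Measurable f) {v : ℚ_[p]}
    (hv : ‖v‖ = 1) (a : ℚ_[p]) : powIntegral ν e f (a * v ^ e) = powIntegral ν e f a := by
  have hv0 : v ≠ 0 := by rintro rfl; simp at hv
  have hve : ‖v‖ₑ = 1 := by rw [← ofReal_norm, hv, ENNReal.ofReal_one]
  have := lintegral_comp_mul_left ν hv0 (f := fun t => f (a * t ^ e) * ‖t‖ₑ ^ (e - 1))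
    (by fun_prop)
  rw [powIntegral, powIntegral, ← this, hve, mul_one]
  congr 1 with t
  rw [enorm_mul, hve, one_mul, mul_pow, mul_assoc]

lemma eventually_powIntegral_eq {e : ℕ} (he : 1 ≤ e) {a : ℚ_[p]} (ha : a ≠ 0) :
    ∀ᶠ a' in 𝓝 a, ∀ f : ℚ_[p] → ℝ≥0∞, Measurable f →
      powIntegral ν e f a' = powIntegral ν e f a := by
  have hd : HasStrictDerivAt (fun v : ℚ_[p] => a * v ^ e) (a * (e * 1 ^ (e - 1))) 1 := by
    simpa using (hasStrictDerivAt_pow e (1 : ℚ_[p])).const_mul a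
  have he0 : (e : ℚ_[p]) ≠ 0 := Nat.cast_ne_zero.2 (by omega)
  have hmap := hd.map_nhds_eq (by simp [ha, he0])
  rw [one_pow, mul_one] at hmap
  rw [← hmap, eventually_map]
  have h1 : ∀ᶠ v : ℚ_[p] in 𝓝 1, ‖v‖ = 1 := by
    filter_upwards [Metric.ball_mem_nhds (1 : ℚ_[p]) one_pos] with v hv
    rw [Metric.mem_ball, dist_eq_norm] at hv
    have := IsUltrametricDist.norm_add_eq_max_of_norm_ne_norm (x := v - 1) (y := 1)
      (by rw [norm_one]; exact hv.ne)
    rwa [sub_add_cancel, norm_one, max_eq_right hv.le] at this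
  filter_upwards [h1] with v hv f hf
  exact powIntegral_mul_pow ν hf hv a

lemma setLIntegral_powIntegral {e : ℕ} (he : 1 ≤ e) {f : ℚ_[p] → ℝ≥0∞} (hf : Measurable f) :
    ∫⁻ a in shell p e, powIntegral ν e f a ∂ν = ν {t | ‖t‖ = 1} * ∫⁻ s, f s ∂ν := by
  have hA : MeasurableSet (shell p e) := (isOpen_shell e).measurableSet
  let χ : ℚ_[p] → ℝ≥0∞ := (shell p e).indicator 1
  have hχ : Measurable χ := measurable_one.indicator hA
  have hmi : Measurable fun t : ℚ_[p] => ‖t‖ₑ⁻¹ := measurable_enorm.inv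
  have hae : ∀ᵐ t ∂ν, t ≠ 0 := by simp [ae_iff, measure_singleton]
  calc ∫⁻ a in shell p e, powIntegral ν e f a ∂ν
      = ∫⁻ a, ∫⁻ t, χ a * (f (a * t ^ e) * ‖t‖ₑ ^ (e - 1)) ∂ν ∂ν := by
        rw [← lintegral_indicator hA]
        congr 1 with a
        rw [lintegral_const_mul _ (by fun_prop)]
        by_cases ha : a ∈ shell p e <;> simp [χ, ha, powIntegral]
    _ = ∫⁻ t, ∫⁻ a, χ a * (f (a * t ^ e) * ‖t‖ₑ ^ (e - 1)) ∂ν ∂ν :=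
        lintegral_lintegral_swap (by simp only [Function.uncurry_def]; fun_prop)
    _ = ∫⁻ t, ∫⁻ s, χ (s / t ^ e) * f s * ‖t‖ₑ⁻¹ ∂ν ∂ν := by
        refine lintegral_congr_ae ?_
        filter_upwards [hae] with t ht
        have hte := pow_ne_zero e ht
        have h1 := lintegral_comp_mul_left ν hte (f := fun s => χ (s / t ^ e) * f s * ‖t‖ₑ⁻¹)
          (by fun_prop)
        rw [← h1, ← lintegral_mul_const _ (by fun_prop)]
        congr 1 with a
        rw [mul_div_cancel_left₀ _ hte, mul_comm a, enorm_pow, mul_assoc, mul_assoc]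
        congr 2
        obtain ⟨k, rfl⟩ := Nat.exists_eq_add_of_le' he
        rw [Nat.add_sub_cancel, pow_succ', ← mul_assoc,
          ENNReal.inv_mul_cancel (enorm_ne_zero.2 ht) enorm_ne_top, one_mul]
    _ = ∫⁻ s, ∫⁻ t, χ (s / t ^ e) * f s * ‖t‖ₑ⁻¹ ∂ν ∂ν :=
        lintegral_lintegral_swap (by simp only [Function.uncurry_def]; fun_prop)
    _ = ∫⁻ s, ν {t | ‖t‖ = 1} * f s ∂ν := by
        refine lintegral_congr_ae ?_
        filter_upwards [hae] with s hs
        rw [← lintegral_norm_eq_inv ν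
          (zpow_ne_zero (s.valuation / e) (padic_prime_ne_zero (p := p))), mul_comm,
          ← lintegral_const_mul _ (hmi.indicator
            (measurableSet_eq_fun continuous_norm.measurable measurable_const))]
        congr 1 with t
        by_cases ht : s / t ^ e ∈ shell p e
        · have ht' := (div_pow_mem_shell_iff he hs t).1 ht
          simp only [χ, indicator_of_mem ht, Pi.one_apply, one_mul]
          rw [indicator_of_mem (show t ∈ {t : ℚ_[p] | ‖t‖ = _} from ht')]
        · have ht' := mt (div_pow_mem_shell_iff he hs t).2 ht
          simp only [χ, indicator_of_notMem ht, zero_mul]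
          rw [indicator_of_notMem (show t ∉ {t : ℚ_[p] | ‖t‖ = _} from ht'), mul_zero]
    _ = _ := lintegral_const_mul _ hf

lemma exists_lintegral_eq_sum_pow {e : ℕ} (he : 1 ≤ e) :
    ∃ (Λ : Finset ℚ_[p]) (c : ℚ_[p] → ℝ≥0∞), (∀ a ∈ Λ, a ≠ 0 ∧ c a ≠ ∞) ∧
      ∀ f : ℚ_[p] → ℝ≥0∞, Measurable f →
        ∫⁻ s, f s ∂ν = ∑ a ∈ Λ, c a * ∫⁻ t, f (a * t ^ e) * ‖t‖ₑ ^ (e - 1) ∂ν := by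
  have hρ : ∀ a : ℚ_[p], ∃ ρ : ℝ, a ∈ shell p e → 0 < ρ ∧ Metric.closedBall a ρ ⊆ shell p e ∧
      ∀ a' ∈ Metric.closedBall a ρ, ∀ f : ℚ_[p] → ℝ≥0∞, Measurable f →
        powIntegral ν e f a' = powIntegral ν e f a := by
    intro a
    by_cases ha : a ∈ shell p e
    · obtain ⟨ρ, hρ, h⟩ := Metric.nhds_basis_closedBall.eventually_iff.1
        ((show ∀ᶠ a' in 𝓝 a, a' ∈ shell p e from (isOpen_shell e).mem_nhds ha).and
          (eventually_powIntegral_eq ν he (ne_zero_of_mem_shell ha)))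
      exact ⟨ρ, fun _ => ⟨hρ, fun a' ha' => (h ha').1, fun a' ha' => (h ha').2⟩⟩
    · exact ⟨0, fun h => absurd h ha⟩
  choose ρ hρ using hρ
  obtain ⟨Λ, hΛ, hdisj, hC⟩ := exists_closedBall_partition (isCompact_shell (p := p) e) ρ
    fun a ha => ⟨(hρ a ha).1, (hρ a ha).2.1⟩
  have hS : ν {t : ℚ_[p] | ‖t‖ = 1} ≠ 0 := by
    have h1 : IsOpen {t : ℚ_[p] | ‖t‖ = 1} := by
      have : {t : ℚ_[p] | ‖t‖ = 1} = {t | 1 ≤ ‖t‖} ∩ {t | ‖t‖ ≤ 1} := by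
        ext t; simp [le_antisymm_iff, and_comm]
      rw [this]
      exact (isOpen_norm_le_norm 1).inter (isOpen_norm_le 1 one_pos)
    exact (h1.measure_pos ν ⟨1, by simp⟩).ne'
  have hS' : ν {t : ℚ_[p] | ‖t‖ = 1} ≠ ∞ :=
    ((measure_mono fun t (ht : ‖t‖ = 1) => ht.le).trans_lt
      (measure_norm_le_ne_top ν 1).lt_top).ne
  refine ⟨Λ, fun a => (ν {t : ℚ_[p] | ‖t‖ = 1})⁻¹ * ν (Metric.closedBall a (ρ a)),
    fun a ha => ⟨ne_zero_of_mem_shell (hΛ a ha), ENNReal.mul_ne_top (ENNReal.inv_ne_top.2 hS)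
      (isCompact_closedBall a _).measure_ne_top⟩, fun f hf => ?_⟩
  have h1 := setLIntegral_powIntegral ν he hf
  rw [hC, lintegral_biUnion_finset hdisj fun _ _ => Metric.isClosed_closedBall.measurableSet] at h1
  have h2 : ∀ a ∈ Λ, ∫⁻ a' in Metric.closedBall a (ρ a), powIntegral ν e f a' ∂ν =
      ν (Metric.closedBall a (ρ a)) * powIntegral ν e f a := by
    intro a ha
    rw [setLIntegral_congr_fun Metric.isClosed_closedBall.measurableSet
      (g := fun _ => powIntegral ν e f a)
      fun a' ha' => (hρ a (hΛ a ha)).2.2 a' ha' f hf, setLIntegral_const, mul_comm]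
  rw [Finset.sum_congr rfl h2] at h1
  have h3 : ∫⁻ s, f s ∂ν = (ν {t : ℚ_[p] | ‖t‖ = 1})⁻¹ * (ν {t | ‖t‖ = 1} * ∫⁻ s, f s ∂ν) := by
    rw [← mul_assoc, ENNReal.inv_mul_cancel hS hS', one_mul]
  rw [h3, ← h1, Finset.mul_sum]
  refine Finset.sum_congr rfl fun a _ => ?_
  rw [mul_assoc]; rfl

end Power

section ChangeOfVariables
variable {p : ℕ} [Fact p.Prime] [MeasurableSpace ℚ_[p]] [BorelSpace ℚ_[p]]
variable (ν : Measure ℚ_[p]) [ν.IsAddHaarMeasure]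
variable {ι : Type*} [Fintype ι] [DecidableEq ι]

lemma lintegral_pi_congr (i : ι) {f g : (ι → ℚ_[p]) → ℝ≥0∞} (hf : Measurable f)
    (hg : Measurable g)
    (h : ∀ x, ∫⁻ t, f (Function.update x i t) ∂ν = ∫⁻ t, g (Function.update x i t) ∂ν) :
    ∫⁻ x, f x ∂(Measure.pi fun _ => ν) = ∫⁻ x, g x ∂(Measure.pi fun _ => ν) := by
  refine lintegral_eq_of_lmarginal_eq {i} hf hg ?_
  rw [lmarginal_singleton, lmarginal_singleton]
  exact funext h

lemma ae_coord_ne_zero (i : ι) : ∀ᵐ x ∂(Measure.pi fun _ : ι => ν), x i ≠ 0 := by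
  simpa [ae_iff] using Measure.pi_hyperplane (fun _ : ι => ν) i 0

lemma measurable_update_coord (i : ι) {c : (ι → ℚ_[p]) → ℚ_[p]} (hc : Measurable c) :
    Measurable fun x : ι → ℚ_[p] => Function.update x i (c x) := by
  refine measurable_pi_iff.2 fun j => ?_
  by_cases hj : j = i
  · subst hj; simpa using hc
  · simpa [hj] using measurable_pi_apply j

lemma measurePreserving_shear (i : ι) {c : (ι → ℚ_[p]) → ℚ_[p]} (hc : Measurable c)
    (hci : ∀ x t, c (Function.update x i t) = c x) :
    (Measure.pi fun _ : ι => ν).map (fun x => Function.update x i (x i + c x)) =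
      Measure.pi fun _ => ν := by
  have hφ : Measurable fun x : ι → ℚ_[p] => Function.update x i (x i + c x) :=
    measurable_update_coord i ((measurable_pi_apply i).add hc)
  refine Measure.ext_of_lintegral _ fun f hf => ?_
  rw [lintegral_map hf hφ]
  refine lintegral_pi_congr ν i (hf.comp hφ) hf fun x => ?_
  simp only [Function.update_self, hci, Function.update_idem]
  exact lintegral_add_right_eq_self (fun t => f (Function.update x i t)) (c x)

lemma map_withDensity_scale (i : ι) {c : (ι → ℚ_[p]) → ℚ_[p]} (hc : Measurable c)
    (hci : ∀ x t, c (Function.update x i t) = c x)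
    (hc0 : ∀ᵐ x ∂(Measure.pi fun _ : ι => ν), c x ≠ 0) :
    ((Measure.pi fun _ : ι => ν).withDensity fun x => ‖c x‖₊).map
      (fun x => Function.update x i (c x * x i)) = Measure.pi fun _ => ν := by
  have hφ : Measurable fun x : ι → ℚ_[p] => Function.update x i (c x * x i) :=
    measurable_update_coord i (hc.mul (measurable_pi_apply i))
  have hw : Measurable fun x => ‖c x‖ₑ := measurable_enorm.comp hc
  refine Measure.ext_of_lintegral _ fun f hf => ?_
  rw [lintegral_map hf hφ]
  have hms : MeasurableSet {x | c x ≠ 0} := (hc (measurableSet_singleton 0)).compl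
  have h1 : ∫⁻ x, f x ∂(Measure.pi fun _ : ι => ν) =
      ∫⁻ x, {x | c x ≠ 0}.indicator f x ∂(Measure.pi fun _ : ι => ν) := by
    refine lintegral_congr_ae ?_
    filter_upwards [hc0] with x hx
    rw [indicator_of_mem (show x ∈ {x | c x ≠ 0} from hx)]
  rw [h1]
  change ∫⁻ x, f _ ∂((Measure.pi fun _ : ι => ν).withDensity fun x => ‖c x‖ₑ) = _
  refine (lintegral_withDensity_eq_lintegral_mul _ hw (hf.comp hφ)).trans ?_
  refine lintegral_pi_congr ν i (hw.mul (hf.comp hφ)) (hf.indicator hms) fun x => ?_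
  simp only [Pi.mul_apply, Function.update_self, hci, Function.update_idem, Function.comp_apply]
  by_cases hx : c x = 0
  · have : ∀ t, Function.update x i t ∉ {x | c x ≠ 0} := by simp [hci, hx]
    simp [indicator_of_notMem (this _), hx]
  · have : ∀ t, Function.update x i t ∈ {x | c x ≠ 0} := by simp [hci, hx]
    simp only [indicator_of_mem (this _)]
    have hm : Measurable fun t => f (Function.update x i t) := hf.comp (measurable_update x)
    have hm' : Measurable fun t => f (Function.update x i (c x * t)) :=
      hm.comp (measurable_const_mul (c x))
    rw [← lintegral_comp_mul_left ν hx hm, lintegral_const_mul _ hm', mul_comm]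

lemma exists_eq_sum_map_pow (i : ι) {e : ℕ} (he : 1 ≤ e) :
    ∃ (Λ : Finset ℚ_[p]) (c : ℚ_[p] → ℝ≥0∞), (∀ a ∈ Λ, a ≠ 0 ∧ c a ≠ ∞) ∧
      (Measure.pi fun _ : ι => ν) = ∑ a ∈ Λ, c a •
        ((Measure.pi fun _ : ι => ν).withDensity fun x => ‖x i ^ (e - 1)‖₊).map
          (fun x => Function.update x i (a * x i ^ e)) := by
  obtain ⟨Λ, c, hΛ, h⟩ := exists_lintegral_eq_sum_pow ν he
  refine ⟨Λ, c, hΛ, Measure.ext_of_lintegral _ fun f hf => ?_⟩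
  have hi : Measurable fun x : ι → ℚ_[p] => x i := measurable_pi_apply i
  have hφ : ∀ a : ℚ_[p], Measurable fun x : ι → ℚ_[p] => Function.update x i (a * x i ^ e) :=
    fun a => measurable_update_coord i (by fun_prop)
  have hw : Measurable fun x : ι → ℚ_[p] => ‖x i ^ (e - 1)‖ₑ := by fun_prop
  have hF : ∀ a : ℚ_[p], Measurable fun x : ι → ℚ_[p] =>
      ‖x i ^ (e - 1)‖ₑ * f (Function.update x i (a * x i ^ e)) := fun a =>
    hw.mul (hf.comp (hφ a))
  have h1 : ∀ a : ℚ_[p], ∫⁻ x, f x ∂(c a •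
      ((Measure.pi fun _ : ι => ν).withDensity fun x => ‖x i ^ (e - 1)‖₊).map
          (fun x => Function.update x i (a * x i ^ e))) =
      ∫⁻ x, c a * (‖x i ^ (e - 1)‖ₑ * f (Function.update x i (a * x i ^ e)))
        ∂(Measure.pi fun _ : ι => ν) := by
    intro a
    rw [lintegral_smul_measure, lintegral_map hf (hφ a), lintegral_const_mul _ (hF a), smul_eq_mul]
    congr 1
    exact lintegral_withDensity_eq_lintegral_mul _ hw (hf.comp (hφ a))
  rw [lintegral_finsetSum_measure, Finset.sum_congr rfl fun a _ => h1 a,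
    ← lintegral_finsetSum _ fun a _ => (hF a).const_mul (c a)]
  refine lintegral_pi_congr ν i hf (Finset.measurable_fun_sum _ fun a _ => (hF a).const_mul (c a))
    fun x => ?_
  simp only [Function.update_self, Function.update_idem]
  have hm : Measurable fun t => f (Function.update x i t) := hf.comp (measurable_update x)
  have hm' : ∀ a : ℚ_[p], Measurable fun t : ℚ_[p] =>
      ‖t ^ (e - 1)‖ₑ * f (Function.update x i (a * t ^ e)) := fun a =>
    (by fun_prop : Measurable fun t : ℚ_[p] => ‖t ^ (e - 1)‖ₑ).mul
      (hm.comp (by fun_prop : Measurable fun t : ℚ_[p] => a * t ^ e))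
  rw [h _ hm, lintegral_finsetSum _ fun a _ => (hm' a).const_mul (c a)]
  refine Finset.sum_congr rfl fun a _ => ?_
  rw [lintegral_const_mul _ (hm' a)]
  simp only [enorm_pow, mul_comm]

/-- Change of variables for Bochner integrals. -/
lemma setIntegral_map_withDensity {X Y : Type*} [MeasurableSpace X] [MeasurableSpace Y]
    {μ : Measure X} {φ : X → Y} (hφ : Measurable φ) {w : X → ℝ≥0} (hw : Measurable w)
    {G : Y → ℂ} (hG : Measurable G) {C : Set Y} (hC : MeasurableSet C) :
    ∫ y in C, G y ∂((μ.withDensity fun x => (w x : ℝ≥0∞)).map φ) =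
      ∫ x in φ ⁻¹' C, G (φ x) * ((w x : ℝ) : ℂ) ∂μ := by
  rw [setIntegral_map hC hG.aestronglyMeasurable hφ.aemeasurable,
    setIntegral_withDensity_eq_setIntegral_smul hw _ (hφ hC)]
  congr 1 with x
  rw [mul_comm]; rfl

end ChangeOfVariables

section Loc
variable {p : ℕ} [Fact p.Prime] [MeasurableSpace ℚ_[p]] [BorelSpace ℚ_[p]]
variable (ν : Measure ℚ_[p]) [ν.IsAddHaarMeasure]
variable {ι : Type*} [Fintype ι] [DecidableEq ι] {X : Type*}

/-- Measurable functions that are bounded on bounded sets. -/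
structure LocBdd (G : (ι → ℚ_[p]) → ℂ) : Prop where
  measurable : Measurable G
  bdd : ∀ r : ℝ, ∃ B, ∀ x, ‖x‖ ≤ r → ‖G x‖ ≤ B

lemma exists_norm_le_of_continuous {Y : Type*} [SeminormedAddCommGroup Y]
    {φ : (ι → ℚ_[p]) → Y} (hφ : Continuous φ) (r : ℝ) : ∃ B, ∀ x, ‖x‖ ≤ r → ‖φ x‖ ≤ B := by
  obtain ⟨B, hB⟩ := (isCompact_closedBall (0 : ι → ℚ_[p]) r).exists_bound_of_continuousOn
    hφ.continuousOn
  exact ⟨B, fun x hx => hB x (by simpa using hx)⟩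

variable {ν}

lemma LocBdd.integrableOn {G : (ι → ℚ_[p]) → ℂ} (hG : LocBdd G) {C : Set (ι → ℚ_[p])}
    (hC : MeasurableSet C) {r : ℝ} (h : ∀ x ∈ C, ‖x‖ ≤ r) :
    IntegrableOn G C (Measure.pi fun _ => ν) := by
  obtain ⟨B, hB⟩ := hG.bdd r
  refine Measure.integrableOn_of_bounded (M := B) ?_ hG.measurable.aestronglyMeasurable ?_
  · refine ((measure_mono (t := Metric.closedBall 0 r) fun x hx => ?_).trans_lt
      (isCompact_closedBall (0 : ι → ℚ_[p]) r).measure_lt_top).ne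
    simpa using h x hx
  · exact (ae_restrict_iff' hC).2 (.of_forall fun x hx => hB x (h x hx))

lemma LocBdd.comp_mul {G : (ι → ℚ_[p]) → ℂ} (hG : LocBdd G) {φ : (ι → ℚ_[p]) → ι → ℚ_[p]}
    {J : (ι → ℚ_[p]) → ℚ_[p]} (hφ : Continuous φ) (hJ : Continuous J) :
    LocBdd fun x => G (φ x) * (‖J x‖ : ℂ) where
  measurable := (hG.measurable.comp hφ.measurable).mul
    (Complex.measurable_ofReal.comp hJ.norm.measurable)
  bdd r := by
    obtain ⟨s, hs⟩ := exists_norm_le_of_continuous hφ r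
    obtain ⟨B, hB⟩ := hG.bdd s
    obtain ⟨B', hB'⟩ := exists_norm_le_of_continuous hJ r
    refine ⟨B * B', fun x hx => ?_⟩
    rw [norm_mul, Complex.norm_real, norm_norm]
    exact mul_le_mul (hB _ (hs x hx)) (hB' x hx) (norm_nonneg _)
      ((norm_nonneg _).trans (hB _ (hs x hx)))

lemma restrict_finsetSum {α κ : Type*} [MeasurableSpace α] (s : Finset κ) (μ : κ → Measure α)
    (C : Set α) : (∑ a ∈ s, μ a).restrict C = ∑ a ∈ s, (μ a).restrict C :=
  map_sum (Measure.restrictₗ C) _ _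

variable (ν)

/-- The functions whose integrals over small compact open sets belong to `Q`. -/
def Loc (Q : Submodule ℂ (X → ℂ)) (G : X → (ι → ℚ_[p]) → ℂ) : Prop :=
  ∀ᶠ ε in 𝓝[>] (0 : ℝ), ∀ C : Set (ι → ℚ_[p]), IsCompact C → IsOpen C →
    C ⊆ Metric.closedBall 0 ε → (fun z => ∫ x in C, G z x ∂(Measure.pi fun _ => ν)) ∈ Q

variable {ν}

lemma isCompact_preimage_of_subset {φ : (ι → ℚ_[p]) → ι → ℚ_[p]} (hφ : Continuous φ)
    {C : Set (ι → ℚ_[p])} (hC : IsCompact C) {r : ℝ} (h : φ ⁻¹' C ⊆ Metric.closedBall 0 r) :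
    IsCompact (φ ⁻¹' C) :=
  (isCompact_closedBall _ r).of_isClosed_subset (hC.isClosed.preimage hφ) h

lemma continuous_update_coord (i : ι) {c : (ι → ℚ_[p]) → ℚ_[p]} (hc : Continuous c) :
    Continuous fun x : ι → ℚ_[p] => Function.update x i (c x) :=
  continuous_id.update i hc

lemma Loc.shear {Q : Submodule ℂ (X → ℂ)} {G : X → (ι → ℚ_[p]) → ℂ} (hG : ∀ z, LocBdd (G z))
    {i : ι} {c : (ι → ℚ_[p]) → ℚ_[p]} (hc : Continuous c) (hc0 : c 0 = 0)
    (hci : ∀ x t, c (Function.update x i t) = c x)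
    (h : Loc ν Q fun z x => G z (Function.update x i (x i + c x))) : Loc ν Q G := by
  have hφ := continuous_update_coord i ((continuous_apply i).add hc)
  have hψ := continuous_update_coord i ((continuous_apply i).sub hc)
  obtain ⟨ε, h, hε⟩ := (h.and self_mem_nhdsWithin).exists
  have hev : ∀ᶠ δ in 𝓝[>] (0 : ℝ), ∀ y : ι → ℚ_[p], ‖y‖ ≤ δ →
      ‖Function.update y i (y i - c y)‖ ≤ ε := by
    have h0 : Tendsto (fun x : ι → ℚ_[p] => Function.update x i (x i - c x)) (𝓝 0) (𝓝 0) := by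
      simpa [hc0] using hψ.tendsto 0
    obtain ⟨δ, hδ, hδ'⟩ := Metric.nhds_basis_closedBall.eventually_iff.1
      (h0.eventually (Metric.closedBall_mem_nhds 0 hε))
    filter_upwards [Ioo_mem_nhdsGT hδ] with d hd y hy
    simpa using hδ' (show y ∈ Metric.closedBall 0 δ by simpa using hy.trans hd.2.le)
  filter_upwards [hev] with δ hδ C hC hC' hCδ
  have hsub : (fun x : ι → ℚ_[p] => Function.update x i (x i + c x)) ⁻¹' C ⊆
      Metric.closedBall 0 ε := by
    intro x hx
    have h1 := hδ _ (by simpa using hCδ hx)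
    simpa [hci] using h1
  have h2 := h _ (isCompact_preimage_of_subset hφ hC hsub) (hC'.preimage hφ) hsub
  convert h2 using 2 with z
  conv_lhs => rw [← measurePreserving_shear ν i hc.measurable hci]
  exact setIntegral_map hC'.measurableSet (hG z).measurable.aestronglyMeasurable
    hφ.measurable.aemeasurable

lemma Loc.pow {Q : Submodule ℂ (X → ℂ)} {G : X → (ι → ℚ_[p]) → ℂ} (hG : ∀ z, LocBdd (G z))
    {i : ι} {e : ℕ} (he : 1 ≤ e)
    (h : ∀ a : ℚ_[p], a ≠ 0 → Loc ν Q fun z x =>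
      G z (Function.update x i (a * x i ^ e)) * (‖x i ^ (e - 1)‖ : ℂ)) : Loc ν Q G := by
  obtain ⟨Λ, c, hΛ, hμ⟩ := exists_eq_sum_map_pow ν i he
  obtain ⟨ε, hε', hε⟩ := (((Finset.eventually_all Λ).2
    fun a ha => h a (hΛ a ha).1).and self_mem_nhdsWithin).exists
  have hε : 0 < ε := hε
  have hev : ∀ᶠ δ in 𝓝[>] (0 : ℝ), δ < ε ∧ ∀ a ∈ Λ, δ < ‖a‖ * ε ^ e := by
    refine Eventually.and ?_ ((Finset.eventually_all Λ).2 fun a ha => ?_)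
    · filter_upwards [Ioo_mem_nhdsGT hε] with d hd using hd.2
    · filter_upwards [Ioo_mem_nhdsGT (mul_pos (norm_pos_iff.2 (hΛ a ha).1) (pow_pos hε e))] with
        d hd using hd.2
  have hφ : ∀ a : ℚ_[p], Continuous fun x : ι → ℚ_[p] => Function.update x i (a * x i ^ e) :=
    fun a => continuous_update_coord i (by fun_prop)
  filter_upwards [hev] with δ hδ C hC hC' hCδ
  have hsub : ∀ a ∈ Λ, (fun x : ι → ℚ_[p] => Function.update x i (a * x i ^ e)) ⁻¹' C ⊆
      Metric.closedBall 0 ε := by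
    intro a ha x hx
    have h1 : ‖Function.update x i (a * x i ^ e)‖ ≤ δ := by simpa using hCδ hx
    rw [mem_closedBall_zero_iff, pi_norm_le_iff_of_nonneg hε.le]
    intro j
    have h2 := (norm_le_pi_norm _ j).trans h1
    by_cases hj : j = i
    · subst hj
      rw [Function.update_self, norm_mul, norm_pow] at h2
      have h3 := h2.trans (hδ.2 a ha).le
      rw [mul_le_mul_iff_right₀ (norm_pos_iff.2 (hΛ a ha).1)] at h3
      exact le_of_pow_le_pow_left₀ (by omega) hε.le h3
    · rw [Function.update_of_ne hj] at h2
      exact h2.trans hδ.1.le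
  have key : (fun z => ∫ x in C, G z x ∂(Measure.pi fun _ => ν)) =
      ∑ a ∈ Λ, ((c a).toReal : ℂ) • fun z =>
        ∫ x in (fun x : ι → ℚ_[p] => Function.update x i (a * x i ^ e)) ⁻¹' C,
          G z (Function.update x i (a * x i ^ e)) * (‖x i ^ (e - 1)‖ : ℂ)
            ∂(Measure.pi fun _ => ν) := by
    funext z
    have hInt := (hG z).integrableOn (ν := ν) hC'.measurableSet (r := δ)
      fun x hx => by simpa using hCδ hx
    rw [Finset.sum_apply]
    conv_lhs => rw [hμ, restrict_finsetSum]
    rw [integral_finsetSum_measure]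
    · refine Finset.sum_congr rfl fun a ha => ?_
      rw [Measure.restrict_smul, integral_smul_measure, Pi.smul_apply,
        setIntegral_map_withDensity (hφ a).measurable (by fun_prop) (hG z).measurable
          hC'.measurableSet]
      simp
    · intro a ha
      refine Integrable.mono_measure hInt (Measure.restrict_mono le_rfl ?_)
      conv_rhs => rw [hμ]
      exact Finset.single_le_sum (f := fun a => c a •
        ((Measure.pi fun _ : ι => ν).withDensity fun x => ‖x i ^ (e - 1)‖₊).map
          (fun x => Function.update x i (a * x i ^ e))) (fun _ _ => Measure.zero_le _) ha
  rw [key]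
  exact Q.sum_mem fun a ha => Q.smul_mem _ (hε' a ha _
    (isCompact_preimage_of_subset (hφ a) hC (hsub a ha)) (hC'.preimage (hφ a)) (hsub a ha))

end Loc

section Blow
variable {p : ℕ} [Fact p.Prime] [MeasurableSpace ℚ_[p]] [BorelSpace ℚ_[p]]
variable {ν : Measure ℚ_[p]} [ν.IsAddHaarMeasure]
variable {ι : Type*} [Fintype ι] [DecidableEq ι] {X : Type*}

/-- Change of variables for a blow-up chart, on the part of the space where the quotient of two
coordinates is in a prescribed set. -/
lemma setIntegral_blow {G : (ι → ℚ_[p]) → ℂ} (hG : Measurable G) {i j : ι} (hij : i ≠ j)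
    {C Ω : Set (ι → ℚ_[p])} (hC : MeasurableSet C) (hΩ : MeasurableSet Ω) {T : Set ℚ_[p]}
    (hΩT : ∀ x : ι → ℚ_[p], x j ≠ 0 → (Function.update x i (x j * x i) ∈ Ω ↔ x i ∈ T)) :
    ∫ x in C ∩ Ω, G x ∂(Measure.pi fun _ => ν) =
      ∫ x in (fun x : ι → ℚ_[p] => Function.update x i (x j * x i)) ⁻¹' C ∩ {x | x i ∈ T},
        G (Function.update x i (x j * x i)) * (‖x j‖ : ℂ) ∂(Measure.pi fun _ => ν) := by
  have hφ : Measurable fun x : ι → ℚ_[p] => Function.update x i (x j * x i) :=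
    measurable_update_coord i (by fun_prop)
  have hμ := map_withDensity_scale ν i (c := fun x : ι → ℚ_[p] => x j) (measurable_pi_apply j)
    (fun x t => by rw [Function.update_of_ne hij.symm]) (ae_coord_ne_zero ν j)
  conv_lhs => rw [← hμ]
  rw [setIntegral_map_withDensity hφ (by fun_prop) hG (hC.inter hΩ)]
  refine setIntegral_congr_set ?_
  filter_upwards [ae_coord_ne_zero ν j] with x hx
  exact propext (and_congr_right fun _ => hΩT x hx)

lemma Loc.blow {Q : Submodule ℂ (X → ℂ)} {G : X → (ι → ℚ_[p]) → ℂ} (hG : ∀ z, LocBdd (G z))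
    {i j : ι} (hij : i ≠ j)
    (hA : Loc ν Q fun z x => G z (Function.update x i (x j * x i)) * (‖x j‖ : ℂ))
    (hB : ∀ v : ℚ_[p], Loc ν Q fun z x =>
      G z (Function.update x j (x i * (v + x j))) * (‖x i‖ : ℂ)) : Loc ν Q G := by
  obtain ⟨ε, hA, hε⟩ := (hA.and self_mem_nhdsWithin).exists
  have hε : 0 < ε := hε
  have hBv : ∀ v : ℚ_[p], ∃ ρ, (∀ C : Set (ι → ℚ_[p]), IsCompact C → IsOpen C →
      C ⊆ Metric.closedBall 0 ρ → (fun z => ∫ x in C,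
        G z (Function.update x j (x i * (v + x j))) * (‖x i‖ : ℂ) ∂(Measure.pi fun _ => ν)) ∈ Q) ∧
      0 < ρ ∧ ρ < ε⁻¹ := fun v =>
    ((hB v).and (Ioo_mem_nhdsGT (inv_pos.2 hε))).exists
  choose ρ hB hρ using hBv
  have hT : IsCompact (Metric.ball (0 : ℚ_[p]) ε⁻¹) :=
    (isCompact_closedBall _ _).of_isClosed_subset (IsUltrametricDist.isClopen_ball _ _).isClosed
      Metric.ball_subset_closedBall
  obtain ⟨t, -, hdisj, hTt⟩ := exists_closedBall_partition hT ρ fun a ha => ⟨(hρ a).1, by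
    rw [IsUltrametricDist.ball_eq_of_mem ha]
    exact Metric.closedBall_subset_ball (hρ a).2⟩
  have hev : ∀ᶠ δ in 𝓝[>] (0 : ℝ), δ < ε ∧ ∀ v ∈ t, δ < ρ v := by
    refine Eventually.and ?_ ((Finset.eventually_all t).2 fun a _ => ?_)
    · filter_upwards [Ioo_mem_nhdsGT hε] with d hd using hd.2
    · filter_upwards [Ioo_mem_nhdsGT (hρ a).1] with d hd using hd.2
  filter_upwards [hev] with δ hδ C hC hC' hCδ
  have hCm := hC'.measurableSet
  have hCδ' : ∀ x ∈ C, ‖x‖ ≤ δ := fun x hx => by simpa using hCδ hx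
  let Ω : Set (ι → ℚ_[p]) := {x | ‖x i‖ ≤ ε * ‖x j‖}
  have hΩ : MeasurableSet Ω :=
    (isClosed_le (continuous_apply i).norm (continuous_const.mul (continuous_apply j).norm)).measurableSet
  let φA : (ι → ℚ_[p]) → ι → ℚ_[p] := fun x => Function.update x i (x j * x i)
  have hφA : Continuous φA := continuous_update_coord i (by fun_prop)
  let φB : ℚ_[p] → (ι → ℚ_[p]) → ι → ℚ_[p] := fun v x => Function.update x j (x i * (v + x j))
  have hφB : ∀ v, Continuous (φB v) := fun v => continuous_update_coord j (by fun_prop)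
  have hball : ∀ r : ℝ, 0 < r → IsClopen {x : ι → ℚ_[p] | ‖x‖ ≤ r} := fun r hr => by
    have : {x : ι → ℚ_[p] | ‖x‖ ≤ r} = Metric.closedBall 0 r := by ext; simp
    rw [this]
    exact IsUltrametricDist.isClopen_closedBall (0 : ι → ℚ_[p]) hr.ne'
  have hsub : ∀ (r : ℝ) (S : Set (ι → ℚ_[p])), S ∩ {x | ‖x‖ ≤ r} ⊆ Metric.closedBall 0 r :=
    fun r S x hx => by simpa using hx.2
  have hcomp : ∀ r : ℝ, 0 < r → ∀ φ : (ι → ℚ_[p]) → ι → ℚ_[p], Continuous φ →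
      IsCompact (φ ⁻¹' C ∩ {x | ‖x‖ ≤ r}) := fun r hr φ hφ =>
    (isCompact_closedBall _ r).of_isClosed_subset
      ((hC.isClosed.preimage hφ).inter (hball r hr).isClosed) (hsub r _)
  have hfirst : ∀ z, ∫ x in C ∩ Ω, G z x ∂(Measure.pi fun _ => ν) =
      ∫ x in φA ⁻¹' C ∩ {x | ‖x‖ ≤ ε}, G z (φA x) * (‖x j‖ : ℂ) ∂(Measure.pi fun _ => ν) := by
    intro z
    rw [setIntegral_blow (hG z).measurable hij hCm hΩ (T := {t | ‖t‖ ≤ ε}) fun x hx => by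
      simp only [Ω, mem_ofPred_eq, Function.update_self, Function.update_of_ne hij.symm, norm_mul]
      rw [mul_comm ε, mul_le_mul_iff_right₀ (norm_pos_iff.2 hx)]]
    congr 2
    ext x
    refine and_congr_right fun hx => ⟨fun h => ?_, fun h => (norm_le_pi_norm x i).trans h⟩
    refine (pi_norm_le_iff_of_nonneg hε.le).2 fun k => ?_
    by_cases hk : k = i
    · subst hk; exact h
    · have := (norm_le_pi_norm _ k).trans (hCδ' _ hx)
      simp only [Function.update_of_ne hk] at this
      exact this.trans hδ.1.le
  have hsecond : ∀ z, ∫ x in C ∩ Ωᶜ, G z x ∂(Measure.pi fun _ => ν) =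
      ∑ v ∈ t, ∫ x in φB v ⁻¹' C ∩ {x | ‖x‖ ≤ ρ v},
        G z (φB v x) * (‖x i‖ : ℂ) ∂(Measure.pi fun _ => ν) := by
    intro z
    rw [setIntegral_blow (hG z).measurable hij.symm hCm hΩ.compl (T := Metric.ball 0 ε⁻¹)
      fun x hx => by
        simp only [Ω, mem_compl_iff, mem_ofPred_eq, Function.update_self,
          Function.update_of_ne hij, norm_mul, not_le, mem_ball_zero_iff]
        rw [mul_comm, mul_assoc, mul_comm, mul_lt_iff_lt_one_left (norm_pos_iff.2 hx),
          ← lt_inv_mul_iff₀' hε, mul_one]]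
    have hset : ∀ S : Set (ι → ℚ_[p]), S ∩ {x | x j ∈ Metric.ball (0 : ℚ_[p]) ε⁻¹} =
        ⋃ v ∈ t, S ∩ {x | x j ∈ Metric.closedBall v (ρ v)} := by
      intro S
      rw [hTt]
      ext x
      simp only [mem_inter_iff, mem_ofPred_eq, mem_iUnion, exists_prop]
      tauto
    have hφ0 : Continuous fun x : ι → ℚ_[p] => Function.update x j (x i * x j) :=
      continuous_update_coord j (by fun_prop)
    have hm : ∀ v, MeasurableSet ((fun x : ι → ℚ_[p] => Function.update x j (x i * x j)) ⁻¹' C ∩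
        {x | x j ∈ Metric.closedBall v (ρ v)}) := fun v =>
      ((hC'.preimage hφ0).measurableSet).inter
        (Metric.isClosed_closedBall.preimage (continuous_apply j)).measurableSet
    have hL := (hG z).comp_mul hφ0 (continuous_apply i)
    rw [hset, integral_biUnion_finset t (fun v _ => hm v)]
    · refine Finset.sum_congr rfl fun v hv => ?_
      have hψ := continuous_update_coord (p := p) (ι := ι) j
        (c := fun x => x j + v) (by fun_prop)
      conv_lhs => rw [← measurePreserving_shear ν j (c := fun _ => v) measurable_const
        fun _ _ => rfl]
      rw [setIntegral_map (hm v) hL.measurable.aestronglyMeasurable hψ.measurable.aemeasurable]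
      have hφB' : ∀ x, φB v x = Function.update x j (x i * (v + x j)) := fun _ => rfl
      simp only [hφB', Function.update_idem, Function.update_self, Function.update_of_ne hij,
        add_comm v]
      congr 2
      ext x
      simp only [mem_preimage, mem_inter_iff, mem_ofPred_eq, hφB', Function.update_idem,
        Function.update_self, Function.update_of_ne hij, add_comm v, Metric.mem_closedBall, dist_eq_norm, add_sub_cancel_right]
      refine and_congr_right fun hx => ⟨fun h => ?_, fun h => (norm_le_pi_norm x j).trans h⟩
      refine (pi_norm_le_iff_of_nonneg (hρ v).1.le).2 fun k => ?_
      by_cases hk : k = j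
      · subst hk; exact h
      · have := (norm_le_pi_norm _ k).trans (hCδ' _ hx)
        simp only [Function.update_of_ne hk] at this
        exact this.trans (hδ.2 v hv).le
    · intro v hv w hw hvw
      refine Disjoint.mono inter_subset_right inter_subset_right ?_
      exact (hdisj hv hw hvw).preimage fun x : ι → ℚ_[p] => x j
    · intro v hv
      refine hL.integrableOn (hm v) (r := max δ (max ‖v‖ (ρ v))) fun x hx => ?_
      refine (pi_norm_le_iff_of_nonneg (le_max_of_le_right (le_max_of_le_left
        (norm_nonneg _)))).2 fun k => ?_
      by_cases hk : k = j
      · subst hk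
        have h1 : ‖x k - v‖ ≤ ρ v := by simpa [dist_eq_norm] using hx.2
        have h2 := IsUltrametricDist.norm_add_le_max (x k - v) v
        rw [sub_add_cancel] at h2
        exact h2.trans (max_le (le_max_of_le_right (le_max_of_le_right h1))
          (le_max_of_le_right (le_max_left _ _)))
      · have := (norm_le_pi_norm _ k).trans (hCδ' _ hx.1)
        simp only [Function.update_of_ne hk] at this
        exact this.trans (le_max_left _ _)
  have key : (fun z => ∫ x in C, G z x ∂(Measure.pi fun _ => ν)) =
      (fun z => ∫ x in φA ⁻¹' C ∩ {x | ‖x‖ ≤ ε},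
        G z (φA x) * (‖x j‖ : ℂ) ∂(Measure.pi fun _ => ν)) +
      ∑ v ∈ t, fun z => ∫ x in φB v ⁻¹' C ∩ {x | ‖x‖ ≤ ρ v},
        G z (φB v x) * (‖x i‖ : ℂ) ∂(Measure.pi fun _ => ν) := by
    funext z
    rw [Pi.add_apply, Finset.sum_apply, ← hfirst, ← hsecond, ← Set.sdiff_eq,
      integral_inter_add_sdiff hΩ ((hG z).integrableOn hCm hCδ')]
  rw [key]
  refine Q.add_mem (hA _ (hcomp ε hε φA hφA) ((hC'.preimage hφA).inter (hball ε hε).isOpen)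
    (hsub _ _)) (Q.sum_mem fun v _ => ?_)
  exact hB v _ (hcomp _ (hρ v).1 _ (hφB v)) ((hC'.preimage (hφB v)).inter
    (hball _ (hρ v).1).isOpen) (hsub _ _)

end Blow

section Cover
variable {p : ℕ} [Fact p.Prime] [MeasurableSpace ℚ_[p]] [BorelSpace ℚ_[p]]
variable {ν : Measure ℚ_[p]} [ν.IsAddHaarMeasure]
variable {ι : Type*} [Fintype ι] [DecidableEq ι] {X : Type*}

lemma IsCover.continuous {S : Finset ι} {𝒞 : Set (((ι → ℚ_[p]) → ι → ℚ_[p]) × ((ι → ℚ_[p]) → ℚ_[p]))}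
    (h : IsCover S 𝒞) {χ : ((ι → ℚ_[p]) → ι → ℚ_[p]) × ((ι → ℚ_[p]) → ℚ_[p])} (hχ : χ ∈ 𝒞) :
    Continuous χ.1 ∧ Continuous χ.2 := by
  cases h with
  | shear i hi c hc hc' hc0 hS =>
    obtain rfl := hχ
    exact ⟨continuous_update_coord i (by fun_prop), continuous_const⟩
  | pow i hi e he =>
    obtain ⟨a, ha, rfl⟩ := hχ
    exact ⟨continuous_update_coord i (by fun_prop), by fun_prop⟩
  | blow i j hi hj hij =>
    obtain rfl | ⟨v, rfl⟩ := hχ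
    · exact ⟨continuous_update_coord i (by fun_prop), by fun_prop⟩
    · exact ⟨continuous_update_coord j (by fun_prop), by fun_prop⟩

lemma Loc.of_cover {Q : Submodule ℂ (X → ℂ)} {G : X → (ι → ℚ_[p]) → ℂ} (hG : ∀ z, LocBdd (G z))
    {S : Finset ι} {𝒞 : Set (((ι → ℚ_[p]) → ι → ℚ_[p]) × ((ι → ℚ_[p]) → ℚ_[p]))}
    (h : IsCover S 𝒞) (hχ : ∀ χ ∈ 𝒞, Loc ν Q fun z x => G z (χ.1 x) * (‖χ.2 x‖ : ℂ)) :
    Loc ν Q G := by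
  cases h with
  | shear i hi c hc hc' hc0 hS =>
    refine Loc.shear hG (i := i) hc' hc0 (fun x t => ?_) ?_
    · refine hS fun j hj => ?_
      rw [Function.update_of_ne (Finset.ne_of_mem_erase hj)]
    · simpa using hχ _ rfl
  | pow i hi e he =>
    exact Loc.pow hG (i := i) he fun a ha => hχ _ ⟨a, ha, rfl⟩
  | blow i j hi hj hij =>
    exact Loc.blow hG hij (hχ _ (mem_insert _ _)) fun v => hχ _ (mem_insert_of_mem _ ⟨v, rfl⟩)

lemma loc_of_mon {Q : Submodule ℂ (X → ℂ)} {H : X → ℚ_[p] → ℚ_[p] → ℂ}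
    (hH : ∀ z, Measurable fun q : ℚ_[p] × ℚ_[p] => H z q.1 q.2)
    (hH' : ∀ z, ∃ B, ∀ a b, ‖H z a b‖ ≤ B)
    (hbase : ∀ f g J : (ι → ℚ_[p]) → ℚ_[p], Continuous f → Continuous g → Continuous J →
      MonUnit f → MonUnit g → MonUnit J → Loc ν Q fun z x => H z (f x) (g x) * (‖J x‖ : ℂ))
    {F : (ι → ℚ_[p]) → ℚ_[p]} {S : Finset ι} (hF : Mon S F) {f g J : (ι → ℚ_[p]) → ℚ_[p]}
    (hf : Continuous f) (hg : Continuous g) (hJ : Continuous J)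
    (hfa : AnalyticAt ℚ_[p] f 0) (hga : AnalyticAt ℚ_[p] g 0) (hJa : AnalyticAt ℚ_[p] J 0)
    (hfF : GDvd f F) (hgF : GDvd g F) (hJF : GDvd J F) :
    Loc ν Q fun z x => H z (f x) (g x) * (‖J x‖ : ℂ) := by
  induction hF generalizing f g J with
  | unit F hF =>
    exact hbase f g J hf hg hJ (.of_dvd hfa hF hfF) (.of_dvd hga hF hgF) (.of_dvd hJa hF hJF)
  | step F 𝒞 h𝒞 _ ih =>
    refine Loc.of_cover (fun z => ?_) h𝒞 fun χ hχ => ?_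
    · refine LocBdd.comp_mul (G := fun x => H z (f x) (g x)) (φ := id) ⟨?_, fun r => ?_⟩
        continuous_id hJ
      · exact (hH z).comp (hf.measurable.prodMk hg.measurable)
      · obtain ⟨B, hB⟩ := hH' z
        exact ⟨B, fun x _ => hB _ _⟩
    · obtain ⟨h1, h2⟩ := h𝒞.continuous hχ
      have hc := h𝒞.isChart hχ
      have := ih χ hχ (hf.comp h1) (hg.comp h1) ((hJ.comp h1).mul h2) (hc.comp hfa) (hc.comp hga)
        ((hc.comp hJa).mul hc.analyticAt_jac) (hfF.comp_chart hc) (hgF.comp_chart hc)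
        (hJF.comp_chart_mul hc)
      simpa [mul_assoc] using this

end Cover

section Box
variable {p : ℕ} [Fact p.Prime] [MeasurableSpace ℚ_[p]] [BorelSpace ℚ_[p]]
variable {ν : Measure ℚ_[p]} [ν.IsAddHaarMeasure]
variable {ι : Type*} [Fintype ι] [DecidableEq ι]

lemma setIntegral_dilate (i : ι) {t : ℚ_[p]} (ht : t ≠ 0) {G : (ι → ℚ_[p]) → ℂ}
    (hG : Measurable G) {S : Set (ι → ℚ_[p])} (hS : MeasurableSet S) :
    ∫ x in S, G x ∂(Measure.pi fun _ => ν) =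
      ∫ x in (fun x : ι → ℚ_[p] => Function.update x i (t * x i)) ⁻¹' S,
        G (Function.update x i (t * x i)) * (‖t‖ : ℂ) ∂(Measure.pi fun _ => ν) := by
  conv_lhs => rw [← map_withDensity_scale ν i (c := fun _ => t) measurable_const (fun _ _ => rfl)
    (.of_forall fun _ => ht)]
  exact setIntegral_map_withDensity (measurable_update_coord i (by fun_prop)) (by fun_prop) hG hS

/-- The points of the polydisc of radius `r` whose coordinates in `T` have norm `r`. -/
def box (r : ℝ) (T : Finset ι) : Set (ι → ℚ_[p]) :=
  {x | ∀ i, ‖x i‖ ≤ r ∧ (i ∈ T → ‖x i‖ = r)}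

lemma measurableSet_box (r : ℝ) (T : Finset ι) : MeasurableSet (box r T : Set (ι → ℚ_[p])) := by
  have : (box r T : Set (ι → ℚ_[p])) =
      ⋂ i, {x | ‖x i‖ ≤ r} ∩ {x | i ∈ T → ‖x i‖ = r} := by
    ext x; simp only [box, mem_ofPred_eq, mem_iInter, mem_inter_iff]
  rw [this]
  refine (isClosed_iInter fun i => (isClosed_le (continuous_apply i).norm continuous_const).inter
    ?_).measurableSet
  by_cases hi : i ∈ T
  · simpa [hi] using isClosed_eq (continuous_apply i).norm continuous_const
  · simp [hi]

lemma norm_le_of_mem_box {r : ℝ} (hr : 0 ≤ r) {T : Finset ι} {x : ι → ℚ_[p]} (hx : x ∈ box r T) :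
    ‖x‖ ≤ r :=
  (pi_norm_le_iff_of_nonneg hr).2 fun i => (hx i).1

lemma box_empty {r : ℝ} (hr : 0 ≤ r) :
    (box r ∅ : Set (ι → ℚ_[p])) = Metric.closedBall 0 r := by
  ext x
  simp [box, pi_norm_le_iff_of_nonneg hr]

lemma mem_box_update_iff {r : ℝ} {T : Finset ι} {x : ι → ℚ_[p]} {i : ι} {t : ℚ_[p]} :
    Function.update x i t ∈ box r T ↔
      (‖t‖ ≤ r ∧ (i ∈ T → ‖t‖ = r)) ∧ ∀ j, j ≠ i → ‖x j‖ ≤ r ∧ (j ∈ T → ‖x j‖ = r) := by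
  constructor
  · intro h
    refine ⟨by simpa using h i, fun j hj => ?_⟩
    simpa [hj] using h j
  · rintro ⟨h1, h2⟩ j
    by_cases hj : j = i
    · subst hj; simpa using h1
    · simpa [hj] using h2 j hj

lemma mem_box_iff (i : ι) {r : ℝ} {T : Finset ι} {x : ι → ℚ_[p]} :
    x ∈ box r T ↔
      (‖x i‖ ≤ r ∧ (i ∈ T → ‖x i‖ = r)) ∧ ∀ j, j ≠ i → ‖x j‖ ≤ r ∧ (j ∈ T → ‖x j‖ = r) := by
  rw [← mem_box_update_iff, Function.update_eq_self]

lemma setIntegral_box_eq (N : ℕ) {T : Finset ι} {i : ι} (hi : i ∉ T) {G : (ι → ℚ_[p]) → ℂ}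
    (hG : LocBdd G) :
    ∫ x in box ((p : ℝ) ^ (-(N : ℤ))) T, G x ∂(Measure.pi fun _ => ν) =
      ∫ x in box ((p : ℝ) ^ (-(N : ℤ))) (insert i T), G x ∂(Measure.pi fun _ => ν) +
      ∫ x in box ((p : ℝ) ^ (-(N : ℤ))) T,
        G (Function.update x i (p * x i)) * ((p : ℂ)⁻¹) ∂(Measure.pi fun _ => ν) := by
  set r := (p : ℝ) ^ (-(N : ℤ)) with hr
  have hr0 : 0 < r := zpow_pos prime_pos_real _
  have hm : MeasurableSet {x : ι → ℚ_[p] | ‖x i‖ = r} :=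
    (isClosed_eq (continuous_apply i).norm continuous_const).measurableSet
  rw [← integral_inter_add_sdiff hm (hG.integrableOn (measurableSet_box r T)
    fun x hx => norm_le_of_mem_box hr0.le hx)]
  congr 1
  · congr 2
    ext x
    rw [mem_inter_iff, mem_box_iff i, mem_box_iff i]
    constructor
    · rintro ⟨⟨h1, h2⟩, h3⟩
      exact ⟨⟨h1.1, fun _ => h3⟩, fun j hj => ⟨(h2 j hj).1, fun hjT =>
        (h2 j hj).2 (Finset.mem_of_mem_insert_of_ne hjT hj)⟩⟩
    · rintro ⟨h1, h2⟩
      exact ⟨⟨⟨h1.1, fun h => absurd h hi⟩, fun j hj => ⟨(h2 j hj).1, fun hjT =>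
        (h2 j hj).2 (Finset.mem_insert_of_mem hjT)⟩⟩, h1.2 (Finset.mem_insert_self _ _)⟩
  · rw [setIntegral_dilate i (padic_prime_ne_zero (p := p)) hG.measurable
      (MeasurableSet.diff (measurableSet_box r T) hm)]
    have hnorm : (‖(p : ℚ_[p])‖ : ℂ) = (p : ℂ)⁻¹ := by simp
    rw [hnorm]
    congr 2
    ext x
    rw [mem_preimage, Set.mem_sdiff, mem_box_update_iff, mem_box_iff i]
    simp only [hi, false_imp_iff, and_true, mem_ofPred_eq, Function.update_self]
    rw [and_right_comm]
    refine and_congr_left fun _ => ?_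
    have h1 : ‖x i‖ ≤ r ↔ ‖x i‖ < r * p := by
      rw [hr, Padic.norm_le_pow_iff_norm_lt_pow_add_one, zpow_add_one₀ prime_pos_real.ne']
    rw [h1, norm_mul, Padic.norm_p, ← lt_iff_le_and_ne, inv_mul_lt_iff₀ prime_pos_real, mul_comm r]

end Box

section Recurrence
variable {p : ℕ} [Fact p.Prime]

lemma exists_norm_aeval_padicShift_le {P : Polynomial ℂ} {h : ℚ_[p] → ℂ} (hb : ∃ B, ∀ z, ‖h z‖ ≤ B) :
    ∃ B, ∀ z, ‖Polynomial.aeval (padicShift p) P h z‖ ≤ B := by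
  obtain ⟨B, hB⟩ := hb
  refine ⟨∑ i ∈ P.support, ‖P.coeff i‖ * B, fun z => ?_⟩
  rw [aeval_padicShift_apply]
  refine (norm_sum_le _ _).trans (Finset.sum_le_sum fun i _ => ?_)
  rw [norm_mul]
  exact mul_le_mul_of_nonneg_left (hB _) (norm_nonneg _)

/-- Annihilation near the origin by a polynomial in the shift with roots in the punctured
unit disc. -/
def Annihilated (h : ℚ_[p] → ℂ) : Prop :=
  ∃ P : Polynomial ℂ, P ≠ 0 ∧ (∀ l, P.IsRoot l → l ≠ 0 ∧ ‖l‖ < 1) ∧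
    ∀ᶠ z in 𝓝[≠] 0, Polynomial.aeval (padicShift p) P h z = 0

lemma annihilated_of_recurrence {h h' : ℚ_[p] → ℂ} (hb : ∃ B, ∀ z, ‖h z‖ ≤ B) {a : ℂ}
    (ha : a ≠ 0) (ha1 : ‖a‖ < 1) (k : ℤ)
    (hrec : ∀ z, h z = h' z + a * h ((p : ℚ_[p]) ^ k * z)) (h1 : Annihilated h') :
    Annihilated h := by
  obtain ⟨P, hP0, hPr, hP⟩ := h1
  have hp0 := padic_prime_ne_zero (p := p)
  obtain ⟨k, rfl | rfl⟩ := k.eq_nat_or_neg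
  · have hrec' : h = h' + a • (padicShift p ^ k) h := by
      funext z
      rw [Pi.add_apply, Pi.smul_apply, padicShift_pow_apply, hrec z, smul_eq_mul, zpow_natCast]
    have hcomm : ∀ z, Polynomial.aeval (padicShift p) P h z =
        Polynomial.aeval (padicShift p) P h' z +
          a * Polynomial.aeval (padicShift p) P h ((p : ℚ_[p]) ^ k * z) := by
      intro z
      have h2 : Polynomial.aeval (padicShift p) P ((padicShift p ^ k) h) =
          (padicShift p ^ k) (Polynomial.aeval (padicShift p) P h) := by
        have := (Polynomial.commute_X_pow P k).map (Polynomial.aeval (padicShift p))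
        rw [map_pow, Polynomial.aeval_X] at this
        exact (LinearMap.congr_fun this h).symm
      conv_lhs => rw [hrec', map_add, map_smul, h2]
      rw [Pi.add_apply, Pi.smul_apply, padicShift_pow_apply, smul_eq_mul]
    refine ⟨P, hP0, hPr, ?_⟩
    obtain ⟨B, hB⟩ := exists_norm_aeval_padicShift_le (P := P) hb
    obtain ⟨δ, hδ, hδP⟩ := Metric.mem_nhdsWithin_iff.1 hP
    have hstep : ∀ n : ℕ, ∀ z : ℚ_[p], ‖z‖ < δ → z ≠ 0 →
        ‖Polynomial.aeval (padicShift p) P h z‖ ≤ ‖a‖ ^ n * B := by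
      intro n
      induction n with
      | zero => intro z _ _; simpa using hB z
      | succ n ih =>
        intro z hz hz0
        have h3 : Polynomial.aeval (padicShift p) P h' z = 0 := hδP ⟨by simpa using hz, hz0⟩
        have h4 : ‖(p : ℚ_[p]) ^ k * z‖ < δ := by
          refine lt_of_le_of_lt ?_ hz
          rw [norm_mul, norm_pow]
          exact mul_le_of_le_one_left (norm_nonneg _)
            (pow_le_one₀ (norm_nonneg _) Padic.norm_p_lt_one.le)
        rw [hcomm, h3, zero_add, norm_mul, pow_succ', mul_assoc]
        exact mul_le_mul_of_nonneg_left (ih _ h4 (mul_ne_zero (pow_ne_zero _ hp0) hz0))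
          (norm_nonneg _)
    refine Metric.mem_nhdsWithin_iff.2 ⟨δ, hδ, fun z hz => ?_⟩
    have h5 : Tendsto (fun n : ℕ => ‖a‖ ^ n * B) atTop (𝓝 0) := by
      simpa using (tendsto_pow_atTop_nhds_zero_of_lt_one (norm_nonneg a) ha1).mul_const B
    have h6 := ge_of_tendsto' h5 fun n => hstep n z (by simpa using hz.1) hz.2
    exact norm_le_zero_iff.1 h6
  · rcases Nat.eq_zero_or_pos k with rfl | hk
    · refine ⟨P, hP0, hPr, ?_⟩
      have h1a : (1 - a) ≠ 0 := by
        rintro h0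
        rw [← sub_eq_zero.1 h0] at ha1
        simp at ha1
      have h2 : h = (1 - a)⁻¹ • h' := by
        funext z
        have := hrec z
        simp only [CharP.cast_eq_zero, neg_zero, zpow_zero, one_mul] at this
        rw [Pi.smul_apply, smul_eq_mul, eq_inv_mul_iff_mul_eq₀ h1a]
        linear_combination this
      filter_upwards [hP] with z hz
      rw [h2, map_smul, Pi.smul_apply, hz, smul_zero]
    · have h2 : Polynomial.aeval (padicShift p) (Polynomial.X ^ k - Polynomial.C a) h =
          (padicShift p ^ k) h' := by
        funext z
        rw [map_sub, map_pow, Polynomial.aeval_X, Polynomial.aeval_C, LinearMap.sub_apply,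
          Pi.sub_apply, padicShift_pow_apply, padicShift_pow_apply, hrec]
        rw [zpow_neg, zpow_natCast, inv_mul_cancel_left₀ (pow_ne_zero _ hp0),
          Module.algebraMap_end_apply, Pi.smul_apply, smul_eq_mul, add_sub_cancel_right]
      refine ⟨P * (Polynomial.X ^ k - Polynomial.C a), mul_ne_zero hP0
        (Polynomial.X_pow_sub_C_ne_zero hk a), fun l hl => ?_, ?_⟩
      · refine (Polynomial.root_mul.1 hl).elim (hPr l) fun hl => ?_
        have hla : l ^ k = a := by
          simpa [Polynomial.IsRoot, sub_eq_zero] using hl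
        refine ⟨fun h0 => ha (by rw [← hla, h0, zero_pow hk.ne']), ?_⟩
        rw [← hla, norm_pow] at ha1
        exact (pow_lt_one_iff_of_nonneg (norm_nonneg _) hk.ne').1 ha1
      · have h3 := eventually_aeval_padicShift_eq_zero hP (Polynomial.X ^ k)
        filter_upwards [h3] with z hz
        rw [map_mul, Module.End.mul_apply, h2]
        rw [map_pow, Polynomial.aeval_X] at hz
        have := (Polynomial.commute_X_pow P k).map (Polynomial.aeval (padicShift p))
        rw [map_pow, Polynomial.aeval_X] at this
        have h4 := LinearMap.congr_fun this h'
        rw [Module.End.mul_apply, Module.End.mul_apply] at h4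
        rw [← h4]
        exact hz

end Recurrence

section Homogeneous
variable {p : ℕ} [Fact p.Prime] [MeasurableSpace ℚ_[p]] [BorelSpace ℚ_[p]]
variable {ν : Measure ℚ_[p]} [ν.IsAddHaarMeasure]
variable {ι : Type*} [Fintype ι] [DecidableEq ι]

lemma eventually_norm_eq_one : ∀ᶠ v : ℚ_[p] in 𝓝 1, ‖v‖ = 1 := by
  filter_upwards [Metric.ball_mem_nhds (1 : ℚ_[p]) one_pos] with v hv
  rw [Metric.mem_ball, dist_eq_norm] at hv
  have := IsUltrametricDist.norm_add_eq_max_of_norm_ne_norm (x := v - 1) (y := 1)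
    (by rw [norm_one]; exact hv.ne)
  rwa [sub_add_cancel, norm_one, max_eq_right hv.le] at this

lemma exists_zpow_eq {k : ℤ} (hk : k ≠ 0) :
    ∃ M : ℕ, ∀ u : ℚ_[p], ‖u - 1‖ ≤ (p : ℝ) ^ (-(M : ℤ)) → ∃ t : ℚ_[p], ‖t‖ = 1 ∧ t ^ k = u := by
  have hd := hasStrictDerivAt_zpow (𝕜 := ℚ_[p]) k 1 (.inl one_ne_zero)
  have hmap := hd.map_nhds_eq (by simpa using hk)
  rw [one_zpow] at hmap
  have h : ∀ᶠ u : ℚ_[p] in 𝓝 1, ∃ t : ℚ_[p], ‖t‖ = 1 ∧ t ^ k = u := by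
    rw [← hmap, eventually_map]
    filter_upwards [eventually_norm_eq_one] with v hv using ⟨v, hv, rfl⟩
  obtain ⟨ε, hε, h⟩ := Metric.nhds_basis_ball.eventually_iff.1 h
  obtain ⟨M, hM⟩ := exists_pow_lt_of_lt_one hε (inv_lt_one_of_one_lt₀ (one_lt_prime_real (p := p)))
  refine ⟨M, fun u hu => h ?_⟩
  rw [Metric.mem_ball, dist_eq_norm]
  exact hu.trans_lt (by simpa using hM)

/-- The oscillatory integrand with the constant term removed. -/
noncomputable def osc (Ψ : ℚ_[p] → ℂ) (R : (ι → ℚ_[p]) → ℚ_[p]) (W : (ι → ℚ_[p]) → ℂ)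
    (z : ℚ_[p]) (x : ι → ℚ_[p]) : ℂ := (Ψ (z * R x) - 1) * W x

variable {Ψ : ℚ_[p] → ℂ} {R : (ι → ℚ_[p]) → ℚ_[p]} {W : (ι → ℚ_[p]) → ℂ}

lemma norm_osc_le (hΨ : ∀ x, ‖Ψ x‖ = 1) (z : ℚ_[p]) (x : ι → ℚ_[p]) :
    ‖osc Ψ R W z x‖ ≤ 2 * ‖W x‖ := by
  rw [osc, norm_mul]
  refine mul_le_mul_of_nonneg_right ((norm_sub_le _ _).trans ?_) (norm_nonneg _)
  rw [hΨ, norm_one]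
  norm_num

lemma locBdd_osc (hΨc : Continuous Ψ) (hΨ : ∀ x, ‖Ψ x‖ = 1) (hR : Measurable R) (hW : LocBdd W)
    (z : ℚ_[p]) : LocBdd (osc Ψ R W z) where
  measurable := ((hΨc.measurable.comp (hR.const_mul z)).sub_const 1).mul hW.measurable
  bdd r := by
    obtain ⟨B, hB⟩ := hW.bdd r
    exact ⟨2 * B, fun x hx => (norm_osc_le hΨ z x).trans
      (mul_le_mul_of_nonneg_left (hB x hx) (by norm_num))⟩

variable {κ : ι → ℤ} {b : ι → ℕ}

lemma annihilated_box (hΨc : Continuous Ψ) (hΨ : ∀ x, ‖Ψ x‖ = 1) (hΨ1 : ∀ x, ‖x‖ ≤ 1 → Ψ x = 1)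
    (hR : Measurable R) (hW : LocBdd W)
    (hRh : ∀ i t, t ≠ 0 → ∀ x, R (Function.update x i (t * x i)) = t ^ κ i * R x)
    (hWh : ∀ i t x, W (Function.update x i (t * x i)) = (‖t‖ : ℂ) ^ b i * W x)
    (N : ℕ) (hRb : ∃ B, ∀ x ∈ box ((p : ℝ) ^ (-(N : ℤ))) Finset.univ, ‖R x‖ ≤ B)
    (S : Finset ι) :
    Annihilated fun z => ∫ x in box ((p : ℝ) ^ (-(N : ℤ))) Sᶜ,
      osc Ψ R W z x ∂(Measure.pi fun _ => ν) := by
  have hr0 : 0 < (p : ℝ) ^ (-(N : ℤ)) := zpow_pos prime_pos_real _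
  have hp0 := padic_prime_ne_zero (p := p)
  induction S using Finset.induction_on with
  | empty =>
    rw [Finset.compl_empty]
    obtain ⟨B, hB⟩ := hRb
    refine ⟨1, one_ne_zero, fun l hl => by simp at hl, ?_⟩
    have hz : ∀ᶠ z : ℚ_[p] in 𝓝[≠] 0, ‖z‖ * |B| ≤ 1 := by
      refine nhdsWithin_le_nhds ?_
      have : Tendsto (fun z : ℚ_[p] => ‖z‖ * |B|) (𝓝 0) (𝓝 0) := by
        simpa using (continuous_norm.tendsto (0 : ℚ_[p])).mul_const |B|
      exact (this.eventually (gt_mem_nhds one_pos)).mono fun _ h => h.le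
    filter_upwards [hz] with z hz
    rw [map_one, Module.End.one_apply]
    refine setIntegral_eq_zero_of_forall_eq_zero fun x hx => ?_
    rw [osc, hΨ1, sub_self, zero_mul]
    rw [norm_mul]
    exact (mul_le_mul_of_nonneg_left ((hB x hx).trans (le_abs_self B)) (norm_nonneg _)).trans hz
  | insert i S hi ih =>
    have hin : insert i (insert i S)ᶜ = Sᶜ := by
      ext j; by_cases hj : j = i <;> simp [hj, hi]
    have ha : ‖(p : ℂ)⁻¹ ^ (b i + 1)‖ < 1 := by
      rw [norm_pow, norm_inv, Complex.norm_natCast]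
      exact pow_lt_one₀ (by positivity) (inv_lt_one_of_one_lt₀ one_lt_prime_real) (by omega)
    refine annihilated_of_recurrence ?_ (a := (p : ℂ)⁻¹ ^ (b i + 1))
      (pow_ne_zero _ (inv_ne_zero (Nat.cast_ne_zero.2 (Fact.out : p.Prime).ne_zero))) ha (κ i)
      (fun z => ?_) ih
    · refine ⟨∫ x in box ((p : ℝ) ^ (-(N : ℤ))) (insert i S)ᶜ, 2 * ‖W x‖
        ∂(Measure.pi fun _ => ν), fun z => ?_⟩
      refine norm_integral_le_of_norm_le ?_ (.of_forall fun x => norm_osc_le hΨ z x)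
      exact (hW.integrableOn (measurableSet_box _ _)
        fun x hx => norm_le_of_mem_box hr0.le hx).norm.const_mul 2
    · rw [setIntegral_box_eq N (i := i) (by simp) (locBdd_osc hΨc hΨ hR hW z), hin,
        ← integral_const_mul]
      congr 1
      refine integral_congr_ae (.of_forall fun x => ?_)
      simp only [osc]
      rw [hRh i _ hp0, hWh, Padic.norm_p]
      push_cast
      rw [← mul_assoc z, mul_comm z]
      ring

lemma mem_asym_of_homogeneous (hΨc : Continuous Ψ) (hΨ : ∀ x, ‖Ψ x‖ = 1)
    (hΨ1 : ∀ x, ‖x‖ ≤ 1 → Ψ x = 1) (hR : Measurable R) (hW : LocBdd W)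
    (hRh : ∀ i t, t ≠ 0 → ∀ x, R (Function.update x i (t * x i)) = t ^ κ i * R x)
    (hWh : ∀ i t x, W (Function.update x i (t * x i)) = (‖t‖ : ℂ) ^ b i * W x)
    (N : ℕ) (hRb : ∃ B, ∀ x ∈ box ((p : ℝ) ^ (-(N : ℤ))) Finset.univ, ‖R x‖ ≤ B)
    {i : ι} (hi : κ i ≠ 0) :
    (fun z => ∫ x in Metric.closedBall 0 ((p : ℝ) ^ (-(N : ℤ))),
      osc Ψ R W z x ∂(Measure.pi fun _ => ν)) ∈ asym p := by
  have hr0 : 0 < (p : ℝ) ^ (-(N : ℤ)) := zpow_pos prime_pos_real _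
  have h := annihilated_box (ν := ν) hΨc hΨ hΨ1 hR hW hRh hWh N hRb Finset.univ
  rw [Finset.compl_univ, box_empty hr0.le] at h
  obtain ⟨M, hM⟩ := exists_zpow_eq (p := p) hi
  refine ⟨M, .of_forall fun z u hu => ?_, h⟩
  obtain ⟨t, ht, rfl⟩ := hM u hu
  have ht0 : t ≠ 0 := by rintro rfl; simp at ht
  have hG : Measurable (osc Ψ R W z) := (locBdd_osc hΨc hΨ hR hW z).measurable
  beta_reduce
  rw [setIntegral_dilate i ht0 hG Metric.isClosed_closedBall.measurableSet]
  have hpre : (fun x : ι → ℚ_[p] => Function.update x i (t * x i)) ⁻¹'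
      Metric.closedBall 0 ((p : ℝ) ^ (-(N : ℤ))) =
        Metric.closedBall 0 ((p : ℝ) ^ (-(N : ℤ))) := by
    ext x
    rw [mem_preimage, ← box_empty hr0.le, mem_box_update_iff, mem_box_iff i, norm_mul, ht, one_mul]
  rw [hpre]
  refine integral_congr_ae (.of_forall fun x => ?_)
  simp only [osc]
  rw [hRh i _ ht0, hWh, ht]
  push_cast
  rw [← mul_assoc z, mul_comm z]
  ring

end Homogeneous

section Isometric
lemma map_restrict_closedBall_of_isometric {V : Type*} [NormedAddCommGroup V] [IsUltrametricDist V]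
    [ProperSpace V] [TotallyDisconnectedSpace V] [SecondCountableTopology V]
    [MeasurableSpace V] [BorelSpace V]
    (μ : Measure V) [μ.IsAddHaarMeasure] {r : ℝ} (hr : 0 < r) {τ : V → V} (h0 : τ 0 = 0)
    (hτ : ∀ x ∈ Metric.closedBall (0 : V) r, ∀ y ∈ Metric.closedBall (0 : V) r,
      ‖τ x - τ y‖ = ‖x - y‖) :
    AEMeasurable τ (μ.restrict (Metric.closedBall 0 r)) ∧
      (μ.restrict (Metric.closedBall 0 r)).map τ = μ.restrict (Metric.closedBall 0 r) := by
  set K := Metric.closedBall (0 : V) r with hK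
  have hKo : IsOpen K := IsUltrametricDist.isOpen_closedBall 0 hr.ne'
  have hKc : IsCompact K := isCompact_closedBall _ _
  have hKm : MeasurableSet K := hKo.measurableSet
  have hcont : ContinuousOn τ K := by
    refine LipschitzOnWith.continuousOn (K := 1) (LipschitzOnWith.of_dist_le_mul fun x hx y hy => ?_)
    rw [dist_eq_norm, dist_eq_norm, hτ x hx y hy, NNReal.coe_one, one_mul]
  have hae : AEMeasurable τ (μ.restrict K) := hcont.aemeasurable hKm
  refine ⟨hae, ?_⟩
  have hmaps : ∀ x ∈ K, τ x ∈ K := by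
    intro x hx
    have := hτ x hx 0 (Metric.mem_closedBall_self hr.le)
    rw [h0, sub_zero, sub_zero] at this
    rw [hK, mem_closedBall_zero_iff] at hx ⊢
    rwa [this]
  have happ : ∀ A, MeasurableSet A → (μ.restrict K).map τ A = μ (τ ⁻¹' A ∩ K) := fun A hA => by
    rw [Measure.map_apply_of_aemeasurable hae hA, Measure.restrict_apply' hKm]
  have hle : ∀ A ⊆ K, IsClopen A → μ (τ ⁻¹' A ∩ K) ≤ μ A := by
    intro A hAK hA
    have hball : ∀ a ∈ A, ∃ ρ, 0 < ρ ∧ Metric.closedBall a ρ ⊆ A := fun a ha =>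
      Metric.nhds_basis_closedBall.mem_iff.1 (hA.isOpen.mem_nhds ha)
    choose! ρ hρ using hball
    obtain ⟨t, htA, htd, hAt⟩ :=
      exists_closedBall_partition (hKc.of_isClosed_subset hA.isClosed hAK) ρ hρ
    have hAm : μ A = ∑ a ∈ t, μ (Metric.closedBall a (ρ a)) := by
      conv_lhs => rw [hAt]
      exact measure_biUnion_finset htd fun a _ => Metric.isClosed_closedBall.measurableSet
    have hpre : τ ⁻¹' A ∩ K ⊆ ⋃ a ∈ t, τ ⁻¹' Metric.closedBall a (ρ a) ∩ K := by
      intro x hx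
      have h1 : τ x ∈ ⋃ a ∈ t, Metric.closedBall a (ρ a) := hAt ▸ hx.1
      obtain ⟨a, ha, h2⟩ := mem_iUnion₂.1 h1
      exact mem_iUnion₂.2 ⟨a, ha, h2, hx.2⟩
    refine (measure_mono hpre).trans ((measure_biUnion_finset_le _ _).trans ?_)
    rw [hAm]
    refine Finset.sum_le_sum fun a _ => ?_
    rcases (τ ⁻¹' Metric.closedBall a (ρ a) ∩ K).eq_empty_or_nonempty with he | ⟨y, hy, hyK⟩
    · rw [he, measure_empty]; exact zero_le
    · rw [μ.addHaar_closedBall_center a, ← μ.addHaar_closedBall_center y]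
      refine measure_mono fun x hx => ?_
      rw [Metric.mem_closedBall, dist_eq_norm, ← hτ x hx.2 y hyK, ← dist_eq_norm]
      refine (dist_triangle_max _ a _).trans (max_le hx.1 ?_)
      rw [dist_comm]
      exact hy
  have hclopen : ∀ A ⊆ K, IsClopen A → μ (τ ⁻¹' A ∩ K) = μ A := by
    intro A hAK hA
    refine le_antisymm (hle A hAK hA) ?_
    have h1 := hle (K \ A) sdiff_subset (IsClopen.diff ⟨hKc.isClosed, hKo⟩ hA)
    have h2 : μ K ≤ μ (τ ⁻¹' A ∩ K) + μ (τ ⁻¹' (K \ A) ∩ K) := by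
      refine (measure_mono fun x hx => ?_).trans (measure_union_le _ _)
      by_cases hxA : τ x ∈ A
      · exact .inl ⟨hxA, hx⟩
      · exact .inr ⟨⟨hmaps x hx, hxA⟩, hx⟩
    have h3 : μ A + μ (K \ A) = μ K := by
      rw [← measure_union disjoint_sdiff_self_right (hKm.diff hA.isOpen.measurableSet),
        union_sdiff_cancel hAK]
    have h4 : μ (K \ A) ≠ ∞ := ((measure_mono sdiff_subset).trans_lt hKc.measure_lt_top).ne
    rw [← h3] at h2
    exact (ENNReal.add_le_add_iff_right h4).1 (h2.trans (add_le_add_right h1 _))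
  have hfin : IsFiniteMeasure (μ.restrict K) := ⟨by
    rw [Measure.restrict_apply_univ]; exact hKc.measure_lt_top⟩
  have hall : ∀ A, IsClopen A → (μ.restrict K).map τ A = μ.restrict K A := by
    intro A hA
    rw [happ A hA.isOpen.measurableSet, Measure.restrict_apply' hKm,
      ← hclopen (A ∩ K) inter_subset_right (hA.inter ⟨hKc.isClosed, hKo⟩)]
    congr 1
    ext x
    exact ⟨fun h => ⟨⟨h.1, hmaps x h.2⟩, h.2⟩, fun h => ⟨h.1.1, h.2⟩⟩
  refine ext_of_generate_finite {s : Set V | IsClopen s} ?_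
    (fun s hs t ht _ => hs.inter ht) hall (hall _ isClopen_univ)
  rw [BorelSpace.measurable_eq (α := V)]
  exact loc_compact_Haus_tot_disc_of_zero_dim.borel_eq_generateFrom

end Isometric

section Twist
variable {p : ℕ} [Fact p.Prime] [MeasurableSpace ℚ_[p]] [BorelSpace ℚ_[p]]
variable {ν : Measure ℚ_[p]} [ν.IsAddHaarMeasure]
variable {ι : Type*} [Fintype ι] [DecidableEq ι]

lemma norm_update_mul_sub (i : ι) {ω : (ι → ℚ_[p]) → ℚ_[p]} {r L : ℝ} (hr : 0 ≤ r)
    (hrL : r * L < 1)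
    (h1 : ∀ x ∈ Metric.closedBall (0 : ι → ℚ_[p]) r, ‖ω x‖ = 1)
    (h2 : ∀ x ∈ Metric.closedBall (0 : ι → ℚ_[p]) r, ∀ y ∈ Metric.closedBall (0 : ι → ℚ_[p]) r,
      ‖ω x - ω y‖ ≤ L * ‖x - y‖)
    {x y : ι → ℚ_[p]} (hx : x ∈ Metric.closedBall 0 r) (hy : y ∈ Metric.closedBall 0 r) :
    ‖Function.update x i (ω x * x i) - Function.update y i (ω y * y i)‖ = ‖x - y‖ := by
  set d := Function.update x i (ω x * x i) - Function.update y i (ω y * y i) with hd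
  have hdj : ∀ j, j ≠ i → d j = (x - y) j := fun j hj => by simp [hd, hj]
  have hdi : d i = ω x * (x i - y i) + (ω x - ω y) * y i := by
    simp only [hd, Pi.sub_apply, Function.update_self]; ring
  have herr : ‖(ω x - ω y) * y i‖ ≤ r * L * ‖x - y‖ := by
    rw [norm_mul, mul_comm, mul_assoc]
    refine mul_le_mul ?_ (h2 x hx y hy) (norm_nonneg _) hr
    exact (norm_le_pi_norm y i).trans (mem_closedBall_zero_iff.1 hy)
  have hmain : ‖ω x * (x i - y i)‖ = ‖x i - y i‖ := by rw [norm_mul, h1 x hx, one_mul]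
  refine le_antisymm ((pi_norm_le_iff_of_nonneg (norm_nonneg _)).2 fun j => ?_) ?_
  · by_cases hj : j = i
    · subst hj
      rw [hdi]
      refine (IsUltrametricDist.norm_add_le_max _ _).trans (max_le ?_ (herr.trans ?_))
      · rw [hmain]; exact norm_le_pi_norm (x - y) j
      · exact mul_le_of_le_one_left (norm_nonneg _) hrL.le
    · rw [hdj j hj]; exact norm_le_pi_norm (x - y) j
  · have h3 : ‖x - y‖ ≤ max ‖d‖ (r * L * ‖x - y‖) := by
      refine (pi_norm_le_iff_of_nonneg (le_max_of_le_left (norm_nonneg _))).2 fun j => ?_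
      by_cases hj : j = i
      · subst hj
        have h4 : ω x * (x j - y j) = d j + -((ω x - ω y) * y j) := by rw [hdi]; ring
        rw [Pi.sub_apply, ← hmain, h4]
        exact (IsUltrametricDist.norm_add_le_max _ _).trans
          (max_le_max (norm_le_pi_norm d j) (by rwa [norm_neg]))
      · rw [← hdj j hj]; exact le_max_of_le_left (norm_le_pi_norm d j)
    rcases le_max_iff.1 h3 with h | h
    · exact h
    · have h5 : ‖x - y‖ ≤ 0 := by nlinarith [norm_nonneg (x - y)]
      exact h5.trans (norm_nonneg _)

lemma eventually_setIntegral_twist (i : ι) {ω : (ι → ℚ_[p]) → ℚ_[p]}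
    {ω' : (ι → ℚ_[p]) →L[ℚ_[p]] ℚ_[p]} (hω : HasStrictFDerivAt ω ω' 0)
    (h1 : ∀ᶠ x in 𝓝 0, ‖ω x‖ = 1) :
    ∀ᶠ r in 𝓝[>] (0 : ℝ), ∀ G : (ι → ℚ_[p]) → ℂ, Measurable G →
      ∫ x in Metric.closedBall 0 r, G (Function.update x i (ω x * x i))
        ∂(Measure.pi fun _ => ν) = ∫ x in Metric.closedBall 0 r, G x ∂(Measure.pi fun _ => ν) := by
  obtain ⟨L, s, hs, hLs⟩ := hω.exists_lipschitzOnWith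
  obtain ⟨ε, hε, hεs⟩ := Metric.nhds_basis_closedBall.mem_iff.1 (Filter.inter_mem hs h1)
  have hlt : ∀ᶠ r in 𝓝[>] (0 : ℝ), r * (L : ℝ) < 1 := by
    refine nhdsWithin_le_nhds ?_
    have : Tendsto (fun r : ℝ => r * (L : ℝ)) (𝓝 0) (𝓝 0) := by
      simpa using (tendsto_id (x := 𝓝 (0 : ℝ))).mul_const (L : ℝ)
    exact this.eventually (gt_mem_nhds one_pos)
  filter_upwards [hlt, Ioo_mem_nhdsGT hε] with r hrL hr G hG
  have hsub : Metric.closedBall (0 : ι → ℚ_[p]) r ⊆ s ∩ {x | ‖ω x‖ = 1} :=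
    (Metric.closedBall_subset_closedBall hr.2.le).trans hεs
  obtain ⟨hae, hmap⟩ := map_restrict_closedBall_of_isometric (Measure.pi fun _ : ι => ν) hr.1
    (τ := fun x => Function.update x i (ω x * x i)) (by simp)
    fun x hx y hy => norm_update_mul_sub i hr.1.le hrL (fun x hx => (hsub hx).2)
      (fun x hx y hy => by
        simpa [dist_eq_norm] using hLs.dist_le_mul x (hsub hx).1 y (hsub hy).1) hx hy
  conv_rhs => rw [← hmap]
  exact (integral_map hae hG.aestronglyMeasurable).symm

end Twist

section Centered
variable {p : ℕ} [Fact p.Prime] [MeasurableSpace ℚ_[p]] [BorelSpace ℚ_[p]]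
variable {ν : Measure ℚ_[p]} [ν.IsAddHaarMeasure]
variable {ι : Type*} [Fintype ι] [DecidableEq ι]

lemma eventually_norm_eq_of_analyticAt {u : (ι → ℚ_[p]) → ℚ_[p]} {a : ι → ℚ_[p]}
    (hu : AnalyticAt ℚ_[p] u a) (hu0 : u a ≠ 0) : ∀ᶠ x in 𝓝 a, ‖u x‖ = ‖u a‖ := by
  have h1 : Tendsto (fun x => u x / u a) (𝓝 a) (𝓝 1) := by
    simpa [hu0] using hu.continuousAt.tendsto.div_const (u a)
  filter_upwards [h1.eventually eventually_norm_eq_one] with x hx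
  rwa [norm_div, div_eq_one_iff_eq (norm_ne_zero_iff.2 hu0)] at hx

lemma tendsto_zpow_neg_nhdsGT : Tendsto (fun N : ℕ => (p : ℝ) ^ (-(N : ℤ))) atTop (𝓝[>] 0) := by
  refine tendsto_nhdsWithin_iff.2 ⟨?_, .of_forall fun N => zpow_pos prime_pos_real _⟩
  have := tendsto_pow_atTop_nhds_zero_of_lt_one (inv_nonneg.2 prime_pos_real.le)
    (inv_lt_one_of_one_lt₀ (one_lt_prime_real (p := p)))
  simpa using this

lemma eventually_forall_mem_closedBall {P : (ι → ℚ_[p]) → Prop} {a : ι → ℚ_[p]}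
    (hP : ∀ᶠ x in 𝓝 a, P x) :
    ∀ᶠ r in 𝓝[>] (0 : ℝ), ∀ x ∈ Metric.closedBall a r, P x := by
  obtain ⟨ε, hε, hεP⟩ := Metric.nhds_basis_closedBall.eventually_iff.1 hP
  filter_upwards [Ioo_mem_nhdsGT hε] with r hr x hx
  exact hεP (Metric.closedBall_subset_closedBall hr.2.le hx)

lemma exists_zpow_root {k : ℤ} (hk : k ≠ 0) {q : (ι → ℚ_[p]) → ℚ_[p]}
    (hq : AnalyticAt ℚ_[p] q 0) (hq0 : q 0 ≠ 0) :
    ∃ (ω : (ι → ℚ_[p]) → ℚ_[p]) (ω' : (ι → ℚ_[p]) →L[ℚ_[p]] ℚ_[p]),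
      HasStrictFDerivAt ω ω' 0 ∧ (∀ᶠ x in 𝓝 0, ‖ω x‖ = 1) ∧
        ∀ᶠ x in 𝓝 0, q 0 * ω x ^ k = q x := by
  have hd := hasStrictDerivAt_zpow (𝕜 := ℚ_[p]) k 1 (.inl one_ne_zero)
  have hd0 : (k : ℚ_[p]) * 1 ^ (k - 1) ≠ 0 := by simpa using hk
  have hr := hd.eventually_right_inverse hd0
  have hρ := hd.to_localInverse hd0
  generalize HasStrictDerivAt.localInverse _ _ _ hd hd0 = ρ at hr hρ
  generalize ((k : ℚ_[p]) * 1 ^ (k - 1))⁻¹ = c at hρ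
  rw [one_zpow] at hr hρ
  have hq1 : AnalyticAt ℚ_[p] (fun x => (q 0)⁻¹ * q x) 0 := analyticAt_const.mul hq
  have hq11 : (q 0)⁻¹ * q 0 = 1 := inv_mul_cancel₀ hq0
  rw [← hq11] at hρ
  have hroot : ∀ᶠ x in 𝓝 0, ρ ((q 0)⁻¹ * q x) ^ k = (q 0)⁻¹ * q x := by
    have := hq1.continuousAt.tendsto
    rw [hq11] at this
    exact this.eventually hr
  refine ⟨fun x => ρ ((q 0)⁻¹ * q x), _,
    HasStrictDerivAt.comp_hasStrictFDerivAt (f := fun x => (q 0)⁻¹ * q x) 0 hρ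
      hq1.hasStrictFDerivAt, ?_, ?_⟩
  · filter_upwards [hroot, eventually_norm_eq_of_analyticAt hq1 (by simp [hq0])] with x hx h1
    rw [← hx, hq11, norm_one, norm_zpow, zpow_eq_one_iff_of_ne_zero₀ hk] at h1
    refine h1.resolve_right fun h2 => ?_
    linarith [norm_nonneg (ρ ((q 0)⁻¹ * q x)), h2.1]
  · filter_upwards [hroot] with x hx
    rw [hx, mul_inv_cancel_left₀ hq0]

lemma eventually_mem_asym_closedBall {Ψ : ℚ_[p] → ℂ} (hΨc : Continuous Ψ)
    (hΨ : ∀ x, ‖Ψ x‖ = 1) (hΨ1 : ∀ x, ‖x‖ ≤ 1 → Ψ x = 1)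
    {f g J : (ι → ℚ_[p]) → ℚ_[p]} (hf : MonUnit f) (hg : MonUnit g) (hJ : MonUnit J) :
    ∀ᶠ N : ℕ in atTop, (fun z => ∫ x in Metric.closedBall 0 ((p : ℝ) ^ (-(N : ℤ))),
      osc Ψ (fun x => f x / g x) (fun x => (‖J x‖ : ℂ)) z x ∂(Measure.pi fun _ => ν)) ∈
        asym p := by
  obtain ⟨kf, uf, huf, huf0, hf⟩ := hf
  obtain ⟨kg, ug, hug, hug0, hg⟩ := hg
  obtain ⟨kJ, uJ, huJ, huJ0, hJ⟩ := hJ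
  have hrt := tendsto_zpow_neg_nhdsGT (p := p)
  have hball : ∀ P : (ι → ℚ_[p]) → Prop, (∀ᶠ x in 𝓝 0, P x) →
      ∀ᶠ N : ℕ in atTop, ∀ x ∈ Metric.closedBall 0 ((p : ℝ) ^ (-(N : ℤ))), P x :=
    fun P hP => hrt.eventually (eventually_forall_mem_closedBall hP)
  set q : (ι → ℚ_[p]) → ℚ_[p] := fun x => uf x / ug x with hq
  have hqa : AnalyticAt ℚ_[p] q 0 := huf.div hug hug0
  have hq0 : q 0 ≠ 0 := div_ne_zero huf0 hug0
  by_cases hk : kf = kg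
  · filter_upwards [hball _ (hf.and (hg.and (eventually_norm_eq_of_analyticAt hqa hq0)))] with N hN
    refine asym_of_eventually_eq_zero ?_
    have hz : ∀ᶠ z : ℚ_[p] in 𝓝[≠] 0, ‖z‖ * ‖q 0‖ ≤ 1 := by
      refine nhdsWithin_le_nhds ?_
      have : Tendsto (fun z : ℚ_[p] => ‖z‖ * ‖q 0‖) (𝓝 0) (𝓝 0) := by
        simpa using (continuous_norm.tendsto (0 : ℚ_[p])).mul_const ‖q 0‖
      exact (this.eventually (gt_mem_nhds one_pos)).mono fun _ h => h.le
    filter_upwards [hz] with z hz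
    refine setIntegral_eq_zero_of_forall_eq_zero fun x hx => ?_
    obtain ⟨h1, h2, h3⟩ := hN x hx
    rw [osc, hΨ1, sub_self, zero_mul]
    rw [norm_mul, h1, h2, hk, mul_div_mul_comm, norm_mul, h3, norm_div]
    refine le_trans (mul_le_mul_of_nonneg_left ?_ (norm_nonneg _)) hz
    exact mul_le_of_le_one_left (norm_nonneg _) (div_self_le_one _)
  · obtain ⟨i, hi⟩ := Function.ne_iff.1 hk
    let κ : ι → ℤ := fun i => kf i - kg i
    have hκ : κ i ≠ 0 := sub_ne_zero.2 (by exact_mod_cast hi)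
    let R : (ι → ℚ_[p]) → ℚ_[p] := fun x => q 0 * (monom kf x / monom kg x)
    let W : (ι → ℚ_[p]) → ℂ := fun x => ((‖monom kJ x‖ * ‖uJ 0‖ : ℝ) : ℂ)
    have hmc : ∀ k, Continuous (monom k : (ι → ℚ_[p]) → ℚ_[p]) := fun k => by
      unfold monom; fun_prop
    have hR : Measurable R := ((hmc kf).measurable.div (hmc kg).measurable).const_mul _
    have hWc : Continuous W :=
      Complex.continuous_ofReal.comp ((hmc kJ).norm.mul continuous_const)
    have hW : LocBdd W := ⟨hWc.measurable, exists_norm_le_of_continuous hWc⟩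
    have hRh : ∀ i t, t ≠ 0 → ∀ x, R (Function.update x i (t * x i)) = t ^ κ i * R x := by
      intro i t ht x
      simp only [R, κ, monom_update_mul, zpow_sub₀ ht, zpow_natCast]
      field_simp
    have hWh : ∀ i t x, W (Function.update x i (t * x i)) = (‖t‖ : ℂ) ^ kJ i * W x := by
      intro i t x
      simp only [W, monom_update_mul, norm_mul, norm_pow]
      push_cast
      ring
    obtain ⟨ω, ω', hω, hω1, hωq⟩ := exists_zpow_root hκ hqa hq0
    filter_upwards [hrt.eventually (eventually_setIntegral_twist (ν := ν) i hω hω1),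
      hball _ (hf.and (hg.and (hJ.and (hω1.and (hωq.and
        (eventually_norm_eq_of_analyticAt huJ huJ0))))))] with N htw hN
    have hRb : ∃ B, ∀ x ∈ box ((p : ℝ) ^ (-(N : ℤ))) (Finset.univ : Finset ι), ‖R x‖ ≤ B := by
      set r := (p : ℝ) ^ (-(N : ℤ))
      refine ⟨‖q 0‖ * ((∏ i, r ^ kf i) / ∏ i, r ^ kg i), fun x hx => le_of_eq ?_⟩
      have hx : ∀ i, ‖x i‖ = r := fun i => (hx i).2 (Finset.mem_univ i)
      simp only [R, monom, norm_mul, norm_div, norm_prod, norm_pow, hx]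
    convert mem_asym_of_homogeneous (ν := ν) hΨc hΨ hΨ1 hR hW hRh hWh N hRb hκ using 2 with z
    rw [← htw _ (locBdd_osc hΨc hΨ hR hW z).measurable]
    refine setIntegral_congr_fun Metric.isClosed_closedBall.measurableSet fun x hx => ?_
    obtain ⟨h1, h2, h3, h4, h5, h6⟩ := hN x hx
    have hω0 : ω x ≠ 0 := by intro h; simp [h] at h4
    simp only [osc]
    rw [hRh i _ hω0, hWh, h4, Complex.ofReal_one, one_pow, one_mul, h1, h2, h3]
    congr 4
    · simp only [R]
      rw [mul_left_comm, ← mul_assoc, h5, mul_div_mul_comm, mul_comm]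
    · simp only [norm_mul, h6]

end Centered

section Translate
variable {𝕜 : Type*} [NontriviallyNormedField 𝕜] [CompleteSpace 𝕜]
  {ι : Type*} [Fintype ι] [DecidableEq ι]

lemma MonUnit.finsetProd {κ : Type*} (s : Finset κ) {F : κ → (ι → 𝕜) → 𝕜}
    (hF : ∀ j ∈ s, MonUnit (F j)) : MonUnit fun x => ∏ j ∈ s, F j x := by
  classical
  induction s using Finset.induction_on with
  | empty => simpa using MonUnit.of_unit (analyticAt_const (v := (1 : 𝕜))) one_ne_zero
  | insert j s hj ih =>
    simp_rw [Finset.prod_insert hj]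
    exact (hF j (Finset.mem_insert_self _ _)).mul
      (ih fun i hi => hF i (Finset.mem_insert_of_mem hi))

lemma analyticAt_comp_add {u : (ι → 𝕜) → 𝕜} {a : ι → 𝕜} (hu : AnalyticAt 𝕜 u a) :
    AnalyticAt 𝕜 (fun y => u (a + y)) 0 :=
  AnalyticAt.fun_comp (g := u) (f := fun y => a + y) (by simpa using hu)
    (analyticAt_const.add analyticAt_id)

lemma tendsto_add_nhds (a : ι → 𝕜) : Tendsto (fun y => a + y) (𝓝 0) (𝓝 a) := by
  simpa using (continuous_const.add continuous_id).tendsto (0 : ι → 𝕜) (f := fun y => a + y)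

lemma MonUnit.eventually_translate {F : (ι → 𝕜) → 𝕜} (hF : MonUnit F) :
    ∀ᶠ a in 𝓝 0, MonUnit fun y => F (a + y) := by
  obtain ⟨k, u, hu, hu0, hF⟩ := hF
  filter_upwards [hF.eventually_nhds, hu.eventually_analyticAt,
    hu.continuousAt.eventually_ne hu0] with a ha hua hu0a
  have h1 : MonUnit fun y => PadicOsc.monom k (a + y) := by
    refine MonUnit.finsetProd _ fun i _ => ?_
    by_cases hi : a i = 0
    · simpa [hi] using MonUnit.coord_pow i (k i)
    · exact MonUnit.of_unit ((analyticAt_const.add (analyticAt_coord i 0)).pow _) (by simp [hi])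
  have h2 : MonUnit fun y => u (a + y) :=
    MonUnit.of_unit (analyticAt_comp_add hua) (by simpa using hu0a)
  exact (h1.mul h2).congr ((tendsto_add_nhds a).eventually ha)

end Translate

section Local
variable {p : ℕ} [Fact p.Prime] [MeasurableSpace ℚ_[p]] [BorelSpace ℚ_[p]]
variable {ν : Measure ℚ_[p]} [ν.IsAddHaarMeasure]
variable {ι : Type*} [Fintype ι] [DecidableEq ι] {X : Type*}

lemma mem_of_locally {Q : Submodule ℂ (X → ℂ)} {G : X → (ι → ℚ_[p]) → ℂ}
    (hG : ∀ z, LocBdd (G z)) {C : Set (ι → ℚ_[p])} (hC : IsCompact C) (hCo : IsOpen C)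
    (h : ∀ a ∈ C, ∀ᶠ N : ℕ in atTop,
      (fun z => ∫ y in Metric.closedBall 0 ((p : ℝ) ^ (-(N : ℤ))), G z (a + y)
        ∂(Measure.pi fun _ => ν)) ∈ Q) :
    (fun z => ∫ x in C, G z x ∂(Measure.pi fun _ => ν)) ∈ Q := by
  have hN : ∀ a ∈ C, ∃ N : ℕ, Metric.closedBall a ((p : ℝ) ^ (-(N : ℤ))) ⊆ C ∧
      (fun z => ∫ y in Metric.closedBall 0 ((p : ℝ) ^ (-(N : ℤ))), G z (a + y)
        ∂(Measure.pi fun _ => ν)) ∈ Q := fun a ha =>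
    ((tendsto_zpow_neg_nhdsGT.eventually
      (eventually_forall_mem_closedBall (hCo.mem_nhds ha))).and (h a ha)).exists
  choose! N hN using hN
  obtain ⟨t, htC, htd, hCt⟩ := exists_closedBall_partition hC (fun a => (p : ℝ) ^ (-(N a : ℤ)))
    fun a ha => ⟨zpow_pos prime_pos_real _, (hN a ha).1⟩
  obtain ⟨r, hr⟩ := hC.isBounded.exists_norm_le
  have key : (fun z => ∫ x in C, G z x ∂(Measure.pi fun _ => ν)) =
      ∑ a ∈ t, fun z => ∫ y in Metric.closedBall 0 ((p : ℝ) ^ (-(N a : ℤ))), G z (a + y)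
        ∂(Measure.pi fun _ => ν) := by
    funext z
    have hInt := (hG z).integrableOn (ν := ν) hC.measurableSet hr
    rw [Finset.sum_apply]
    conv_lhs => rw [hCt]
    rw [integral_biUnion_finset t (fun a _ => Metric.isClosed_closedBall.measurableSet) htd
      fun a ha => hInt.mono_set (hN a (htC a ha)).1]
    refine Finset.sum_congr rfl fun a _ => ?_
    have hmp := measurePreserving_add_left (Measure.pi fun _ : ι => ν) a
    rw [← hmp.setIntegral_preimage_emb (measurableEmbedding_addLeft a)]
    congr 2
    ext y
    simp [dist_eq_norm]
  rw [key]
  exact Q.sum_mem fun a ha => (hN a (htC a ha)).2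

lemma loc_asym {Ψ : ℚ_[p] → ℂ} (hΨc : Continuous Ψ)
    (hΨ : ∀ x, ‖Ψ x‖ = 1) (hΨ1 : ∀ x, ‖x‖ ≤ 1 → Ψ x = 1)
    {f g J : (ι → ℚ_[p]) → ℚ_[p]} (hfc : Continuous f) (hgc : Continuous g) (hJc : Continuous J)
    (hf : MonUnit f) (hg : MonUnit g) (hJ : MonUnit J) :
    Loc ν (asym p) fun z x => (Ψ (z * (f x / g x)) - 1) * (‖J x‖ : ℂ) := by
  filter_upwards [eventually_forall_mem_closedBall (hf.eventually_translate.and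
    (hg.eventually_translate.and hJ.eventually_translate))] with ε hε C hC hCo hCε
  have hJc' : Continuous fun x => (‖J x‖ : ℂ) := Complex.continuous_ofReal.comp hJc.norm
  refine mem_of_locally (fun z => locBdd_osc (R := fun x => f x / g x) (W := fun x => (‖J x‖ : ℂ))
    hΨc hΨ (hfc.measurable.div hgc.measurable) ⟨hJc'.measurable, exists_norm_le_of_continuous hJc'⟩
    z) hC hCo fun a ha => ?_
  obtain ⟨h1, h2, h3⟩ := hε a (hCε ha)
  exact eventually_mem_asym_closedBall hΨc hΨ hΨ1 h1 h2 h3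

lemma MonUnit.eventually_ae_ne_zero {f : (ι → ℚ_[p]) → ℚ_[p]} (hf : MonUnit f) :
    ∀ᶠ r in 𝓝[>] (0 : ℝ), ∀ᵐ x ∂(Measure.pi fun _ : ι => ν),
      x ∈ Metric.closedBall 0 r → f x ≠ 0 := by
  obtain ⟨k, u, hu, hu0, hf⟩ := hf
  filter_upwards [eventually_forall_mem_closedBall (hf.and (hu.continuousAt.eventually_ne hu0))]
    with r hr
  have hae : ∀ᵐ x ∂(Measure.pi fun _ : ι => ν), ∀ i, x i ≠ 0 :=
    ae_all_iff.2 fun i => ae_coord_ne_zero ν i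
  filter_upwards [hae] with x hx hxr
  rw [(hr x hxr).1]
  exact mul_ne_zero (monom_ne_zero fun i hi => absurd hi (hx i)) (hr x hxr).2

open Classical in
lemma loc_null {f g J : (ι → ℚ_[p]) → ℚ_[p]} (hf : MonUnit f) (hg : MonUnit g) :
    Loc ν (⊥ : Submodule ℂ (X → ℂ)) fun _ x =>
      (if f x = 0 ∨ g x = 0 then 1 else 0) * (‖J x‖ : ℂ) := by
  filter_upwards [hf.eventually_ae_ne_zero (ν := ν), hg.eventually_ae_ne_zero (ν := ν)] with
    ε h1 h2 C hC hCo hCε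
  rw [Submodule.mem_bot]
  funext z
  refine setIntegral_eq_zero_of_ae_eq_zero ?_
  filter_upwards [h1, h2] with x hx1 hx2 hxC
  rw [if_neg, zero_mul]
  exact not_or.2 ⟨hx1 (hCε hxC), hx2 (hCε hxC)⟩

lemma eventually_mem_of_analytic {Q : Submodule ℂ (X → ℂ)} {H : X → ℚ_[p] → ℚ_[p] → ℂ}
    (hH : ∀ z, Measurable fun q : ℚ_[p] × ℚ_[p] => H z q.1 q.2)
    (hH' : ∀ z, ∃ B, ∀ a b, ‖H z a b‖ ≤ B)
    (hbase : ∀ f g J : (ι → ℚ_[p]) → ℚ_[p], Continuous f → Continuous g → Continuous J →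
      MonUnit f → MonUnit g → MonUnit J → Loc ν Q fun z x => H z (f x) (g x) * (‖J x‖ : ℂ))
    {f g : (ι → ℚ_[p]) → ℚ_[p]} (hfc : Continuous f) (hgc : Continuous g) {a : ι → ℚ_[p]}
    (hf : AnalyticAt ℚ_[p] f a) (hg : AnalyticAt ℚ_[p] g a)
    (hfg : ¬ ∀ᶠ x in 𝓝 a, f x * g x = 0) :
    ∀ᶠ N : ℕ in atTop, (fun z => ∫ y in Metric.closedBall 0 ((p : ℝ) ^ (-(N : ℤ))),
      H z (f (a + y)) (g (a + y)) ∂(Measure.pi fun _ => ν)) ∈ Q := by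
  have hfa := analyticAt_comp_add hf
  have hga := analyticAt_comp_add hg
  have hF : AnalyticAt ℚ_[p] (fun y => f (a + y) * g (a + y)) 0 := hfa.mul hga
  have hmon := mon_of_analyticAt Finset.univ _ hF (fun x y h => by
    rw [show x = y from funext fun i => h i (by simp)]) (fun h0 => hfg (by
      have h1 : Tendsto (fun x => x - a) (𝓝 a) (𝓝 0) := by
        simpa using (continuous_id.sub continuous_const).tendsto a (f := fun x => x - a)
      filter_upwards [h1.eventually h0] with x hx
      simpa using hx))
  have h := loc_of_mon hH hH' hbase hmon (f := fun y => f (a + y)) (g := fun y => g (a + y))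
    (J := fun _ => 1) (by fun_prop) (by fun_prop) continuous_const hfa hga analyticAt_const
    ⟨_, hga, .rfl⟩ ⟨_, hfa, .of_forall fun x => mul_comm _ _⟩
    ⟨_, hF, .of_forall fun x => (one_mul _).symm⟩
  filter_upwards [(tendsto_zpow_neg_nhdsGT (p := p)).eventually h] with N hN
  have hp : (p : ℝ) ^ (-(N : ℤ)) ≠ 0 := (zpow_pos prime_pos_real _).ne'
  simpa using hN _ (isCompact_closedBall _ _) (IsUltrametricDist.isOpen_closedBall 0 hp) le_rfl

end Local

section Polynomials
variable {p : ℕ} [Fact p.Prime] {ι : Type*} [Fintype ι] [DecidableEq ι]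

lemma not_eventually_eval_eq_zero {P : MvPolynomial ι ℚ_[p]} (hP : P ≠ 0) (a : ι → ℚ_[p]) :
    ¬ ∀ᶠ x in 𝓝 a, MvPolynomial.eval x P = 0 := by
  intro h
  obtain ⟨ε, hε, hεP⟩ := Metric.nhds_basis_ball.eventually_iff.1 h
  refine hP (MvPolynomial.funext_set (fun i => Metric.ball (a i) ε) (fun i => ?_) fun x hx => ?_)
  · exact infinite_of_mem_nhds (a i) (Metric.ball_mem_nhds _ hε)
  · rw [map_zero]
    refine hεP ?_
    rw [ball_pi _ hε]
    exact hx

variable [MeasurableSpace ℚ_[p]] [BorelSpace ℚ_[p]]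
variable (ν : Measure ℚ_[p]) [ν.IsAddHaarMeasure]

open Classical in
lemma measure_zeros_eq_zero {f g : MvPolynomial ι ℚ_[p]} (hf : f ≠ 0) (hg : g ≠ 0) :
    (Measure.pi fun _ : ι => ν) {x | MvPolynomial.eval x f = 0 ∨ MvPolynomial.eval x g = 0} = 0 := by
  set D := {x : ι → ℚ_[p] | MvPolynomial.eval x f = 0 ∨ MvPolynomial.eval x g = 0} with hD
  have hfc := MvPolynomial.continuous_eval f
  have hgc := MvPolynomial.continuous_eval g
  have hDm : MeasurableSet D :=
    ((isClosed_eq hfc continuous_const).union (isClosed_eq hgc continuous_const)).measurableSet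
  let H : Unit → ℚ_[p] → ℚ_[p] → ℂ := fun _ a b => if a = 0 ∨ b = 0 then 1 else 0
  have hH : ∀ z, Measurable fun q : ℚ_[p] × ℚ_[p] => H z q.1 q.2 := fun _ =>
    Measurable.ite ((measurableSet_eq_fun measurable_fst measurable_const).union
      (measurableSet_eq_fun measurable_snd measurable_const)) measurable_const measurable_const
  have hH' : ∀ z a b, ‖H z a b‖ ≤ 1 := fun _ a b => by
    simp only [H]; split_ifs <;> simp
  have hball : ∀ N : ℕ, (Measure.pi fun _ : ι => ν) (D ∩ Metric.closedBall 0 (N + 1)) = 0 := by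
    intro N
    have hN : (N + 1 : ℝ) ≠ 0 := by positivity
    have h := mem_of_locally (ν := ν) (Q := ⊥)
      (G := fun z x => H z (MvPolynomial.eval x f) (MvPolynomial.eval x g))
      (fun z => ⟨(hH z).comp (hfc.measurable.prodMk hgc.measurable), fun _ => ⟨1, fun x _ =>
        hH' z _ _⟩⟩) (isCompact_closedBall (0 : ι → ℚ_[p]) (N + 1))
      (IsUltrametricDist.isOpen_closedBall 0 hN) fun a _ =>
        eventually_mem_of_analytic hH (fun z => ⟨1, hH' z⟩)
          (fun f g J _ _ _ hf hg _ => loc_null hf hg) hfc hgc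
          (AnalyticOnNhd.eval_mvPolynomial f a trivial)
          (AnalyticOnNhd.eval_mvPolynomial g a trivial)
          (by simpa using not_eventually_eval_eq_zero (mul_ne_zero hf hg) a)
    rw [Submodule.mem_bot] at h
    have h1 := congrFun h ()
    have h2 : (fun x => H () (MvPolynomial.eval x f) (MvPolynomial.eval x g)) =
        D.indicator fun _ => (1 : ℂ) := by
      funext x
      simp only [H, indicator_apply, hD, mem_ofPred_eq]
    simp only [h2] at h1
    rw [integral_indicator_const _ hDm] at h1
    have hfin := (isCompact_closedBall (0 : ι → ℚ_[p]) (N + 1)).measure_lt_top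
      (μ := Measure.pi fun _ : ι => ν)
    simpa [measureReal_restrict_apply hDm, measureReal_eq_zero_iff,
      ((measure_mono inter_subset_right).trans_lt hfin).ne] using h1
  have hcover : D ⊆ ⋃ N : ℕ, D ∩ Metric.closedBall 0 (N + 1) := fun x hx => by
    obtain ⟨N, hN⟩ := exists_nat_ge ‖x‖
    exact mem_iUnion.2 ⟨N, hx, by rw [mem_closedBall_zero_iff]; linarith⟩
  exact measure_mono_null hcover (measure_iUnion_null hball)

lemma integral_osc_mem_asym {Ψ : ℚ_[p] → ℂ} (hΨc : Continuous Ψ)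
    (hΨ : ∀ x, ‖Ψ x‖ = 1) (hΨ1 : ∀ x, ‖x‖ ≤ 1 → Ψ x = 1) {Φ : (ι → ℚ_[p]) → ℂ}
    (hΦ : IsLocallyConstant Φ) (hΦc : HasCompactSupport Φ)
    {f g : MvPolynomial ι ℚ_[p]} (hf : f ≠ 0) (hg : g ≠ 0) :
    (fun z => ∫ x, osc Ψ (fun x => MvPolynomial.eval x f / MvPolynomial.eval x g) Φ z x
      ∂(Measure.pi fun _ => ν)) ∈ asym p := by
  have hfc := MvPolynomial.continuous_eval f
  have hgc := MvPolynomial.continuous_eval g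
  have hsupp : IsClopen (Function.support Φ) := (hΦ.isClopen_fiber 0).compl
  have hcpt : IsCompact (Function.support Φ) := by
    have := hΦc.isCompact
    rwa [tsupport, hsupp.isClosed.closure_eq] at this
  have hosc := locBdd_osc (R := fun x => MvPolynomial.eval x f / MvPolynomial.eval x g)
    hΨc hΨ (hfc.measurable.div hgc.measurable)
    ⟨hΦ.continuous.measurable, exists_norm_le_of_continuous hΦ.continuous⟩
  convert mem_of_locally (ν := ν) hosc hcpt hsupp.isOpen fun a _ => ?_ using 2 with z
  · refine (setIntegral_eq_integral_of_forall_compl_eq_zero fun x hx => ?_).symm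
    rw [osc, Function.notMem_support.1 hx, mul_zero]
  · have h := eventually_mem_of_analytic (ν := ν) (Q := asym p)
      (H := fun z a b => Ψ (z * (a / b)) - 1)
      (fun z => (hΨc.measurable.comp
        ((measurable_fst.div measurable_snd).const_mul z)).sub_const 1)
      (fun z => ⟨2, fun a b => (norm_sub_le _ _).trans (by rw [hΨ, norm_one]; norm_num)⟩)
      (fun f g J hfc hgc hJc hf hg hJ => loc_asym hΨc hΨ hΨ1 hfc hgc hJc hf hg hJ) hfc hgc
      (AnalyticOnNhd.eval_mvPolynomial f a trivial) (AnalyticOnNhd.eval_mvPolynomial g a trivial)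
      (by simpa using not_eventually_eval_eq_zero (mul_ne_zero hf hg) a)
    have hconst : ∀ᶠ y in 𝓝 0, Φ (a + y) = Φ a :=
      (tendsto_add_nhds a).eventually (hΦ.eventually_eq a)
    filter_upwards [h, (tendsto_zpow_neg_nhdsGT (p := p)).eventually
      (eventually_forall_mem_closedBall hconst)] with N hN hN'
    convert (asym p).smul_mem (Φ a) hN using 1
    funext z
    rw [Pi.smul_apply, smul_eq_mul, ← integral_const_mul]
    refine setIntegral_congr_fun Metric.isClosed_closedBall.measurableSet fun y hy => ?_
    simp only [osc]
    rw [hN' y hy, mul_comm]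

lemma sub_integral_mem_asym (μ : Measure (ι → ℚ_[p])) [μ.IsAddHaarMeasure]
    {Ψ : ℚ_[p] → ℂ} (hΨc : Continuous Ψ)
    (hΨ : ∀ x, ‖Ψ x‖ = 1) (hΨ1 : ∀ x, ‖x‖ ≤ 1 → Ψ x = 1) {Φ : (ι → ℚ_[p]) → ℂ}
    (hΦ : IsLocallyConstant Φ) (hΦc : HasCompactSupport Φ)
    {f g : MvPolynomial ι ℚ_[p]} (hf : f ≠ 0) (hg : g ≠ 0) :
    (fun z => (∫ x in {x | MvPolynomial.eval x f = 0 ∨ MvPolynomial.eval x g = 0}ᶜ,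
      Φ x * Ψ (z * (MvPolynomial.eval x f / MvPolynomial.eval x g)) ∂μ) - ∫ x, Φ x ∂μ) ∈
        asym p := by
  let ν : Measure ℚ_[p] := Measure.addHaar
  have hμ := Measure.isAddLeftInvariant_eq_smul μ (Measure.pi fun _ : ι => ν)
  set c := μ.addHaarScalarFactor (Measure.pi fun _ : ι => ν)
  have hD : μ {x | MvPolynomial.eval x f = 0 ∨ MvPolynomial.eval x g = 0} = 0 := by
    rw [hμ, Measure.smul_apply, measure_zeros_eq_zero ν hf hg, smul_zero]
  have hfc := MvPolynomial.continuous_eval f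
  have hgc := MvPolynomial.continuous_eval g
  have hΦi : Integrable Φ μ := hΦ.continuous.integrable_of_hasCompactSupport hΦc
  convert (asym p).smul_mem (c : ℂ) (integral_osc_mem_asym ν hΨc hΨ hΨ1 hΦ hΦc hf hg) using 1
  funext z
  have hΨm : Measurable fun x : ι → ℚ_[p] =>
      Ψ (z * (MvPolynomial.eval x f / MvPolynomial.eval x g)) :=
    hΨc.measurable.comp ((hfc.measurable.div hgc.measurable).const_mul z)
  have hInt : Integrable (fun x => Φ x *
      Ψ (z * (MvPolynomial.eval x f / MvPolynomial.eval x g))) μ :=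
    hΦi.mul_bdd (c := 1) hΨm.aestronglyMeasurable (.of_forall fun x => (hΨ _).le)
  have hres : μ.restrict
      {x | MvPolynomial.eval x f = 0 ∨ MvPolynomial.eval x g = 0}ᶜ = μ :=
    Measure.restrict_eq_self_of_ae_mem (compl_mem_ae_iff.2 hD)
  rw [hres, ← integral_sub hInt hΦi]
  conv_lhs => rw [hμ]
  rw [integral_smul_nnreal_measure, Pi.smul_apply, smul_eq_mul, NNReal.smul_def, Complex.real_smul]
  congr 1
  refine integral_congr_ae (.of_forall fun x => ?_)
  simp only [osc]
  ring

end Polynomials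
end PadicOsc

open MeasureTheory Complex MvPolynomial

/-- Expansion of the `p`-adic oscillatory integral `E_Φ(z; f/g)` for small `|z|_p`:
it differs from `∫ Φ` by a finite sum of terms
`e_{γ,m}(ac z)·|z|_p^γ·(ln|z|_p)^{m−1}` with `Re γ > 0`. -/
theorem padic_oscillatory_integral_expansion_small_z
    (p : ℕ) [Fact p.Prime] (n : ℕ)
    [MeasurableSpace (Fin n → ℚ_[p])] [BorelSpace (Fin n → ℚ_[p])]
    (μ : Measure (Fin n → ℚ_[p])) [μ.IsAddHaarMeasure]
    (hμ : μ (Set.univ.pi fun _ : Fin n => {x : ℚ_[p] | ‖x‖ ≤ 1}) = 1)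
    (f g : MvPolynomial (Fin n) ℚ_[p]) (hf : f ≠ 0) (hg : g ≠ 0)
    (hfg : ∀ c : ℚ_[p], f ≠ c • g)
    (Φ : (Fin n → ℚ_[p]) → ℂ) (hΦlc : IsLocallyConstant Φ) (hΦc : HasCompactSupport Φ)
    (Ψ : ℚ_[p] → ℂ)
    (hΨadd : ∀ a b : ℚ_[p], Ψ (a + b) = Ψ a * Ψ b)
    (hΨcont : Continuous Ψ) (hΨnorm : ∀ x : ℚ_[p], ‖Ψ x‖ = 1)
    (hΨtriv : ∀ x : ℚ_[p], ‖x‖ ≤ 1 → Ψ x = 1)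
    (hΨnontriv : ∃ x : ℚ_[p], ‖x‖ ≤ p ∧ Ψ x ≠ 1)
    (D : Set (Fin n → ℚ_[p]))
    (hD : D = {x | eval x f = 0 ∨ eval x g = 0})
    (E : ℚ_[p] → ℂ)
    (hE : ∀ z : ℚ_[p], E z =
      ∫ x in Dᶜ, Φ x * Ψ (z * (eval x f / eval x g)) ∂μ) :
    ∃ (Γ : Finset ℂ) (m : ℂ → ℕ) (e : ℂ → ℕ → ℚ_[p] → ℂ) (δ : ℝ),
      0 < δ ∧
      (∀ γ ∈ Γ, 0 < γ.re) ∧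
      (∀ γ ∈ Γ, 1 ≤ m γ) ∧
      (∀ γ i, IsLocallyConstant (e γ i)) ∧
      ∀ z : ℚ_[p], z ≠ 0 → ‖z‖ < δ →
        E z - (∫ x, Φ x ∂μ) =
          ∑ γ ∈ Γ, ∑ i ∈ Finset.Icc 1 (m γ),
            e γ i (z * (p : ℚ_[p]) ^ (-z.valuation)) *
              ((‖z‖ : ℝ) : ℂ) ^ γ * ((Real.log ‖z‖ : ℝ) : ℂ) ^ (i - 1) := by
  rename_i mpi _ _
  let _ : MeasurableSpace ℚ_[p] := borel _
  have : BorelSpace ℚ_[p] := ⟨rfl⟩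
  obtain rfl : mpi = MeasurableSpace.pi :=
    (BorelSpace.measurable_eq (α := Fin n → ℚ_[p])).trans
      (@BorelSpace.measurable_eq (Fin n → ℚ_[p]) _ MeasurableSpace.pi _).symm
  subst hD
  obtain ⟨Γ, m, e, δ, hδ, hΓ, hm, he, h⟩ := PadicOsc.exists_expansion_of_mem_asym
    (PadicOsc.sub_integral_mem_asym μ hΨcont hΨnorm hΨtriv hΦlc hΦc hf hg)
  refine ⟨Γ, m, e, δ, hδ, hΓ, hm, he, fun z hz hzδ => ?_⟩
  rw [hE]
  exact h z hz hzδ
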